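/- (Fourth link) Let X ⊂ ℙ³ be a smooth cubic surface and a a positive integer. Assume that the ideal I_{Z_{p(a)},X} of a general set of p(a) = (3/2)a(a−1) + 2a + 1 points on X has graded minimal free resolution over R given by 0 → R(−a−3)^{2a} → R(−a−2)^{3a+3} → R(−a)^{a} ⊕ R(−a−1)^{3} → I_{Z_{p(a)},X} → 0. Then the ideal I_{Z_{m(a+1)},X} of a general set of m(a+1) = (3/2)(a+1)a + a + 1 points on X has graded minimal free resolution over R given by 0 → R(−a−4)^{a} → R(−a−2)^{3a+3} → R(−a−1)^{2a+3} → I_{Z_{m(a+1)},X} → 0. -/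

import Mathlib

/-!
Common definitions for formalizing "The minimal resolution conjecture for points
on the cubic surface" (arXiv:math/0611137).

We work with `R = k[x₀,x₁,x₂,x₃]`, closed points of `ℙ³` modeled by
`Projectivization k (Fin 4 → k)`, saturated ideals of sets of points as vanishing
ideals, genericity expressed by a nonempty basic open subset of the configuration
space, and graded minimal free resolutions expressed by explicit homogeneous
matrices whose entries have zero constant term (no nonzero scalar entries).
-/

open MvPolynomial

noncomputable section

/-- The polynomial ring `R = k[x₀,x₁,x₂,x₃]` in four variables over `k`. -/
abbrev R4 (k : Type) [Field k] : Type := MvPolynomial (Fin 4) k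

/-- The (closed) points of the projective space `ℙ³` over `k`. -/
abbrev P3 (k : Type) [Field k] : Type := Projectivization k (Fin 4 → k)

variable (k : Type) [Field k]

/-- A polynomial vanishes at a projective point if it vanishes at every
representative vector of that point. -/
def VanishesAt (f : R4 k) (p : P3 k) : Prop :=
  ∀ (v : Fin 4 → k) (hv : v ≠ 0), Projectivization.mk k v hv = p → eval v f = 0

/-- The saturated homogeneous ideal `I_Z ⊆ R` of a set `Z` of (reduced) points of
`ℙ³`: all polynomials vanishing at every point of `Z`. -/
def pointsIdeal (Zs : Set (P3 k)) : Ideal (R4 k) where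
  carrier := {f | ∀ p ∈ Zs, VanishesAt k f p}
  zero_mem' := by
    intro p _ v hv _
    simp
  add_mem' := by
    intro a b ha hb p hp v hv hmk
    have h1 := ha p hp v hv hmk
    have h2 := hb p hp v hv hmk
    simp [h1, h2]
  smul_mem' := by
    intro c a ha p hp v hv hmk
    have h1 := ha p hp v hv hmk
    simp [smul_eq_mul, h1]

/-- An ideal of `R` is homogeneous if it is generated by homogeneous elements. -/
def IsHomogIdeal (I : Ideal (R4 k)) : Prop :=
  ∃ G : Set (R4 k), (∀ g ∈ G, ∃ d : ℕ, g.IsHomogeneous d) ∧ I = Ideal.span G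

/-- Saturation of an ideal with respect to the irrelevant maximal ideal
`(x₀,…,x₃)`. -/
def satIdeal (I : Ideal (R4 k)) : Ideal (R4 k) where
  carrier := {g | ∀ i : Fin 4, ∃ N : ℕ, (X i : R4 k) ^ N * g ∈ I}
  zero_mem' := by
    intro i
    exact ⟨0, by simp⟩
  add_mem' := by
    intro a b ha hb i
    obtain ⟨N, hN⟩ := ha i
    obtain ⟨M, hM⟩ := hb i
    refine ⟨N + M, ?_⟩
    have h1 : (X i : R4 k) ^ (N + M) * (a + b)
        = X i ^ M * (X i ^ N * a) + X i ^ N * (X i ^ M * b) := by ring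
    rw [h1]
    exact Ideal.add_mem _ (Ideal.mul_mem_left _ _ hN) (Ideal.mul_mem_left _ _ hM)
  smul_mem' := by
    intro c a ha i
    obtain ⟨N, hN⟩ := ha i
    refine ⟨N, ?_⟩
    have h1 : (X i : R4 k) ^ N * (c • a) = c * (X i ^ N * a) := by
      rw [smul_eq_mul]; ring
    rw [h1]
    exact Ideal.mul_mem_left _ _ hN

/-- The colon ideal `(I : J) = {r | r·J ⊆ I}`. -/
def icolon (I J : Ideal (R4 k)) : Ideal (R4 k) where
  carrier := {r | ∀ x ∈ J, r * x ∈ I}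
  zero_mem' := by
    intro x hx
    rw [zero_mul]; exact I.zero_mem
  add_mem' := by
    intro a b ha hb x hx
    rw [add_mul]
    exact Ideal.add_mem _ (ha x hx) (hb x hx)
  smul_mem' := by
    intro c a ha x hx
    rw [smul_eq_mul, mul_assoc]
    exact Ideal.mul_mem_left _ _ (ha x hx)

/-- A smooth cubic surface `X ⊂ ℙ³`: an irreducible homogeneous cubic form with
no singular zero (Jacobian criterion). -/
structure SmoothCubicSurface (k : Type) [Field k] : Type where
  f : MvPolynomial (Fin 4) k
  homog : f.IsHomogeneous 3
  irred : Irreducible f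
  smooth : ∀ v : Fin 4 → k, v ≠ 0 → eval v f = 0 →
    ∃ i : Fin 4, eval v (pderiv i f) ≠ 0

/-- A configuration of `t` distinct points lying on `X`. -/
def ConfigOn (S : SmoothCubicSurface k) {t : ℕ} (Z : Fin t → P3 k) : Prop :=
  Function.Injective Z ∧ ∀ i, VanishesAt k S.f (Z i)

/-- A configuration avoids the (closed locus of the) polynomial `g` on the
product of the affine cones: some choice of representatives does not annihilate `g`. -/
def Avoids {t : ℕ} (g : MvPolynomial (Fin t × Fin 4) k) (Z : Fin t → P3 k) : Prop :=
  ∃ v : Fin t → Fin 4 → k,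
    (∀ i, ∃ hv : v i ≠ 0, Projectivization.mk k (v i) hv = Z i) ∧
    eval (fun q : Fin t × Fin 4 => v q.1 q.2) g ≠ 0

/-- `P` holds for a *general* set of `t` points on `X`: it holds on a nonempty
(basic) Zariski-open subset of the family of all sets of `t` points of `X`. -/
def GeneralPointsSatisfy (S : SmoothCubicSurface k) (t : ℕ)
    (P : (Fin t → P3 k) → Prop) : Prop :=
  ∃ g : MvPolynomial (Fin t × Fin 4) k,
    (∃ Z : Fin t → P3 k, ConfigOn k S Z ∧ Avoids k g Z) ∧
    (∀ Z : Fin t → P3 k, ConfigOn k S Z → Avoids k g Z → P Z)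

/-- An admissible entry of a matrix in a graded **minimal** free resolution,
mapping a generator of degree `d` into a generator of degree `e`: the entry is
homogeneous of degree `d - e`, and it is not a nonzero scalar (zero constant
coefficient). -/
def EntryOk (d e : ℕ) (q : R4 k) : Prop :=
  (q = 0 ∨ ∃ c : ℕ, d = e + c ∧ q.IsHomogeneous c) ∧ coeff 0 q = 0

/-- Integer-degree version of `EntryOk` (for modules with generators of
arbitrary integer degrees). -/
def EntryOkZ (d e : ℤ) (q : R4 k) : Prop :=
  (q = 0 ∨ ∃ c : ℕ, d = e + (c : ℤ) ∧ q.IsHomogeneous c) ∧ coeff 0 q = 0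

/-- The body of a graded minimal free resolution of length 2 over `R` of the
`R`-module `I/J`:
`0 → ⊕ R(-d2 i) --M2--> ⊕ R(-d1 j) --g--> I/J → 0`.
The generators `g j ∈ I` are homogeneous of degree `d1 j` and generate `I` mod `J`;
`M2` is a homogeneous matrix with no nonzero scalar entries whose rows generate the
kernel, and which is injective. -/
def Res2Body (J I : Ideal (R4 k)) {n1 n2 : ℕ}
    (d1 : Fin n1 → ℕ) (d2 : Fin n2 → ℕ)
    (g : Fin n1 → R4 k) (M2 : Fin n2 → Fin n1 → R4 k) : Prop :=
  (∀ j, g j ∈ I ∧ (g j).IsHomogeneous (d1 j)) ∧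
  (∀ x ∈ I, ∃ w : Fin n1 → R4 k, x - ∑ j, w j * g j ∈ J) ∧
  (∀ i j, EntryOk k (d2 i) (d1 j) (M2 i j)) ∧
  (∀ w : Fin n1 → R4 k,
    ((∑ j, w j * g j) ∈ J) ↔ ∃ u : Fin n2 → R4 k, ∀ j, w j = ∑ i, u i * M2 i j) ∧
  (∀ u : Fin n2 → R4 k, (∀ j, (∑ i, u i * M2 i j) = 0) → u = 0)

/-- `I/J` has a graded minimal free resolution
`0 → ⊕ R(-d2 i) → ⊕ R(-d1 j) → I/J → 0` over `R`. -/
def HasMinFreeRes2 (J I : Ideal (R4 k)) {n1 n2 : ℕ}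
    (d1 : Fin n1 → ℕ) (d2 : Fin n2 → ℕ) : Prop :=
  ∃ (g : Fin n1 → R4 k) (M2 : Fin n2 → Fin n1 → R4 k), Res2Body k J I d1 d2 g M2

/-- The body of a graded minimal free resolution of length 3 over `R` of the
`R`-module `I/J`:
`0 → ⊕ R(-d3 l) --M3--> ⊕ R(-d2 i) --M2--> ⊕ R(-d1 j) --g--> I/J → 0`. -/
def Res3Body (J I : Ideal (R4 k)) {n1 n2 n3 : ℕ}
    (d1 : Fin n1 → ℕ) (d2 : Fin n2 → ℕ) (d3 : Fin n3 → ℕ)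
    (g : Fin n1 → R4 k) (M2 : Fin n2 → Fin n1 → R4 k)
    (M3 : Fin n3 → Fin n2 → R4 k) : Prop :=
  (∀ j, g j ∈ I ∧ (g j).IsHomogeneous (d1 j)) ∧
  (∀ x ∈ I, ∃ w : Fin n1 → R4 k, x - ∑ j, w j * g j ∈ J) ∧
  (∀ i j, EntryOk k (d2 i) (d1 j) (M2 i j)) ∧
  (∀ i j, EntryOk k (d3 i) (d2 j) (M3 i j)) ∧
  (∀ w : Fin n1 → R4 k,
    ((∑ j, w j * g j) ∈ J) ↔ ∃ u : Fin n2 → R4 k, ∀ j, w j = ∑ i, u i * M2 i j) ∧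
  (∀ u : Fin n2 → R4 k,
    (∀ j, (∑ i, u i * M2 i j) = 0) ↔ ∃ t : Fin n3 → R4 k, ∀ i, u i = ∑ l, t l * M3 l i) ∧
  (∀ t : Fin n3 → R4 k, (∀ i, (∑ l, t l * M3 l i) = 0) → t = 0)

/-- `I/J` has a graded minimal free resolution
`0 → ⊕ R(-d3 l) → ⊕ R(-d2 i) → ⊕ R(-d1 j) → I/J → 0` over `R`.
Taking `J = ⊥` this is a resolution of the ideal `I ⊆ R`; taking `J = (f)` it is a
resolution of `I/(f) ⊆ R_X = R/(f)`; taking `J = I_C` a resolution of `I/I_C`. -/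
def HasMinFreeRes3 (J I : Ideal (R4 k)) {n1 n2 n3 : ℕ}
    (d1 : Fin n1 → ℕ) (d2 : Fin n2 → ℕ) (d3 : Fin n3 → ℕ) : Prop :=
  ∃ (g : Fin n1 → R4 k) (M2 : Fin n2 → Fin n1 → R4 k) (M3 : Fin n3 → Fin n2 → R4 k),
    Res3Body k J I d1 d2 d3 g M2 M3

/-- The Betti numbers read off from a minimal free resolution
`0 → F₃ → F₂ → F₁ → I_Z → 0` of the ideal of `Z` (so that
`F_i = ⊕_j R(-i-j)^{b_{i,j}}` in the resolution of `R/I_Z`, with `F₀ = R`). -/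
def bettiCount {n1 n2 n3 : ℕ} (d1 : Fin n1 → ℕ) (d2 : Fin n2 → ℕ) (d3 : Fin n3 → ℕ)
    (i j : ℕ) : ℕ :=
  if i = 0 then (if j = 0 then 1 else 0)
  else if i = 1 then (Finset.univ.filter fun l => d1 l = 1 + j).card
  else if i = 2 then (Finset.univ.filter fun l => d2 l = 2 + j).card
  else if i = 3 then (Finset.univ.filter fun l => d3 l = 3 + j).card
  else 0

/-- The Hilbert polynomial `P_X(t) = (3/2)t(t+1) + 1` of the cubic surface. -/
def PXcubic (t : ℕ) : ℕ := 3 * (t * (t + 1) / 2) + 1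

/-- The saturated homogeneous ideal of an integral curve lying on `X`. -/
def IsCurveIdealOn (S : SmoothCubicSurface k) (I : Ideal (R4 k)) : Prop :=
  IsHomogIdeal k I ∧ I.IsPrime ∧ S.f ∈ I ∧
    ringKrullDim (R4 k ⧸ I) = ((2 : ℕ∞) : WithBot ℕ∞)

/-- The Jacobian criterion at a point of the cone: some 2×2 minor of the Jacobian
matrix of elements of `I` is nonzero, i.e. the curve is smooth there. -/
def CurveSmoothAt (I : Ideal (R4 k)) (v : Fin 4 → k) : Prop :=
  ∃ g₁ ∈ I, ∃ g₂ ∈ I, ∃ i j : Fin 4,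
    eval v (pderiv i g₁) * eval v (pderiv j g₂)
      - eval v (pderiv j g₁) * eval v (pderiv i g₂) ≠ 0

/-- A smooth (integral) curve on `X`. -/
def IsSmoothCurveIdealOn (S : SmoothCubicSurface k) (I : Ideal (R4 k)) : Prop :=
  IsCurveIdealOn k S I ∧
  ∀ v : Fin 4 → k, v ≠ 0 → (∀ g ∈ I, eval v g = 0) → CurveSmoothAt k I v

/-- The coordinate ring `R/I` of a curve has depth 2 (a regular sequence of two
positive-degree homogeneous elements), i.e. the curve is arithmetically
Cohen–Macaulay. -/
def IsACMIdeal (I : Ideal (R4 k)) : Prop :=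
  ∃ r₁ r₂ : R4 k,
    (∃ d₁ : ℕ, 0 < d₁ ∧ r₁.IsHomogeneous d₁) ∧
    (∃ d₂ : ℕ, 0 < d₂ ∧ r₂.IsHomogeneous d₂) ∧
    (∀ x : R4 k, r₁ * x ∈ I → x ∈ I) ∧
    (∀ x : R4 k, r₂ * x ∈ I ⊔ Ideal.span {r₁} → x ∈ I ⊔ Ideal.span {r₁})

/-- The Hilbert function `t ↦ dim_k (R/I)_t`. -/
def hilbFn (I : Ideal (R4 k)) (t : ℕ) : ℕ :=
  Module.finrank k ↥(homogeneousSubmodule (Fin 4) k t) -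
    Module.finrank k ↥(homogeneousSubmodule (Fin 4) k t ⊓
      Submodule.restrictScalars k I)

/-- The subscheme with saturated ideal `I` has degree `d` and (arithmetic) genus `g`,
read off from the Hilbert polynomial `P(t) = d·t + 1 - g`. -/
def HasDegreeGenus (I : Ideal (R4 k)) (d : ℕ) (g : ℤ) : Prop :=
  ∃ N : ℕ, ∀ t : ℕ, N ≤ t → (hilbFn k I t : ℤ) = d * t + 1 - g

/-- Linear equivalence of divisors on `X`: the divisor with (divisorial) ideal `I`
is linearly equivalent to (divisor of `J`) + `a·H`, where `H` is the hyperplane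
class.  Concretely, there are homogeneous forms `q, p` with `deg p = deg q + a`,
nonzero on `X`, with `q·I = p·J` in `R_X = R/(f)`.  (Taking `J = ⊤` expresses
that the divisor of `I` is linearly equivalent to `aH`.) -/
def LinEquivOnX (S : SmoothCubicSurface k) (I J : Ideal (R4 k)) (a : ℤ) : Prop :=
  ∃ (mq mp : ℕ) (q p : R4 k), (mp : ℤ) = (mq : ℤ) + a ∧
    q.IsHomogeneous mq ∧ p.IsHomogeneous mp ∧
    q ∉ Ideal.span {S.f} ∧ p ∉ Ideal.span {S.f} ∧
    Ideal.span {q} * I ⊔ Ideal.span {S.f} = Ideal.span {p} * J ⊔ Ideal.span {S.f}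

/-- Linear equivalence, on the curve `C` with ideal `IC`, of the divisor with
ideal `IG` to `r·H_C` (`H_C` the hyperplane section of `C`): there are homogeneous
forms `q, p`, nonzero on `C`, with `deg p = deg q + r` and `q·I_{G,C} = (p)` in
`R/I_C`. -/
def DivOnCurveEquivH (IC IG : Ideal (R4 k)) (r : ℤ) : Prop :=
  ∃ (mq mp : ℕ) (q p : R4 k), (mp : ℤ) = (mq : ℤ) + r ∧
    q.IsHomogeneous mq ∧ p.IsHomogeneous mp ∧ q ∉ IC ∧ p ∉ IC ∧
    Ideal.span {q} * IG ⊔ IC = Ideal.span {p} ⊔ IC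

/-- The saturated homogeneous ideal of a zero-dimensional subscheme of `ℙ³`. -/
def IsZeroDimIdeal (I : Ideal (R4 k)) : Prop :=
  IsHomogIdeal k I ∧ satIdeal k I = I ∧
    ringKrullDim (R4 k ⧸ I) = ((1 : ℕ∞) : WithBot ℕ∞)

/-- An arithmetically Gorenstein zero-dimensional subscheme of `ℙ³`: its ideal has a
graded minimal free resolution of length 3 whose last free module has rank one. -/
def IsAGPointsIdeal (I : Ideal (R4 k)) : Prop :=
  IsZeroDimIdeal k I ∧
  ∃ (n1 n2 : ℕ) (d1 : Fin n1 → ℕ) (d2 : Fin n2 → ℕ) (s : ℕ),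
    HasMinFreeRes3 k ⊥ I d1 d2 (fun _ : Fin 1 => s)

/-- `V₁` and `V₂` are directly Gorenstein linked by the arithmetically Gorenstein
scheme with ideal `IG`: `I_G ⊆ I_{V₁} ∩ I_{V₂}`, `I_G : I_{V₁} = I_{V₂}` and
`I_G : I_{V₂} = I_{V₁}`. -/
def IsGLinked (IG I1 I2 : Ideal (R4 k)) : Prop :=
  IG ≤ I1 ⊓ I2 ∧ icolon k IG I1 = I2 ∧ icolon k IG I2 = I1

/-- The divisor `G` (with ideal `IG`) on the curve `C ⊂ X` (with ideal `IC`) is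
linearly equivalent to `m·H_C - K_C`.  By adjunction on the cubic surface
(`K_X = -H`) this says `G + C|_C ∼ (m+1)·H_C` on `C`, where `C|_C` is realized as
the scheme-theoretic intersection `C ∩ C'` with any curve `C' ∼ C`, `C' ≠ C`,
chosen disjoint from `G`. -/
def EquivHminusKC (S : SmoothCubicSurface k) (IC IG : Ideal (R4 k)) (m : ℤ) : Prop :=
  ∃ IC' : Ideal (R4 k), IsCurveIdealOn k S IC' ∧ IC' ≠ IC ∧
    LinEquivOnX k S IC' IC 0 ∧
    satIdeal k (satIdeal k (IC ⊔ IC') ⊔ IG) = ⊤ ∧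
    DivOnCurveEquivH k IC (IG ⊓ satIdeal k (IC ⊔ IC')) (m + 1)

/-- A line on `X`: a smooth integral curve of degree 1, genus 0 on `X`. -/
def IsLineOn (S : SmoothCubicSurface k) (I : Ideal (R4 k)) : Prop :=
  IsSmoothCurveIdealOn k S I ∧ HasDegreeGenus k I 1 0

/-- A smooth conic on `X`: a smooth integral curve of degree 2, genus 0 on `X`. -/
def IsConicOn (S : SmoothCubicSurface k) (I : Ideal (R4 k)) : Prop :=
  IsSmoothCurveIdealOn k S I ∧ HasDegreeGenus k I 2 0

/-- A twisted cubic on `X`: a smooth integral curve of degree 3, genus 0 on `X`. -/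
def IsTwistedCubicOn (S : SmoothCubicSurface k) (I : Ideal (R4 k)) : Prop :=
  IsSmoothCurveIdealOn k S I ∧ HasDegreeGenus k I 3 0

/-- The curve `C ⊂ X` moves in a linear system of (projective) dimension `dim`,
i.e. `h⁰(O_X(C)) = dim + 1`.  Global sections of `O_X(C)` are computed, for any
homogeneous `q ∈ I_C` of degree `s` not divisible by `f`, as the degree-`s` part of
the colon ideal `((q, f) : I_C)` modulo `(f)`. -/
def MovesInLinSysOfDim (S : SmoothCubicSurface k) (IC : Ideal (R4 k)) (dim : ℤ) : Prop :=
  ∀ (s : ℕ) (q : R4 k), q.IsHomogeneous s → q ∈ IC → q ∉ Ideal.span {S.f} →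
    (Module.finrank k ↥(homogeneousSubmodule (Fin 4) k s ⊓
        Submodule.restrictScalars k (icolon k (Ideal.span {q} ⊔ Ideal.span {S.f}) IC)) : ℤ)
      - (Module.finrank k ↥(homogeneousSubmodule (Fin 4) k s ⊓
        Submodule.restrictScalars k (icolon k (Ideal.span {q} ⊔ Ideal.span {S.f}) IC) ⊓
        Submodule.restrictScalars k (Ideal.span {S.f})) : ℤ) = dim + 1

/-- `I/(f₀)` is a maximal Cohen–Macaulay module over `R/(f₀)` (3-dimensional):
it admits a regular sequence of three positive-degree homogeneous elements. -/
def IsMCMQuotient (f0 : R4 k) (I : Ideal (R4 k)) : Prop :=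
  ∃ r₁ r₂ r₃ : R4 k,
    (∃ d : ℕ, 0 < d ∧ r₁.IsHomogeneous d) ∧
    (∃ d : ℕ, 0 < d ∧ r₂.IsHomogeneous d) ∧
    (∃ d : ℕ, 0 < d ∧ r₃.IsHomogeneous d) ∧
    (∀ x ∈ I, r₁ * x ∈ Ideal.span {f0} → x ∈ Ideal.span {f0}) ∧
    (∀ x ∈ I, r₂ * x ∈ Ideal.span {r₁} * I ⊔ Ideal.span {f0} →
      x ∈ Ideal.span {r₁} * I ⊔ Ideal.span {f0}) ∧
    (∀ x ∈ I, r₃ * x ∈ Ideal.span {r₁} * I ⊔ Ideal.span {r₂} * I ⊔ Ideal.span {f0} →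
      x ∈ Ideal.span {r₁} * I ⊔ Ideal.span {r₂} * I ⊔ Ideal.span {f0}) ∧
    (∃ x ∈ I, x ∉ Ideal.span {r₁} * I ⊔ Ideal.span {r₂} * I ⊔ Ideal.span {r₃} * I
      ⊔ Ideal.span {f0})

end

namespace CubicLink

section Act

variable {S P Q : Type*} [CommRing S] [AddCommGroup P] [Module S P] [AddCommGroup Q] [Module S Q]
variable {ι κ μ : Type*} [Fintype κ] [Fintype μ]

/-- The action of a matrix on tuples of elements of a module. -/
def act (D : Matrix ι κ S) (m : κ → P) : ι → P := fun i => ∑ j, D i j • m j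

lemma act_sub (D : Matrix ι κ S) (m n : κ → P) : act D (m - n) = act D m - act D n := by
  ext i; simp [act, smul_sub]

lemma act_zero (D : Matrix ι κ S) : act D (0 : κ → P) = 0 := by
  ext i; simp [act]

lemma act_zero_matrix (m : κ → P) : act (0 : Matrix ι κ S) m = 0 := by
  ext i; simp [act]

lemma act_smul (D : Matrix ι κ S) (s : S) (m : κ → P) :
    act D (fun j => s • m j) = fun i => s • act D m i := by
  ext i; simp [act, Finset.smul_sum, smul_comm s]

lemma act_act (D : Matrix ι κ S) (E : Matrix κ μ S) (m : μ → P) :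
    act D (act E m) = act (D * E) m := by
  ext i
  simp only [act, Finset.smul_sum, Matrix.mul_apply, Finset.sum_smul, smul_smul]
  exact Finset.sum_comm

lemma act_map (φ : P →ₗ[S] Q) (D : Matrix ι κ S) (m : κ → P) :
    act D (fun j => φ (m j)) = fun i => φ (act D m i) := by
  ext i; simp [act]

lemma act_apply_pi {n : Type*} (D : Matrix ι κ S) (m : κ → n → P) (i : ι) (l : n) :
    act D m i l = act D (fun j => m j l) i := by
  simp [act]

end Act

/-- Exactness of a complex with consecutive matrices `D`, `E` on given subspaces. -/
def KEx {k S P : Type*} [CommRing k] [CommRing S] [AddCommGroup P] [Module S P] [Module k P]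
    {ι κ μ : Type*} [Fintype κ] [Fintype μ] (D : Matrix ι κ S) (E : Matrix κ μ S)
    (G' G : Submodule k P) : Prop :=
  ∀ m : κ → P, (∀ j, m j ∈ G) → act D m = 0 → ∃ n : μ → P, (∀ j, n j ∈ G') ∧ act E n = m

section Syzygy

variable {k S P F : Type*} [CommRing k] [CommRing S] [AddCommGroup P] [Module S P] [Module k P]
variable [AddCommGroup F] [Module S F] [Module k F]
variable {ι κ μ ν : Type*} [Fintype κ] [Fintype μ] [Fintype ν]

/-- Dimension shifting: exactness for the kernel of `φ` one step earlier follows from exactness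
for the source and for the target of `φ`. -/
lemma KEx.ker {D₀ : Matrix ι κ S} {D₁ : Matrix κ μ S} {D₂ : Matrix μ ν S} (h12 : D₁ * D₂ = 0)
    (φ : F →ₗ[S] P) {F₀ F₁ F₂ N₁ N₂ : Submodule k F} {P₀ P₁ : Submodule k P}
    (hF : KEx D₀ D₁ F₁ F₂) (hP : KEx D₁ D₂ P₀ P₁)
    (hN₁ : ∀ x, x ∈ N₁ ↔ x ∈ F₁ ∧ φ x = 0) (hN₂ : ∀ x, x ∈ N₂ ↔ x ∈ F₂ ∧ φ x = 0)
    (hφ : ∀ x ∈ F₁, φ x ∈ P₁) (hsurj : ∀ y ∈ P₀, ∃ x ∈ F₀, φ x = y)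
    (hD₂ : ∀ m : ν → F, (∀ j, m j ∈ F₀) → ∀ i, act D₂ m i ∈ F₁) :
    KEx D₀ D₁ N₁ N₂ := by
  intro m hm h0
  obtain ⟨b, hb, hbm⟩ := hF m (fun j => ((hN₂ _).1 (hm j)).1) h0
  obtain ⟨e, he, hee⟩ := hP (fun j => φ (b j)) (fun j => hφ _ (hb j)) (by
    rw [act_map, hbm]; ext j; exact ((hN₂ _).1 (hm j)).2)
  choose c hc hce using fun j => hsurj (e j) (he j)
  refine ⟨b - act D₂ c, fun j => (hN₁ _).2 ⟨F₁.sub_mem (hb j) (hD₂ c hc j), ?_⟩, ?_⟩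
  · have := congrFun (act_map φ D₂ c) j
    have h2 := congrFun hee j
    simp only [hce] at this
    rw [Pi.sub_apply, map_sub, ← this, ← h2, sub_self]
  · rw [act_sub, hbm, act_act, h12, act_zero_matrix, sub_zero]

lemma KEx.pi {n : Type*} {D : Matrix ι κ S} {E : Matrix κ μ S} {G' G : Submodule k P}
    (h : KEx D E G' G) :
    KEx D E (Submodule.pi Set.univ fun _ : n => G') (Submodule.pi Set.univ fun _ : n => G) := by
  intro m hm h0
  have hm' : ∀ l j, m j l ∈ G := fun l j => (Submodule.mem_pi.1 (hm j)) l (Set.mem_univ l)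
  choose b hb hbm using fun l => h (fun j => m j l) (hm' l) (by
    ext i; rw [← act_apply_pi, h0]; rfl)
  refine ⟨fun j l => b l j, fun j => Submodule.mem_pi.2 fun l _ => hb l j, ?_⟩
  ext i l
  rw [act_apply_pi, hbm]

end Syzygy

section Koszul

variable {S : Type*} [CommRing S]

/-- The empty differential to the left of the Koszul complex. -/
abbrev kosZ (S : Type*) [CommRing S] : Matrix (Fin 0) (Fin 0) S := 0

/-- The zero map out of the last term of the Koszul complex. -/
abbrev kos0 (S : Type*) [CommRing S] : Matrix (Fin 0) (Fin 1) S := 0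

/-- The first differential of the Koszul complex of four elements. -/
def kos1 (x : Fin 4 → S) : Matrix (Fin 1) (Fin 4) S := !![x 0, x 1, x 2, x 3]

/-- The second differential of the Koszul complex of four elements. -/
def kos2 (x : Fin 4 → S) : Matrix (Fin 4) (Fin 6) S :=
  !![x 1, x 2, x 3, 0, 0, 0;
     -x 0, 0, 0, x 2, x 3, 0;
     0, -x 0, 0, -x 1, 0, x 3;
     0, 0, -x 0, 0, -x 1, -x 2]

/-- The third differential of the Koszul complex of four elements. -/
def kos3 (x : Fin 4 → S) : Matrix (Fin 6) (Fin 4) S :=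
  !![0, 0, -x 3, x 2;
     0, x 3, 0, -x 1;
     0, -x 2, x 1, 0;
     -x 3, 0, 0, x 0;
     x 2, 0, -x 0, 0;
     -x 1, x 0, 0, 0]

/-- The fourth differential of the Koszul complex of four elements. -/
def kos4 (x : Fin 4 → S) : Matrix (Fin 4) (Fin 1) S := !![x 0; x 1; x 2; x 3]

/-- The zero map into the first term of the Koszul complex. -/
abbrev kos5 (S : Type*) [CommRing S] : Matrix (Fin 1) (Fin 0) S := 0

lemma kos1_mul_kos2 (x : Fin 4 → S) : kos1 x * kos2 x = 0 := by
  ext i j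
  fin_cases i; fin_cases j <;>
  · simp [kos1, kos2, Matrix.mul_apply, Fin.sum_univ_four]; try ring

lemma kos2_mul_kos3 (x : Fin 4 → S) : kos2 x * kos3 x = 0 := by
  ext i j
  fin_cases i <;> fin_cases j <;>
  · simp [kos2, kos3, Matrix.mul_apply, Fin.sum_univ_six]; try ring

lemma kos3_mul_kos4 (x : Fin 4 → S) : kos3 x * kos4 x = 0 := by
  ext i j
  fin_cases i <;> fin_cases j <;>
  · simp [kos3, kos4, Matrix.mul_apply, Fin.sum_univ_four]; try ring

variable {P : Type*} [AddCommGroup P] [Module S P] (x : Fin 4 → S)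

lemma act_kos1 (m : Fin 4 → P) :
    act (kos1 x) m 0 = x 0 • m 0 + x 1 • m 1 + x 2 • m 2 + x 3 • m 3 := by
  simp [act, kos1, Fin.sum_univ_four]

lemma act_kos2 (n : Fin 6 → P) : act (kos2 x) n =
    ![x 1 • n 0 + x 2 • n 1 + x 3 • n 2, -(x 0 • n 0) + x 2 • n 3 + x 3 • n 4,
      -(x 0 • n 1) - x 1 • n 3 + x 3 • n 5, -(x 0 • n 2) - x 1 • n 4 - x 2 • n 5] := by
  ext i
  fin_cases i <;> simp [act, kos2, Fin.sum_univ_six] <;> try abel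

lemma act_kos3 (w : Fin 4 → P) : act (kos3 x) w =
    ![x 2 • w 3 - x 3 • w 2, x 3 • w 1 - x 1 • w 3, x 1 • w 2 - x 2 • w 1,
      x 0 • w 3 - x 3 • w 0, x 2 • w 0 - x 0 • w 2, x 0 • w 1 - x 1 • w 0] := by
  ext i
  fin_cases i <;> simp [act, kos3, Fin.sum_univ_four] <;> try abel

lemma act_kos4 (u : Fin 1 → P) : act (kos4 x) u = fun i => x i • u 0 := by
  ext i
  fin_cases i <;> simp [act, kos4]

end Koszul

section Variables

variable {σ k : Type*} [Field k]

lemma mem_span_X_of_X_mul_mem {i : σ} {s : Set σ} (hi : i ∉ s) {p : MvPolynomial σ k}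
    (h : X i * p ∈ Ideal.span (X '' s : Set (MvPolynomial σ k))) :
    p ∈ Ideal.span (X '' s : Set (MvPolynomial σ k)) := by
  classical
  rw [mem_ideal_span_X_image] at h ⊢
  intro m hm
  obtain ⟨j, hj, hne⟩ := h (Finsupp.single i 1 + m) (by
    rw [mem_support_iff, coeff_X_mul]; exact mem_support_iff.1 hm)
  refine ⟨j, hj, ?_⟩
  have : i ≠ j := fun e => hi (e ▸ hj)
  simpa [Finsupp.single_apply, this] using hne

lemma syzygy_X₂ {i j : σ} (hij : i ≠ j) {a b : MvPolynomial σ k}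
    (h : X i * a + X j * b = 0) : ∃ p, a = X j * p ∧ b = -(X i * p) := by
  have h1 : X i * a ∈ Ideal.span (X '' {j} : Set (MvPolynomial σ k)) := by
    rw [Set.image_singleton, Ideal.mem_span_singleton]
    exact ⟨-b, by linear_combination h⟩
  have h2 := mem_span_X_of_X_mul_mem (by simpa using hij) h1
  rw [Set.image_singleton, Ideal.mem_span_singleton] at h2
  obtain ⟨p, rfl⟩ := h2
  refine ⟨p, rfl, ?_⟩
  have : X j * (b + X i * p) = 0 := by linear_combination h
  linear_combination (mul_eq_zero.1 this).resolve_left (X_ne_zero j)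

lemma syzygy_X₃ {i j l : σ} (hij : i ≠ j) (hil : i ≠ l) (hjl : j ≠ l)
    {a b c : MvPolynomial σ k} (h : X i * a + X j * b + X l * c = 0) :
    ∃ p q r, a = X j * p + X l * q ∧ b = -(X i * p) + X l * r ∧ c = -(X i * q) - X j * r := by
  have h1 : X l * c ∈ Ideal.span (X '' {i, j} : Set (MvPolynomial σ k)) := by
    rw [Set.image_pair, Ideal.mem_span_pair]
    exact ⟨-a, -b, by linear_combination -h⟩
  have h2 := mem_span_X_of_X_mul_mem (by simp [hil.symm, hjl.symm]) h1
  rw [Set.image_pair, Ideal.mem_span_pair] at h2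
  obtain ⟨q, r, rfl⟩ := h2
  obtain ⟨p, hp, hp'⟩ := syzygy_X₂ hij
    (show X i * (a + X l * q) + X j * (b + X l * r) = 0 by linear_combination h)
  exact ⟨p, -q, -r, by linear_combination hp, by linear_combination hp', by ring⟩

lemma syzygy_X₄ {a b c d : MvPolynomial (Fin 4) k}
    (h : X 0 * a + X 1 * b + X 2 * c + X 3 * d = 0) :
    ∃ n0 n1 n2 n3 n4 n5, a = X 1 * n0 + X 2 * n1 + X 3 * n2 ∧
      b = -(X 0 * n0) + X 2 * n3 + X 3 * n4 ∧ c = -(X 0 * n1) - X 1 * n3 + X 3 * n5 ∧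
      d = -(X 0 * n2) - X 1 * n4 - X 2 * n5 := by
  have h1 : X 3 * d ∈ Ideal.span (X '' {0, 1, 2} : Set (MvPolynomial (Fin 4) k)) := by
    rw [Set.image_insert_eq, Set.image_pair]
    refine Submodule.mem_span_triple.2 ⟨-a, -b, -c, ?_⟩
    simp only [smul_eq_mul]
    linear_combination -h
  have h2 := mem_span_X_of_X_mul_mem (by decide) h1
  rw [Set.image_insert_eq, Set.image_pair] at h2
  obtain ⟨n2, n4, n5, rfl⟩ := Submodule.mem_span_triple.1 h2
  simp only [smul_eq_mul] at h ⊢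
  obtain ⟨p, q, r, hp, hq, hr⟩ := syzygy_X₃ (i := 0) (j := 1) (l := (2 : Fin 4))
    (by decide) (by decide) (by decide)
    (show X 0 * (a + X 3 * n2) + X 1 * (b + X 3 * n4) + X 2 * (c + X 3 * n5) = 0 by
      linear_combination h)
  exact ⟨p, q, -n2, r, -n4, -n5, by linear_combination hp, by linear_combination hq,
    by linear_combination hr, by ring⟩

end Variables

section PolynomialRing

variable {k : Type*} [Field k]

lemma koszul_exact₁ : KEx (kos1 (X : Fin 4 → MvPolynomial (Fin 4) k)) (kos2 X)
    (⊤ : Submodule k (MvPolynomial (Fin 4) k)) ⊤ := by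
  intro m _ h0
  have h := congrFun h0 0
  rw [act_kos1] at h
  obtain ⟨n0, n1, n2, n3, n4, n5, h0, h1, h2, h3⟩ := syzygy_X₄ h
  refine ⟨![n0, n1, n2, n3, n4, n5], fun _ => trivial, ?_⟩
  rw [act_kos2]
  ext1 i
  fin_cases i
  exacts [h0.symm, h1.symm, h2.symm, h3.symm]

lemma koszul_exact₂ : KEx (kos2 (X : Fin 4 → MvPolynomial (Fin 4) k)) (kos3 X)
    (⊤ : Submodule k (MvPolynomial (Fin 4) k)) ⊤ := by
  intro n _ h0
  rw [act_kos2] at h0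
  have e0 : X 1 * n 0 + X 2 * n 1 + X 3 * n 2 = 0 := congrFun h0 0
  have e1 : -(X 0 * n 0) + X 2 * n 3 + X 3 * n 4 = 0 := congrFun h0 1
  have e2 : -(X 0 * n 1) - X 1 * n 3 + X 3 * n 5 = 0 := congrFun h0 2
  obtain ⟨p, q, r, hp, hq, hr⟩ := syzygy_X₃ (by decide) (by decide) (by decide) e0
  obtain ⟨s, hs, hs'⟩ := syzygy_X₂ (i := 2) (j := (3 : Fin 4)) (by decide)
    (show X 2 * (n 3 - X 0 * p) + X 3 * (n 4 - X 0 * q) = 0 by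
      linear_combination e1 + X 0 * hp)
  have h5 : n 5 = X 0 * r + X 1 * s := by
    have : X 3 * (n 5 - (X 0 * r + X 1 * s)) = 0 := by
      linear_combination e2 + X 0 * hq + X 1 * hs
    linear_combination (mul_eq_zero.1 this).resolve_left (X_ne_zero _)
  refine ⟨![-s, r, -q, p], fun _ => trivial, ?_⟩
  rw [act_kos3]
  ext1 i
  fin_cases i
  · change X 2 * p - X 3 * -q = n 0
    linear_combination -hp
  · change X 3 * r - X 1 * p = n 1
    linear_combination -hq
  · change X 1 * -q - X 2 * r = n 2
    linear_combination -hr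
  · change X 0 * p - X 3 * -s = n 3
    linear_combination -hs
  · change X 2 * -s - X 0 * -q = n 4
    linear_combination -hs'
  · change X 0 * r - X 1 * -s = n 5
    linear_combination -h5

lemma koszul_exact₃ : KEx (kos3 (X : Fin 4 → MvPolynomial (Fin 4) k)) (kos4 X)
    (⊤ : Submodule k (MvPolynomial (Fin 4) k)) ⊤ := by
  intro w _ h0
  rw [act_kos3] at h0
  have e3 : X 0 * w 3 - X 3 * w 0 = 0 := congrFun h0 3
  have e4 : X 2 * w 0 - X 0 * w 2 = 0 := congrFun h0 4
  have e5 : X 0 * w 1 - X 1 * w 0 = 0 := congrFun h0 5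
  obtain ⟨p, hp, hp'⟩ := syzygy_X₂ (i := 1) (j := (0 : Fin 4)) (by decide)
    (show X 1 * w 0 + X 0 * -w 1 = 0 by linear_combination -e5)
  have key : ∀ i, X 0 * w i - X i * w 0 = 0 → X i * p = w i := by
    intro i hi
    have : X 0 * (X i * p - w i) = 0 := by linear_combination -hi - X i * hp
    linear_combination (mul_eq_zero.1 this).resolve_left (X_ne_zero _)
  refine ⟨fun _ => p, fun _ => trivial, ?_⟩
  rw [act_kos4]
  ext1 i
  refine key i ?_
  fin_cases i
  · simp
  · exact e5
  · change X 0 * w 2 - X 2 * w 0 = 0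
    linear_combination -e4
  · exact e3

end PolynomialRing

section Field

variable {k : Type*} [Field k]

lemma exists_dot_eq_one {z : Fin 4 → k} (hz : z ≠ 0) :
    ∃ y : Fin 4 → k, z 0 * y 0 + z 1 * y 1 + z 2 * y 2 + z 3 * y 3 = 1 := by
  obtain ⟨i, hi⟩ := Function.ne_iff.1 hz
  refine ⟨Pi.single i (z i)⁻¹, ?_⟩
  have hi' : z i ≠ 0 := hi
  fin_cases i <;> simp_all

/-- A contracting homotopy gives exactness. -/
lemma KEx.of_homotopy {ι κ μ : Type*} [Fintype ι] [Fintype κ] [DecidableEq κ] [Fintype μ]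
    {D : Matrix ι κ k} {E : Matrix κ μ k} (H : Matrix κ ι k) (H' : Matrix μ κ k)
    (h : E * H' + H * D = 1) : KEx D E (⊤ : Submodule k k) ⊤ := by
  intro m _ h0
  refine ⟨act H' m, fun _ => trivial, ?_⟩
  have h1 : act (E * H' + H * D) m = m := by
    rw [h]
    ext i
    simp only [act, Matrix.one_apply, smul_eq_mul, ite_mul, one_mul, zero_mul,
      Finset.sum_ite_eq, Finset.mem_univ, if_true]
  have h2 : act (E * H' + H * D) m = act (E * H') m + act (H * D) m := by
    ext i; simp only [act, Matrix.add_apply, add_smul, Finset.sum_add_distrib, Pi.add_apply]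
  rw [h1, ← act_act H D, h0, act_zero, add_zero, ← act_act] at h2
  exact h2.symm

lemma koszul_field_exact₁ {z : Fin 4 → k} (hz : z ≠ 0) :
    KEx (kos1 z) (kos2 z) (⊤ : Submodule k k) ⊤ := by
  obtain ⟨y, hy⟩ := exists_dot_eq_one hz
  refine KEx.of_homotopy (kos1 y).transpose (kos2 y).transpose ?_
  ext i j
  fin_cases i <;> fin_cases j <;>
  · rw [Matrix.add_apply, Matrix.mul_apply, Matrix.mul_apply, Fin.sum_univ_six, Fin.sum_univ_one]
    simp [kos1, kos2, Matrix.transpose_apply]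
    try first | ring1 | linear_combination hy

lemma koszul_field_exact₂ {z : Fin 4 → k} (hz : z ≠ 0) :
    KEx (kos2 z) (kos3 z) (⊤ : Submodule k k) ⊤ := by
  obtain ⟨y, hy⟩ := exists_dot_eq_one hz
  refine KEx.of_homotopy (kos2 y).transpose (kos3 y).transpose ?_
  ext i j
  fin_cases i <;> fin_cases j <;>
  · rw [Matrix.add_apply, Matrix.mul_apply, Matrix.mul_apply, Fin.sum_univ_four, Fin.sum_univ_four]
    simp [kos2, kos3, Matrix.transpose_apply]
    try first | ring1 | linear_combination hy

lemma koszul_field_exact₃ {z : Fin 4 → k} (hz : z ≠ 0) :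
    KEx (kos3 z) (kos4 z) (⊤ : Submodule k k) ⊤ := by
  obtain ⟨y, hy⟩ := exists_dot_eq_one hz
  refine KEx.of_homotopy (kos3 y).transpose (kos4 y).transpose ?_
  ext i j
  fin_cases i <;> fin_cases j <;>
  · rw [Matrix.add_apply, Matrix.mul_apply, Matrix.mul_apply, Fin.sum_univ_one, Fin.sum_univ_six]
    simp [kos3, kos4, Matrix.transpose_apply]
    try first | ring1 | linear_combination hy

lemma koszul_field_exact₄ {z : Fin 4 → k} (hz : z ≠ 0) :
    KEx (kos4 z) (kos5 k) (⊤ : Submodule k k) ⊤ := by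
  obtain ⟨y, hy⟩ := exists_dot_eq_one hz
  refine KEx.of_homotopy (kos4 y).transpose 0 ?_
  ext i j
  fin_cases i; fin_cases j
  rw [Matrix.add_apply, Matrix.mul_apply, Matrix.mul_apply, Fin.sum_univ_four]
  simp [kos4, Matrix.transpose_apply]
  linear_combination hy

end Field

section Graded

variable {k : Type*} [Field k] {σ : Type*}

/-- The projection onto the part of degree `t` of the twisted module `R(-c)`. -/
noncomputable def comp (c t : ℕ) : MvPolynomial σ k →ₗ[k] MvPolynomial σ k :=
  if c ≤ t then homogeneousComponent (t - c) else 0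

/-- The part of degree `t` of the twisted module `R(-c)`. -/
noncomputable def grad (k : Type*) [Field k] (σ : Type*) (c t : ℕ) :
    Submodule k (MvPolynomial σ k) :=
  if c ≤ t then homogeneousSubmodule σ k (t - c) else ⊥

lemma grad_of_le {c t : ℕ} (h : c ≤ t) : grad k σ c t = homogeneousSubmodule σ k (t - c) :=
  if_pos h

lemma grad_of_lt {c t : ℕ} (h : t < c) : grad k σ c t = ⊥ := if_neg (not_le.2 h)

lemma comp_mem (c t : ℕ) (p : MvPolynomial σ k) : comp c t p ∈ grad k σ c t := by
  unfold comp grad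
  split_ifs
  · exact homogeneousComponent_mem _ _
  · simp

lemma comp_of_mem {c t : ℕ} {p : MvPolynomial σ k} (h : p ∈ grad k σ c t) : comp c t p = p := by
  unfold comp
  unfold grad at h
  split_ifs with hc
  · rw [if_pos hc] at h
    exact homogeneousComponent_eq_self h
  · rw [if_neg hc] at h
    simpa using h.symm

lemma homogeneousComponent_succ_mul {l : MvPolynomial σ k} (hl : l.IsHomogeneous 1)
    (p : MvPolynomial σ k) (s : ℕ) :
    homogeneousComponent (s + 1) (l * p) = l * homogeneousComponent s p := by
  conv_lhs => rw [← sum_homogeneousComponent p, Finset.mul_sum, map_sum]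
  have : ∀ i ∈ Finset.range (p.totalDegree + 1),
      homogeneousComponent (s + 1) (l * homogeneousComponent i p) =
        if i = s then l * homogeneousComponent s p else 0 := by
    intro i _
    have := (hl.mul (homogeneousComponent_isHomogeneous i p))
    rw [homogeneousComponent_of_mem ((mem_homogeneousSubmodule _ _).2 this)]
    by_cases h : i = s
    · subst h; simp [add_comm]
    · rw [if_neg (by omega), if_neg h]
  rw [Finset.sum_congr rfl this]
  simp only [Finset.sum_ite_eq', Finset.mem_range]
  split_ifs with h
  · rfl
  · rw [homogeneousComponent_eq_zero _ _ (by omega), mul_zero]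

lemma homogeneousComponent_zero_mul {l : MvPolynomial σ k} (hl : l.IsHomogeneous 1)
    (p : MvPolynomial σ k) : homogeneousComponent 0 (l * p) = 0 := by
  rw [homogeneousComponent_zero]
  have : coeff 0 l = 0 := hl.coeff_eq_zero (by simp)
  rw [← constantCoeff_eq, map_mul, constantCoeff_eq, this, zero_mul, C_0]

lemma comp_succ_mul {l : MvPolynomial σ k} (hl : l.IsHomogeneous 1)
    (p : MvPolynomial σ k) (c t : ℕ) : comp c (t + 1) (l * p) = l * comp c t p := by
  unfold comp
  by_cases h : c ≤ t
  · rw [if_pos h, if_pos (by omega), Nat.succ_sub h, homogeneousComponent_succ_mul hl]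
  · rw [if_neg h]
    by_cases h' : c ≤ t + 1
    · rw [if_pos h', show t + 1 - c = 0 by omega, homogeneousComponent_zero_mul hl]
      simp
    · rw [if_neg h']; simp

lemma mul_mem_grad {l : MvPolynomial σ k} (hl : l.IsHomogeneous 1) {p : MvPolynomial σ k}
    {c t : ℕ} (hp : p ∈ grad k σ c t) : l * p ∈ grad k σ c (t + 1) := by
  rw [← comp_of_mem hp, ← comp_succ_mul hl]
  exact comp_mem _ _ _

/-- Every polynomial is the sum of its graded parts. -/
lemma exists_sum_comp (c : ℕ) (p : MvPolynomial σ k) :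
    ∀ n, p.totalDegree + c < n → p = ∑ t ∈ Finset.range n, comp c t p := by
  intro n hn
  have h0 : ∑ t ∈ Finset.range c, comp c t p = 0 := by
    refine Finset.sum_eq_zero fun t ht => ?_
    unfold comp
    rw [if_neg (by simpa using ht)]; rfl
  obtain ⟨m, rfl⟩ : ∃ m, n = c + m := ⟨n - c, by omega⟩
  rw [Finset.sum_range_add, h0, zero_add]
  have : ∀ x ∈ Finset.range m, comp c (c + x) p = homogeneousComponent x p := by
    intro x _
    unfold comp
    rw [if_pos (by omega), Nat.add_sub_cancel_left]
  rw [Finset.sum_congr rfl this]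
  conv_lhs => rw [← sum_homogeneousComponent p]
  refine Finset.sum_subset (fun i hi => ?_) fun i _ hi => ?_
  · simp only [Finset.mem_range] at hi ⊢; omega
  · refine homogeneousComponent_eq_zero _ _ ?_
    simpa using hi

variable {ι κ μ : Type*} [Fintype κ] [Fintype μ]

/-- A matrix all of whose entries are linear forms. -/
def IsLin (D : Matrix ι κ (MvPolynomial σ k)) : Prop := ∀ i j, (D i j).IsHomogeneous 1

lemma IsLin.act_comp {D : Matrix ι κ (MvPolynomial σ k)} (hD : IsLin D)
    (m : κ → MvPolynomial σ k) (c t : ℕ) :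
    act D (fun j => comp c t (m j)) = fun i => comp c (t + 1) (act D m i) := by
  ext1 i
  simp only [act, smul_eq_mul, map_sum, comp_succ_mul (hD i _)]

lemma IsLin.act_mem {D : Matrix ι κ (MvPolynomial σ k)} (hD : IsLin D)
    {m : κ → MvPolynomial σ k} {c t : ℕ} (hm : ∀ j, m j ∈ grad k σ c t) (i : ι) :
    act D m i ∈ grad k σ c (t + 1) :=
  Submodule.sum_mem _ fun j _ => mul_mem_grad (hD i j) (hm j)

lemma KEx.graded {D : Matrix ι κ (MvPolynomial σ k)} {E : Matrix κ μ (MvPolynomial σ k)}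
    (hE : IsLin E) (h : KEx D E (⊤ : Submodule k (MvPolynomial σ k)) ⊤) (c t : ℕ) :
    KEx D E (grad k σ c t) (grad k σ c (t + 1)) := by
  intro m hm h0
  obtain ⟨n, -, hn⟩ := h m (fun _ => trivial) h0
  refine ⟨fun j => comp c t (n j), fun j => comp_mem _ _ _, ?_⟩
  rw [hE.act_comp, hn]
  ext1 j
  exact comp_of_mem (hm j)

end Graded

section Lin

variable {k : Type*} [Field k]

lemma isLin_zero {σ ι κ : Type*} : IsLin (0 : Matrix ι κ (MvPolynomial σ k)) :=
  fun _ _ => isHomogeneous_zero _ _ _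

lemma isLin_kos1 : IsLin (kos1 (X : Fin 4 → MvPolynomial (Fin 4) k)) := by
  intro i j
  fin_cases i; fin_cases j <;> exact isHomogeneous_X _ _

lemma isLin_kos2 : IsLin (kos2 (X : Fin 4 → MvPolynomial (Fin 4) k)) := by
  intro i j
  fin_cases i <;> fin_cases j <;>
    first
    | exact isHomogeneous_X _ _
    | exact isHomogeneous_zero _ _ _
    | exact (isHomogeneous_X _ _).neg

lemma isLin_kos3 : IsLin (kos3 (X : Fin 4 → MvPolynomial (Fin 4) k)) := by
  intro i j
  fin_cases i <;> fin_cases j <;>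
    first
    | exact isHomogeneous_X _ _
    | exact isHomogeneous_zero _ _ _
    | exact (isHomogeneous_X _ _).neg

lemma isLin_kos4 : IsLin (kos4 (X : Fin 4 → MvPolynomial (Fin 4) k)) := by
  intro i j
  fin_cases i <;> fin_cases j <;> exact isHomogeneous_X _ _

/-- A form of positive degree is a combination of the variables. -/
lemma koszul_exact₀ {c t : ℕ} (h : t + 1 ≠ c) :
    KEx (kos0 (MvPolynomial (Fin 4) k)) (kos1 X)
      (grad k (Fin 4) c t) (grad k (Fin 4) c (t + 1)) := by
  intro m hm _
  rcases lt_or_ge (t + 1) c with hlt | hge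
  · refine ⟨0, fun _ => Submodule.zero_mem _, ?_⟩
    have := hm 0
    rw [grad_of_lt hlt, Submodule.mem_bot] at this
    ext1 i
    rw [act_zero, Subsingleton.elim i 0, this]; rfl
  have hm0 : m 0 ∈ Ideal.span (X '' Set.univ : Set (MvPolynomial (Fin 4) k)) := by
    rw [mem_ideal_span_X_image]
    intro d hd
    have h1 := hm 0
    rw [grad_of_le hge, mem_homogeneousSubmodule] at h1
    by_contra! hcon
    have hd0 : d = 0 := by ext i; simpa using hcon i trivial
    have := h1.coeff_eq_zero (d := d) (by rw [hd0]; simp; omega)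
    exact (mem_support_iff.1 hd) this
  rw [Set.image_univ] at hm0
  obtain ⟨q, hq⟩ := (Ideal.mem_span_range_iff_exists_fun (R := MvPolynomial (Fin 4) k)).1 hm0
  refine ⟨fun j => comp c t (q j), fun j => comp_mem _ _ _, ?_⟩
  rw [isLin_kos1.act_comp]
  ext1 i
  rw [Subsingleton.elim i 0, act_kos1]
  simp only [Fin.sum_univ_four] at hq
  have : X 0 * q 0 + X 1 * q 1 + X 2 * q 2 + X 3 * q 3 = m 0 := by
    rw [← hq]; ring
  simp only [smul_eq_mul, this]
  exact comp_of_mem (hm 0)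

end Lin

section Presentation

variable {k : Type*} [Field k]

/-- The part of degree `t` of the free module `R(-c)^n`. -/
noncomputable def fgrad (k : Type*) [Field k] (n c t : ℕ) :
    Submodule k (Fin n → MvPolynomial (Fin 4) k) :=
  Submodule.pi Set.univ fun _ => grad k (Fin 4) c t

lemma mem_fgrad {n c t : ℕ} {x : Fin n → MvPolynomial (Fin 4) k} :
    x ∈ fgrad k n c t ↔ ∀ i, x i ∈ grad k (Fin 4) c t := by
  simp [fgrad, Submodule.mem_pi]

variable {P : Type*} [AddCommGroup P] [Module (MvPolynomial (Fin 4) k) P] [Module k P]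
  [IsScalarTower k (MvPolynomial (Fin 4) k) P]

/-- The family `v` is a basis of the lowest degree part, in degree `c`, of a graded module
generated in this degree. -/
structure Pres (c n : ℕ) (Pg : ℕ → Submodule k P) (v : Fin n → P) : Prop where
  mem : ∀ i, v i ∈ Pg c
  low : ∀ t < c, Pg t = ⊥
  span : ∀ y ∈ Pg c, ∃ q : Fin n → k, ∑ i, q i • v i = y
  indep : ∀ q : Fin n → k, ∑ i, q i • v i = 0 → q = 0
  smul : ∀ t i, ∀ y ∈ Pg t, (X i : MvPolynomial (Fin 4) k) • y ∈ Pg (t + 1)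
  gen : ∀ t, c ≤ t → KEx (kos0 (MvPolynomial (Fin 4) k)) (kos1 X) (Pg t) (Pg (t + 1))

lemma Pres.exists {c n : ℕ} {Pg : ℕ → Submodule k P} [FiniteDimensional k (Pg c)]
    (hn : Module.finrank k (Pg c) = n) (low : ∀ t < c, Pg t = ⊥)
    (smul : ∀ t i, ∀ y ∈ Pg t, (X i : MvPolynomial (Fin 4) k) • y ∈ Pg (t + 1))
    (gen : ∀ t, c ≤ t → KEx (kos0 (MvPolynomial (Fin 4) k)) (kos1 X) (Pg t) (Pg (t + 1))) :
    ∃ v : Fin n → P, Pres c n Pg v := by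
  let b := Module.finBasisOfFinrankEq k (Pg c) hn
  refine ⟨fun i => b i, fun i => (b i).2, low, fun y hy => ?_, fun q hq => ?_, smul, gen⟩
  · refine ⟨b.repr ⟨y, hy⟩, ?_⟩
    have := congrArg (Pg c).subtype (b.sum_repr ⟨y, hy⟩)
    rw [map_sum] at this
    exact this
  · have : ∑ i, q i • b i = 0 := by
      apply Subtype.ext
      simpa using hq
    exact funext (Fintype.linearIndependent_iff.1 b.linearIndependent q this)

variable {c n : ℕ} {Pg : ℕ → Submodule k P} {v : Fin n → P}

/-- The map from the free module determined by a family of generators. -/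
noncomputable abbrev lc (k : Type*) [Field k] {P : Type*} [AddCommGroup P]
    [Module (MvPolynomial (Fin 4) k) P] {n : ℕ} (v : Fin n → P) :
    (Fin n → MvPolynomial (Fin 4) k) →ₗ[MvPolynomial (Fin 4) k] P :=
  Fintype.linearCombination (MvPolynomial (Fin 4) k) v

lemma mem_fgrad_self {x : Fin n → MvPolynomial (Fin 4) k} (hx : x ∈ fgrad k n c c) :
    ∃ q : Fin n → k, x = fun i => C (q i) := by
  rw [mem_fgrad] at hx
  have : ∀ i, ∃ q : k, x i = C q := fun i => by
    have := hx i
    rw [grad_of_le le_rfl, Nat.sub_self, mem_homogeneousSubmodule] at this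
    exact ⟨_, totalDegree_eq_zero_iff_eq_C.1 ((totalDegree_zero_iff_isHomogeneous _).2 this)⟩
  choose q hq using this
  exact ⟨q, funext hq⟩

lemma C_smul_eq (r : k) (y : P) : (C r : MvPolynomial (Fin 4) k) • y = r • y := by
  rw [← algebraMap_eq, algebraMap_smul]

lemma lc_C (q : Fin n → k) : lc k v (fun i => C (q i)) = ∑ i, q i • v i := by
  simp [Fintype.linearCombination_apply, C_smul_eq]

lemma fgrad_exact₀ (n : ℕ) {c t : ℕ} (h : t + 1 ≠ c) :
    KEx (kos0 (MvPolynomial (Fin 4) k)) (kos1 X) (fgrad k n c t) (fgrad k n c (t + 1)) :=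
  (koszul_exact₀ h).pi

lemma fgrad_smul {n c t : ℕ} (i : Fin 4) {x : Fin n → MvPolynomial (Fin 4) k}
    (hx : x ∈ fgrad k n c t) : (X i : MvPolynomial (Fin 4) k) • x ∈ fgrad k n c (t + 1) := by
  rw [mem_fgrad] at hx ⊢
  exact fun j => mul_mem_grad (isHomogeneous_X _ _) (hx j)

namespace Pres

lemma lc_mem (h : Pres c n Pg v) (t : ℕ) :
    ∀ x ∈ fgrad k n c t, lc k v x ∈ Pg t := by
  induction t with
  | zero =>
    intro x hx
    rcases Nat.eq_zero_or_pos c with rfl | hc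
    · obtain ⟨q, rfl⟩ := mem_fgrad_self hx
      rw [lc_C]
      exact Submodule.sum_mem _ fun i _ => Submodule.smul_mem _ _ (h.mem i)
    · have : x = 0 := by
        ext1 i
        have := mem_fgrad.1 hx i
        rwa [grad_of_lt hc] at this
      rw [this, map_zero]; exact Submodule.zero_mem _
  | succ t ih =>
    intro x hx
    by_cases hc : t + 1 = c
    · subst hc
      obtain ⟨q, rfl⟩ := mem_fgrad_self hx
      rw [lc_C]
      exact Submodule.sum_mem _ fun i _ => Submodule.smul_mem _ _ (h.mem i)
    · obtain ⟨m, hm, hmx⟩ := fgrad_exact₀ n hc (fun _ => x) (fun _ => hx) (act_zero_matrix _)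
      have := congrFun (act_map (lc k v) (kos1 X) m) 0
      rw [hmx, act_kos1] at this
      rw [← this]
      have hX := fun i => h.smul t i _ (ih _ (hm i))
      exact Submodule.add_mem _ (Submodule.add_mem _ (Submodule.add_mem _ (hX 0) (hX 1)) (hX 2))
        (hX 3)

lemma lc_surj (h : Pres c n Pg v) (t : ℕ) :
    ∀ y ∈ Pg t, ∃ x ∈ fgrad k n c t, lc k v x = y := by
  have base : ∀ y ∈ Pg c, ∃ x ∈ fgrad k n c c, lc k v x = y := by
    intro y hy
    obtain ⟨q, hq⟩ := h.span y hy
    refine ⟨fun i => C (q i), mem_fgrad.2 fun i => ?_, by rw [lc_C, hq]⟩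
    rw [grad_of_le le_rfl, Nat.sub_self]
    exact isHomogeneous_C _ _
  have low : ∀ t < c, ∀ y ∈ Pg t, ∃ x ∈ fgrad k n c t, lc k v x = y := by
    intro t ht y hy
    rw [h.low t ht, Submodule.mem_bot] at hy
    exact ⟨0, Submodule.zero_mem _, by rw [map_zero, hy]⟩
  induction t with
  | zero =>
    rcases Nat.eq_zero_or_pos c with rfl | hc
    · exact base
    · exact low 0 hc
  | succ t ih =>
    intro y hy
    rcases lt_trichotomy (t + 1) c with hc | rfl | hc
    · exact low _ hc y hy
    · exact base y hy
    · obtain ⟨m, hm, hmy⟩ := h.gen t (by omega) (fun _ => y) (fun _ => hy) (act_zero_matrix _)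
      choose x hx hxm using fun i => ih (m i) (hm i)
      refine ⟨act (kos1 (X : Fin 4 → MvPolynomial (Fin 4) k)) x 0, ?_, ?_⟩
      · rw [act_kos1]
        exact Submodule.add_mem _ (Submodule.add_mem _ (Submodule.add_mem _ (fgrad_smul 0 (hx 0))
          (fgrad_smul 1 (hx 1))) (fgrad_smul 2 (hx 2))) (fgrad_smul 3 (hx 3))
      · have := congrFun (act_map (lc k v) (kos1 X) x) 0
        rw [← this]
        simp only [hxm]
        rw [hmy]

end Pres

/-- The graded pieces of the first syzygy module. -/
noncomputable def syz (k : Type*) [Field k] {P : Type*} [AddCommGroup P]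
    [Module (MvPolynomial (Fin 4) k) P] {n : ℕ} (v : Fin n → P) (c t : ℕ) :
    Submodule k (Fin n → MvPolynomial (Fin 4) k) :=
  fgrad k n c t ⊓ (LinearMap.ker (lc k v)).restrictScalars k

lemma mem_syz {t : ℕ} {x : Fin n → MvPolynomial (Fin 4) k} :
    x ∈ syz k v c t ↔ x ∈ fgrad k n c t ∧ lc k v x = 0 := by
  simp [syz]

lemma syz_smul (t : ℕ) (i : Fin 4) (y : Fin n → MvPolynomial (Fin 4) k) (hy : y ∈ syz k v c t) :
    (X i : MvPolynomial (Fin 4) k) • y ∈ syz k v c (t + 1) := by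
  rw [mem_syz] at hy ⊢
  exact ⟨fgrad_smul i hy.1, by rw [map_smul, hy.2, smul_zero]⟩

lemma Pres.syz_low (h : Pres c n Pg v) : ∀ t < c + 1, syz k v c t = ⊥ := by
  intro t ht
  rw [eq_bot_iff]
  intro x hx
  rw [mem_syz] at hx
  rcases (Nat.lt_succ_iff.1 ht).lt_or_eq with hlt | rfl
  · ext1 i
    have := mem_fgrad.1 hx.1 i
    rwa [grad_of_lt hlt] at this
  · obtain ⟨q, rfl⟩ := mem_fgrad_self hx.1
    rw [lc_C] at hx
    rw [h.indep q hx.2]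
    ext1 i; simp

lemma Pres.syz_exact (h : Pres c n Pg v) {ι κ μ ν : Type*} [Fintype κ] [Fintype μ]
    [Fintype ν] {D₀ : Matrix ι κ (MvPolynomial (Fin 4) k)}
    {D₁ : Matrix κ μ (MvPolynomial (Fin 4) k)} {D₂ : Matrix μ ν (MvPolynomial (Fin 4) k)}
    (h12 : D₁ * D₂ = 0) (hD₂ : IsLin D₂) {t : ℕ}
    (hF : KEx D₀ D₁ (grad k (Fin 4) c (t + 1)) (grad k (Fin 4) c (t + 2)))
    (hP : KEx D₁ D₂ (Pg t) (Pg (t + 1))) :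
    KEx D₀ D₁ (syz k v c (t + 1)) (syz k v c (t + 2)) := by
  refine KEx.ker h12 (lc k v) hF.pi hP (fun x => mem_syz) (fun x => mem_syz)
    (h.lc_mem _) (h.lc_surj t) fun m hm i => ?_
  refine mem_fgrad.2 fun l => ?_
  rw [act_apply_pi]
  exact hD₂.act_mem (fun j => mem_fgrad.1 (hm j) l) i

lemma finrank_syz_add [FiniteDimensional k (fgrad k n c t)] (h : Pres c n Pg v) :
    Module.finrank k (syz k v c t) + Module.finrank k (Pg t) =
      Module.finrank k (fgrad k n c t) := by
  let φ : fgrad k n c t →ₗ[k] P := ((lc k v).restrictScalars k).domRestrict (fgrad k n c t)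
  have h1 := LinearMap.finrank_range_add_finrank_ker φ
  have h2 : LinearMap.range φ = Pg t := by
    ext y
    simp only [LinearMap.mem_range, Subtype.exists]
    constructor
    · rintro ⟨x, hx, rfl⟩
      exact h.lc_mem t x hx
    · intro hy
      obtain ⟨x, hx, hxy⟩ := h.lc_surj t y hy
      exact ⟨x, hx, hxy⟩
  have h3 : (LinearMap.ker φ).map (fgrad k n c t).subtype = syz k v c t := by
    ext x
    simp only [Submodule.mem_map, LinearMap.mem_ker, Submodule.subtype_apply, Subtype.exists,
      mem_syz]
    constructor
    · rintro ⟨y, hy, h0, rfl⟩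
      exact ⟨hy, h0⟩
    · rintro ⟨hx, h0⟩
      exact ⟨x, hx, h0, rfl⟩
  have h4 : Module.finrank k (syz k v c t) = Module.finrank k (LinearMap.ker φ) := by
    rw [← h3]
    exact Submodule.finrank_map_subtype_eq _ _
  rw [h2] at h1
  omega

/-- Elements of different degrees of a graded module are independent. -/
def GrIndep {k P : Type*} [Semiring k] [AddCommGroup P] [Module k P]
    (Pg : ℕ → Submodule k P) : Prop :=
  ∀ (N : ℕ) (y : ℕ → P), (∀ t, y t ∈ Pg t) → ∑ t ∈ Finset.range N, y t = 0 →
    ∀ t < N, y t = 0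

/-- The projection of a tuple onto its part of degree `t`. -/
noncomputable def fcomp (c t : ℕ) (x : Fin n → MvPolynomial (Fin 4) k) :
    Fin n → MvPolynomial (Fin 4) k := fun i => comp c t (x i)

lemma exists_sum_fcomp (c : ℕ) (x : Fin n → MvPolynomial (Fin 4) k) :
    ∃ N, x = ∑ t ∈ Finset.range N, fcomp c t x := by
  refine ⟨∑ i, (x i).totalDegree + c + 1, ?_⟩
  ext1 i
  rw [Finset.sum_apply]
  refine exists_sum_comp c (x i) _ ?_
  have := Finset.single_le_sum (f := fun i => (x i).totalDegree) (fun _ _ => Nat.zero_le _)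
    (Finset.mem_univ i)
  omega

lemma grIndep_fgrad (n c : ℕ) : GrIndep (fgrad k n c) := by
  intro N y hy h0 t ht
  ext1 i
  have h1 : comp c t (∑ s ∈ Finset.range N, y s i) = 0 := by
    have := congrFun h0 i
    rw [Finset.sum_apply] at this
    rw [this, Pi.zero_apply, map_zero]
  rw [map_sum, Finset.sum_eq_single t] at h1
  · rwa [comp_of_mem (mem_fgrad.1 (hy t) i)] at h1
  · intro s _ hst
    have hs := mem_fgrad.1 (hy s) i
    unfold comp
    split_ifs with hct
    · unfold grad at hs
      split_ifs at hs with hcs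
      · rw [homogeneousComponent_of_mem hs, if_neg (by omega)]
      · rw [(Submodule.mem_bot k).1 hs, map_zero]
    · rfl
  · intro h
    exact absurd (Finset.mem_range.2 ht) h

lemma GrIndep.mono {Pg Pg' : ℕ → Submodule k P} (h : GrIndep Pg) (hle : ∀ t, Pg' t ≤ Pg t) :
    GrIndep Pg' := fun N y hy => h N y fun t => hle t (hy t)

/-- The kernel of the presentation map is spanned by its graded pieces. -/
lemma Pres.ker_le (h : Pres c n Pg v) (hi : GrIndep Pg) {N : Submodule (MvPolynomial (Fin 4) k)
    (Fin n → MvPolynomial (Fin 4) k)} (hN : ∀ t, ∀ x ∈ syz k v c t, x ∈ N) :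
    ∀ x, lc k v x = 0 → x ∈ N := by
  intro x hx
  obtain ⟨M, hM⟩ := exists_sum_fcomp c x
  have hmem : ∀ t, fcomp c t x ∈ fgrad k n c t := fun t => mem_fgrad.2 fun i => comp_mem _ _ _
  rw [hM, map_sum] at hx
  have := hi M _ (fun t => h.lc_mem t _ (hmem t)) hx
  rw [hM]
  exact Submodule.sum_mem _ fun t ht => hN t _ (mem_syz.2 ⟨hmem t, this t (Finset.mem_range.1 ht)⟩)

end Presentation

section Dimension

variable {k : Type*} [Field k]

lemma finrank_homogeneousSubmodule (t : ℕ) :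
    Module.finrank k (homogeneousSubmodule (Fin 4) k t) = (t + 3).choose 3 := by
  have hs : {d : Fin 4 →₀ ℕ | d.degree = t} =
      ((Finset.univ : Finset (Fin 4)).finsuppAntidiag t : Set (Fin 4 →₀ ℕ)) := by
    ext d
    simp [Finset.mem_finsuppAntidiag, Finsupp.degree_eq_sum]
  rw [homogeneousSubmodule_eq_finsupp_supported, hs]
  refine (AddMonoidAlgebra.supportedEquivFinsupp (R := k) (S := k) _).finrank_eq.trans ?_
  rw [Module.finrank_finsupp_self, ← Nat.card_eq_fintype_card, Nat.card_coe_set_eq,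
    Set.ncard_coe_finset, Finset.card_finsuppAntidiag_nat_eq_choose,
    Finset.card_univ, Fintype.card_fin]
  rw [show 4 + t - 1 = t + 3 by omega, Nat.choose_symm_add]

instance (t : ℕ) : FiniteDimensional k (homogeneousSubmodule (Fin 4) k t) :=
  Module.Finite.iff_fg.2 (homogeneousSubmodule_fg _ _ _)

instance (c t : ℕ) : FiniteDimensional k (grad k (Fin 4) c t) := by
  by_cases h : c ≤ t
  · rw [grad_of_le h]; infer_instance
  · rw [grad_of_lt (not_le.1 h)]; infer_instance

lemma finrank_grad (c t : ℕ) : Module.finrank k (grad k (Fin 4) c t) = (t + 3 - c).choose 3 := by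
  by_cases h : c ≤ t
  · rw [grad_of_le h, finrank_homogeneousSubmodule]
    congr 1; omega
  · rw [grad_of_lt (not_le.1 h), finrank_bot, Nat.choose_eq_zero_of_lt (by omega)]

/-- The coordinatewise description of the graded pieces of a free module. -/
noncomputable def fgradEquiv (n c t : ℕ) : fgrad k n c t ≃ₗ[k] (Fin n → grad k (Fin 4) c t) where
  toFun x i := ⟨x.1 i, mem_fgrad.1 x.2 i⟩
  invFun y := ⟨fun i => y i, mem_fgrad.2 fun i => (y i).2⟩
  map_add' _ _ := rfl
  map_smul' _ _ := rfl
  left_inv _ := rfl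
  right_inv _ := rfl

instance (n c t : ℕ) : FiniteDimensional k (fgrad k n c t) :=
  LinearEquiv.finiteDimensional (fgradEquiv n c t).symm

lemma finrank_fgrad (n c t : ℕ) :
    Module.finrank k (fgrad k n c t) = n * (t + 3 - c).choose 3 := by
  rw [(fgradEquiv n c t).finrank_eq, Module.finrank_pi_fintype]
  simp [finrank_grad]

lemma homogeneousComponent_mul {d : ℕ} {l : MvPolynomial (Fin 4) k} (hl : l.IsHomogeneous d)
    (p : MvPolynomial (Fin 4) k) (t : ℕ) :
    homogeneousComponent t (l * p) = l * comp d t p := by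
  conv_lhs => rw [← sum_homogeneousComponent p, Finset.mul_sum, map_sum]
  have : ∀ i ∈ Finset.range (p.totalDegree + 1),
      homogeneousComponent t (l * homogeneousComponent i p) =
        if t = d + i then l * homogeneousComponent i p else 0 := by
    intro i _
    have := (hl.mul (homogeneousComponent_isHomogeneous i p))
    rw [homogeneousComponent_of_mem ((mem_homogeneousSubmodule _ _).2 this)]
  rw [Finset.sum_congr rfl this]
  unfold comp
  split_ifs with hd
  · rw [Finset.sum_eq_single (t - d) (fun i _ hi => if_neg (by omega)), if_pos (by omega)]
    intro hi
    rw [homogeneousComponent_eq_zero _ _ (by rw [Finset.mem_range] at hi; omega), mul_zero,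
      ite_self]
  · rw [Finset.sum_eq_zero (fun i _ => if_neg (by omega))]
    simp

lemma exists_grad_of_dvd {d t : ℕ} {f g : MvPolynomial (Fin 4) k} (hf : f.IsHomogeneous d)
    (hg : g.IsHomogeneous t) (h : f ∣ g) : ∃ q ∈ grad k (Fin 4) d t, g = f * q := by
  obtain ⟨q, rfl⟩ := h
  refine ⟨comp d t q, comp_mem _ _ _, ?_⟩
  rw [← homogeneousComponent_mul hf, homogeneousComponent_eq_self hg]

variable (f : MvPolynomial (Fin 4) k)

/-- The residue class map of the homogeneous coordinate ring of a surface. -/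
noncomputable abbrev qmk : MvPolynomial (Fin 4) k →ₗ[MvPolynomial (Fin 4) k]
    (MvPolynomial (Fin 4) k ⧸ Ideal.span {f}) := (Ideal.span {f}).mkQ

variable {f}

lemma qmk_eq_zero {g : MvPolynomial (Fin 4) k} : qmk f g = 0 ↔ f ∣ g := by
  rw [Submodule.mkQ_apply, Submodule.Quotient.mk_eq_zero]
  exact Ideal.mem_span_singleton

/-- The image in `R/(f)` of a space of polynomials. -/
noncomputable abbrev qmap (f : MvPolynomial (Fin 4) k) (W : Submodule k (MvPolynomial (Fin 4) k)) :
    Submodule k (MvPolynomial (Fin 4) k ⧸ Ideal.span {f}) :=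
  W.map ((qmk f).restrictScalars k)

lemma finrank_qmap {d t : ℕ} (hf : f.IsHomogeneous d) (h0 : f ≠ 0)
    {W : Submodule k (MvPolynomial (Fin 4) k)} (hW : W ≤ homogeneousSubmodule (Fin 4) k t)
    (hfW : ∀ q ∈ grad k (Fin 4) d t, f * q ∈ W) :
    Module.finrank k (qmap f W) + (t + 3 - d).choose 3 = Module.finrank k W := by
  have : FiniteDimensional k W := Submodule.finiteDimensional_of_le hW
  let φ := ((qmk f).restrictScalars k).domRestrict W
  have h1 := LinearMap.finrank_range_add_finrank_ker φ
  have h2 : LinearMap.range φ = qmap f W := by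
    rw [LinearMap.range_domRestrict]
  have h3 : (LinearMap.ker φ).map W.subtype =
      (grad k (Fin 4) d t).map (LinearMap.mulLeft k f) := by
    ext x
    simp only [Submodule.mem_map, LinearMap.mem_ker, Submodule.subtype_apply, Subtype.exists,
      LinearMap.mulLeft_apply]
    constructor
    · rintro ⟨y, hy, hk, rfl⟩
      obtain ⟨q, hq, e⟩ := exists_grad_of_dvd hf (hW hy) (qmk_eq_zero.1 hk)
      exact ⟨q, hq, e.symm⟩
    · rintro ⟨q, hq, rfl⟩
      exact ⟨_, hfW q hq, qmk_eq_zero.2 (dvd_mul_right _ _), rfl⟩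
  have h4 : Module.finrank k (LinearMap.ker φ) = (t + 3 - d).choose 3 := by
    rw [← Submodule.finrank_map_subtype_eq, h3, ← finrank_grad d t (k := k)]
    refine (Submodule.equivMapOfInjective _ ?_ _).finrank_eq.symm
    exact fun a b hab => mul_left_cancel₀ h0 hab
  rw [← h4, ← h2, h1]

end Dimension

section Surj

variable {k : Type*} [Field k] {ι : Type*}

/-- Quadruples of forms of degree `a` take arbitrary values at the points `z p`, up to multiples
of the position vectors. -/
def SurjQ (a : ℕ) (z : ι → Fin 4 → k) : Prop :=
  ∀ t : ι → Fin 4 → k, ∃ v : Fin 4 → MvPolynomial (Fin 4) k, (∀ i, (v i).IsHomogeneous a) ∧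
    ∃ c : ι → k, ∀ p i, eval (z p) (v i) = t p i + c p * z p i

/-- Contractions of antisymmetric matrices of forms of degree `a` with the position vector take
arbitrary values at the points `z p`, subject to orthogonality to the position vectors. -/
def SurjO (a : ℕ) (z : ι → Fin 4 → k) : Prop :=
  ∀ t : ι → Fin 4 → k, (∀ p, ∑ i, t p i * z p i = 0) →
    ∃ b : Fin 4 → Fin 4 → MvPolynomial (Fin 4) k, (∀ i, b i i = 0) ∧ (∀ i j, b j i = -b i j) ∧
      (∀ i j, (b i j).IsHomogeneous a) ∧ ∀ p i, ∑ j, z p j * eval (z p) (b i j) = t p i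

/-- Forms of degree `s` take arbitrary values at the points `z p`. -/
def SurjEv (s : ℕ) (z : ι → Fin 4 → k) : Prop :=
  ∀ y : ι → k, ∃ g : MvPolynomial (Fin 4) k, g.IsHomogeneous s ∧ ∀ p, eval (z p) g = y p

lemma eval_zero_of_isHomogeneous {a : ℕ} (ha : a ≠ 0) {g : MvPolynomial (Fin 4) k}
    (hg : g.IsHomogeneous a) : eval (0 : Fin 4 → k) g = 0 := by
  rw [eval_zero, constantCoeff_eq]
  exact hg.coeff_eq_zero (by simpa using ha.symm)

lemma SurjQ.ne_zero {a : ℕ} (ha : a ≠ 0) {z : ι → Fin 4 → k} (h : SurjQ a z) (p : ι) :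
    z p ≠ 0 := by
  intro h0
  obtain ⟨v, hv, c, hc⟩ := h fun _ _ => 1
  have := hc p 0
  rw [h0, eval_zero_of_isHomogeneous ha (hv 0)] at this
  simp at this

lemma surjEv_of_single [Fintype ι] [DecidableEq ι] {s : ℕ} {z : ι → Fin 4 → k}
    (h : ∀ p, ∃ g : MvPolynomial (Fin 4) k, g.IsHomogeneous s ∧
      ∀ q, eval (z q) g = if q = p then 1 else 0) : SurjEv s z := by
  choose g hg hgq using h
  intro y
  refine ⟨∑ p, C (y p) * g p, IsHomogeneous.sum _ _ _ fun p _ => (hg p).C_mul _, fun q => ?_⟩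
  simp [map_sum, hgq]

lemma SurjQ.surjEv [Fintype ι] {a : ℕ} (ha : a ≠ 0) {z : ι → Fin 4 → k} (h : SurjQ a z) :
    SurjEv (a + 1) z := by
  classical
  refine surjEv_of_single fun p => ?_
  obtain ⟨j, hj⟩ := Function.ne_iff.1 (h.ne_zero ha p)
  have hj' : z p j ≠ 0 := hj
  obtain ⟨i, hij⟩ := exists_ne j
  obtain ⟨v, hv, c, hc⟩ := h fun q l => if q = p ∧ l = i then (z p j)⁻¹ else 0
  refine ⟨X j * v i - X i * v j, ?_, fun q => ?_⟩
  · rw [add_comm]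
    exact ((isHomogeneous_X _ _).mul (hv i)).sub ((isHomogeneous_X _ _).mul (hv j))
  · simp only [map_sub, map_mul, eval_X, hc, hij.symm, and_true, and_false, if_false]
    split_ifs with hq
    · subst hq; field_simp; ring
    · ring

lemma SurjEv.succ [Fintype ι] {s : ℕ} {z : ι → Fin 4 → k} (h0 : ∀ p, z p ≠ 0)
    (h : SurjEv s z) : SurjEv (s + 1) z := by
  classical
  refine surjEv_of_single fun p => ?_
  obtain ⟨j, hj⟩ := Function.ne_iff.1 (h0 p)
  have hj' : z p j ≠ 0 := hj
  obtain ⟨g, hg, hgq⟩ := h fun q => if q = p then (z p j)⁻¹ else 0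
  refine ⟨X j * g, ?_, fun q => ?_⟩
  · rw [add_comm]
    exact (isHomogeneous_X _ _).mul hg
  · simp only [map_mul, eval_X, hgq]
    split_ifs with hq
    · subst hq; field_simp
    · ring

lemma SurjQ.surjEv_of_lt [Fintype ι] {a s : ℕ} (ha : a ≠ 0) {z : ι → Fin 4 → k}
    (h : SurjQ a z) (hs : a < s) : SurjEv s z := by
  obtain ⟨n, rfl⟩ : ∃ n, s = a + 1 + n := ⟨s - (a + 1), by omega⟩
  clear hs
  induction n with
  | zero => exact h.surjEv ha
  | succ n ih => exact SurjEv.succ (h.ne_zero ha) ih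

end Surj

section Quotient

variable {k : Type*} [Field k] {f : MvPolynomial (Fin 4) k}

/-- The graded pieces of `R/(f)`. -/
noncomputable abbrev Ag (f : MvPolynomial (Fin 4) k) (t : ℕ) :
    Submodule k (MvPolynomial (Fin 4) k ⧸ Ideal.span {f}) :=
  qmap f (homogeneousSubmodule (Fin 4) k t)

lemma qmk_mem_qmap {W : Submodule k (MvPolynomial (Fin 4) k)} {g : MvPolynomial (Fin 4) k}
    (hg : g ∈ W) : qmk f g ∈ qmap f W := ⟨g, hg, rfl⟩

lemma homogeneousSubmodule_eq_grad (t : ℕ) :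
    homogeneousSubmodule (Fin 4) k t = grad k (Fin 4) 0 t :=
  (grad_of_le (Nat.zero_le _)).symm

variable {α ι κ μ ν : Type*} [Fintype κ] [Fintype μ] [Fintype ν]

lemma KEx.quot [Fintype ι] {D : Matrix α ι (MvPolynomial (Fin 4) k)}
    {D₀ : Matrix ι κ (MvPolynomial (Fin 4) k)} {D₁ : Matrix κ μ (MvPolynomial (Fin 4) k)}
    (hD : D * D₀ = 0) (hD₀ : IsLin D₀) (hf : f.IsHomogeneous 3) (h0 : f ≠ 0) {t : ℕ}
    (hR₁ : KEx D₀ D₁ (grad k (Fin 4) 0 t) (grad k (Fin 4) 0 (t + 1)))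
    (hR₀ : KEx D D₀ (grad k (Fin 4) 3 (t + 1)) (grad k (Fin 4) 3 (t + 2))) :
    KEx D₀ D₁ (Ag f t) (Ag f (t + 1)) := by
  intro m hm hm0
  choose l hl hlm using hm
  have hlm' : (fun j => qmk f (l j)) = m := funext hlm
  have hl' : ∀ j, l j ∈ grad k (Fin 4) 0 (t + 1) := fun j => by
    rw [← homogeneousSubmodule_eq_grad]; exact hl j
  have hdvd : ∀ i, f ∣ act D₀ l i := fun i => by
    rw [← qmk_eq_zero]
    have := congrFun (act_map (qmk f) D₀ l) i
    rw [← this, hlm', hm0]; rfl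
  have hhom : ∀ i, (act D₀ l i).IsHomogeneous (t + 2) := fun i => by
    have := hD₀.act_mem hl' i
    rwa [← homogeneousSubmodule_eq_grad] at this
  choose q hq hqe using fun i => exists_grad_of_dvd hf (hhom i) (hdvd i)
  have hqe' : act D₀ l = fun i => f • q i := funext hqe
  have hq0 : act D q = 0 := by
    have := act_smul D f q
    rw [← hqe', act_act, hD, act_zero_matrix] at this
    ext1 i
    have h := congrFun this i
    exact (mul_eq_zero.1 h.symm).resolve_left h0
  obtain ⟨g, hg, hgq⟩ := hR₀ q hq hq0
  have hmem : ∀ j, (l - fun j => f • g j) j ∈ grad k (Fin 4) 0 (t + 1) := fun j => by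
    refine Submodule.sub_mem _ (hl' j) ?_
    have h1 := hg j
    unfold grad at h1
    split_ifs at h1 with hc
    · rw [← homogeneousSubmodule_eq_grad]
      have := hf.mul h1
      rwa [show 3 + (t + 1 - 3) = t + 1 by omega] at this
    · rw [Submodule.mem_bot] at h1
      change f • g j ∈ _
      rw [h1, smul_zero]; exact Submodule.zero_mem _
  obtain ⟨n, hn, hnl⟩ := hR₁ _ hmem (by rw [act_sub, act_smul, hqe', hgq, sub_self])
  refine ⟨fun j => qmk f (n j), fun j => qmk_mem_qmap ?_, ?_⟩
  · rw [homogeneousSubmodule_eq_grad]; exact hn j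
  · rw [act_map, hnl, ← hlm']
    ext1 j
    have : qmk f (f • g j) = 0 := qmk_eq_zero.2 (dvd_mul_right _ _)
    rw [Pi.sub_apply, map_sub, this, sub_zero]

/-- Forms of degree `t` vanishing at the points `z p`. -/
def vSub {Z : Type*} (z : Z → Fin 4 → k) (t : ℕ) : Submodule k (MvPolynomial (Fin 4) k) where
  carrier := {g | g.IsHomogeneous t ∧ ∀ p, eval (z p) g = 0}
  zero_mem' := ⟨isHomogeneous_zero _ _ _, fun _ => map_zero _⟩
  add_mem' ha hb := ⟨ha.1.add hb.1, fun p => by rw [map_add, ha.2, hb.2, add_zero]⟩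
  smul_mem' r g hg := ⟨by rw [smul_eq_C_mul]; exact hg.1.C_mul r, fun p => by
    rw [smul_eval, hg.2, mul_zero]⟩

/-- The graded pieces of the ideal of the points `z p` in `R/(f)`. -/
noncomputable abbrev Mg {Z : Type*} (f : MvPolynomial (Fin 4) k) (z : Z → Fin 4 → k) (t : ℕ) :
    Submodule k (MvPolynomial (Fin 4) k ⧸ Ideal.span {f}) :=
  qmap f (vSub z t)

variable {Z : Type*} {z : Z → Fin 4 → k}

lemma eval_act (D : Matrix ι κ (MvPolynomial (Fin 4) k)) (m : κ → MvPolynomial (Fin 4) k)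
    (y : Fin 4 → k) :
    (fun i => eval y (act D m i)) = act (D.map (eval y)) fun j => eval y (m j) := by
  ext i; simp [act, map_sum]

lemma eval_eq_of_qmk {g h : MvPolynomial (Fin 4) k} (e : qmk f g = qmk f h) {y : Fin 4 → k}
    (hy : eval y f = 0) : eval y g = eval y h := by
  rw [← sub_eq_zero, ← map_sub, qmk_eq_zero] at e
  obtain ⟨q, hq⟩ := e
  have := congrArg (eval y) hq
  rwa [map_mul, hy, zero_mul, map_sub, sub_eq_zero] at this

lemma KEx.vanish {D₀ : Matrix ι κ (MvPolynomial (Fin 4) k)}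
    {D₁ : Matrix κ μ (MvPolynomial (Fin 4) k)} {D₂ : Matrix μ ν (MvPolynomial (Fin 4) k)}
    (h12 : D₁ * D₂ = 0) (hD₂ : IsLin D₂) (hz : ∀ p, eval (z p) f = 0) {s : ℕ}
    (hA : KEx D₀ D₁ (Ag f (s + 1)) (Ag f (s + 2)))
    (hint : ∀ b : Z → μ → k, (∀ p, act (D₁.map (eval (z p))) (b p) = 0) →
      ∃ c : ν → MvPolynomial (Fin 4) k, (∀ j, (c j).IsHomogeneous s) ∧
        ∀ p, act (D₂.map (eval (z p))) (fun j => eval (z p) (c j)) = b p) :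
    KEx D₀ D₁ (Mg f z (s + 1)) (Mg f z (s + 2)) := by
  intro m hm hm0
  choose l hl hlm using hm
  obtain ⟨n, hn, hnm⟩ := hA m (fun j => ⟨l j, (hl j).1, hlm j⟩) hm0
  choose n' hn' hnn using hn
  have hnn' : (fun j => qmk f (n' j)) = n := funext hnn
  have hval : ∀ p, act (D₁.map (eval (z p))) (fun j => eval (z p) (n' j)) = 0 := fun p => by
    rw [← eval_act]
    ext1 i
    have h1 : qmk f (act D₁ n' i) = qmk f (l i) := by
      have := congrFun (act_map (qmk f) D₁ n') i
      rw [← this, hnn', hnm]; exact (hlm i).symm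
    rw [eval_eq_of_qmk h1 (hz p), (hl i).2 p]; rfl
  obtain ⟨c, hc, hcv⟩ := hint (fun p j => eval (z p) (n' j)) hval
  refine ⟨fun j => qmk f (n' j - act D₂ c j), fun j => qmk_mem_qmap ⟨?_, fun p => ?_⟩, ?_⟩
  · refine (hn' j).sub ?_
    have := hD₂.act_mem (c := 0) (t := s) (m := c)
      (fun j => by rw [← homogeneousSubmodule_eq_grad]; exact hc j) j
    rwa [← homogeneousSubmodule_eq_grad] at this
  · have := congrFun (hcv p) j
    rw [← eval_act] at this
    rw [map_sub]
    exact sub_eq_zero.2 this.symm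
  · have h1 := act_map (qmk f) D₁ (n' - act D₂ c)
    have h2 : act D₁ (n' - act D₂ c) = act D₁ n' := by
      rw [act_sub, act_act, h12, act_zero_matrix, sub_zero]
    refine h1.trans ?_
    rw [h2, ← act_map, hnn', hnm]

end Quotient

section Count

variable {k : Type*} [Field k] {ι : Type*}

lemma two_mul_choose_add_three (t : ℕ) :
    2 * (t + 3).choose 3 = 2 * t.choose 3 + 3 * (t * (t + 1)) + 2 := by
  have h2 : ∀ n : ℕ, 2 * (n + 1).choose 2 = n * (n + 1) := fun n => by
    rw [Nat.choose_two_right, Nat.add_sub_cancel, Nat.mul_div_cancel', mul_comm]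
    exact (Nat.even_mul_pred_self (n + 1)).two_dvd
  induction t with
  | zero => rfl
  | succ t ih =>
    have e1 : (t + 1 + 3).choose 3 = (t + 3).choose 2 + (t + 3).choose 3 :=
      Nat.choose_succ_succ _ _
    have e2 : (t + 1).choose 3 = t.choose 2 + t.choose 3 := Nat.choose_succ_succ _ _
    have e3 := h2 (t + 2)
    have e4 : 2 * t.choose 2 + t = t * t := by
      cases t with
      | zero => rfl
      | succ t => rw [h2]; ring
    rw [e1, e2]
    nlinarith

variable {z : ι → Fin 4 → k}

lemma vSub_le (t : ℕ) : vSub z t ≤ homogeneousSubmodule (Fin 4) k t := fun _ h => h.1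

instance (t : ℕ) : FiniteDimensional k (vSub z t) :=
  Submodule.finiteDimensional_of_le (vSub_le t)

lemma finrank_vSub [Fintype ι] {t : ℕ} (h : SurjEv t z) :
    Module.finrank k (vSub z t) + Fintype.card ι = (t + 3).choose 3 := by
  let φ : homogeneousSubmodule (Fin 4) k t →ₗ[k] (ι → k) :=
    { toFun := fun g p => eval (z p) g.1
      map_add' := fun g g' => by ext p; simp
      map_smul' := fun r g => by ext p; simp [smul_eval] }
  have hφ : ∀ g p, φ g p = eval (z p) g.1 := fun _ _ => rfl
  have h1 := LinearMap.finrank_range_add_finrank_ker φ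
  rw [LinearMap.range_eq_top.2 fun y => by
    obtain ⟨g, hg, hgy⟩ := h y
    exact ⟨⟨g, hg⟩, funext fun p => (hφ _ _).trans (hgy p)⟩, finrank_top,
    Module.finrank_fintype_fun_eq_card, finrank_homogeneousSubmodule] at h1
  have h2 : (LinearMap.ker φ).map (homogeneousSubmodule (Fin 4) k t).subtype = vSub z t := by
    ext x
    simp only [Submodule.mem_map, LinearMap.mem_ker, Submodule.subtype_apply, Subtype.exists]
    constructor
    · rintro ⟨y, hy, h0, rfl⟩
      exact ⟨hy, fun p => by rw [← hφ ⟨y, hy⟩, h0]; rfl⟩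
    · rintro ⟨hx, h0⟩
      exact ⟨x, hx, funext fun p => (hφ _ _).trans (h0 p), rfl⟩
  rw [← h2, Submodule.finrank_map_subtype_eq, add_comm, h1]

variable {f : MvPolynomial (Fin 4) k}

lemma mul_mem_vSub {d t : ℕ} (hf : f.IsHomogeneous d) (hz : ∀ p, eval (z p) f = 0)
    {q : MvPolynomial (Fin 4) k} (hq : q ∈ grad k (Fin 4) d t) : f * q ∈ vSub z t := by
  refine ⟨?_, fun p => by rw [map_mul, hz, zero_mul]⟩
  unfold grad at hq
  split_ifs at hq with hc
  · have := hf.mul hq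
    rwa [show d + (t - d) = t by omega] at this
  · rw [(Submodule.mem_bot k).1 hq, mul_zero]; exact isHomogeneous_zero _ _ _

lemma finrank_Mg (hf : f.IsHomogeneous 3) (h0 : f ≠ 0) (hz : ∀ p, eval (z p) f = 0) (t : ℕ) :
    Module.finrank k (Mg f z t) + t.choose 3 = Module.finrank k (vSub z t) :=
  finrank_qmap hf h0 (vSub_le t) fun _ hq => mul_mem_vSub hf hz hq

lemma not_dvd_X (hf : f.IsHomogeneous 3) (i : Fin 4) : ¬ f ∣ X i := by
  intro h
  obtain ⟨q, hq, e⟩ := exists_grad_of_dvd hf (isHomogeneous_X _ _) h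
  rw [grad_of_lt (by omega), Submodule.mem_bot] at hq
  rw [hq, mul_zero] at e
  exact X_ne_zero i e

lemma qmk_mem_Mg {t : ℕ} (hz : ∀ p, eval (z p) f = 0) {g : MvPolynomial (Fin 4) k}
    (hg : g.IsHomogeneous t) : qmk f g ∈ Mg f z t ↔ ∀ p, eval (z p) g = 0 := by
  constructor
  · rintro ⟨g', hg', e⟩ p
    rw [← hg'.2 p]
    exact (eval_eq_of_qmk e (hz p)).symm
  · exact fun h => qmk_mem_qmap ⟨hg, h⟩

lemma finrank_Mg_le_succ (hf : f.IsHomogeneous 3) (hp : Prime f) (t : ℕ) :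
    Module.finrank k (Mg f z t) ≤ Module.finrank k (Mg f z (t + 1)) := by
  let φ : (MvPolynomial (Fin 4) k ⧸ Ideal.span {f}) →ₗ[k] _ :=
    ((LinearMap.lsmul (MvPolynomial (Fin 4) k) (MvPolynomial (Fin 4) k ⧸ Ideal.span {f})
      (X 0)).restrictScalars k)
  have hφ : ∀ g, φ (qmk f g) = qmk f (X 0 * g) := fun g => rfl
  have hi : Function.Injective φ := by
    rw [injective_iff_map_eq_zero]
    intro y hy
    obtain ⟨g, rfl⟩ := Submodule.mkQ_surjective _ y
    have h1 := qmk_eq_zero.1 ((hφ g).symm.trans hy)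
    exact qmk_eq_zero.2 ((hp.dvd_or_dvd h1).resolve_left (not_dvd_X hf 0))
  rw [(Submodule.equivMapOfInjective φ hi _).finrank_eq]
  refine Submodule.finrank_mono ?_
  rintro _ ⟨_, ⟨g, hg, rfl⟩, rfl⟩
  have : X 0 * g ∈ vSub z (t + 1) := by
    refine ⟨?_, fun p => by rw [map_mul, hg.2, mul_zero]⟩
    rw [add_comm]
    exact (isHomogeneous_X _ _).mul hg.1
  exact qmk_mem_qmap this

/-- Points imposing enough conditions lie on no surface of degree `b` not containing `X`. -/
lemma SurjQ.dvd [Fintype ι] {b : ℕ} (hb : b ≠ 0) (h : SurjQ b z) (hf : f.IsHomogeneous 3)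
    (hp : Prime f) (hz : ∀ p, eval (z p) f = 0)
    (hcard : 2 * Fintype.card ι = 3 * (b * (b + 1)) + 2 + 2 * b)
    {g : MvPolynomial (Fin 4) k} (hg : g.IsHomogeneous b) (hgz : ∀ p, eval (z p) g = 0) :
    f ∣ g := by
  obtain ⟨s, rfl⟩ := Nat.exists_eq_succ_of_ne_zero hb
  simp only [Nat.succ_eq_add_one] at *
  let Θ : ((Fin 4 → homogeneousSubmodule (Fin 4) k (s + 1)) × (ι → k)) →ₗ[k]
      (ι → Fin 4 → k) :=
    { toFun := fun v p i => eval (z p) (v.1 i).1 - v.2 p * z p i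
      map_add' := fun v w => by ext p i; simp; ring
      map_smul' := fun r v => by ext p i; simp [smul_eval]; ring }
  let Ψ : ((Fin 4 → vSub z (s + 1)) × homogeneousSubmodule (Fin 4) k s) →ₗ[k]
      ((Fin 4 → homogeneousSubmodule (Fin 4) k (s + 1)) × (ι → k)) :=
    { toFun := fun v => (fun i => ⟨(v.1 i).1 + v.2.1 * X i,
        (v.1 i).2.1.add (v.2.2.mul (isHomogeneous_X _ _))⟩, fun p => eval (z p) v.2.1)
      map_add' := fun v w => by
        refine Prod.ext (funext fun i => Subtype.ext ?_) (funext fun p => ?_)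
        · simp; ring
        · simp
      map_smul' := fun r v => by ext <;> simp [smul_eval] }
  have hΘ : Function.Surjective Θ := fun t => by
    obtain ⟨v, hv, c, hc⟩ := h t
    exact ⟨(fun i => ⟨v i, hv i⟩, c), by ext p i; simp [Θ, hc]⟩
  have hΨ : LinearMap.range Ψ ≤ LinearMap.ker Θ := by
    rintro _ ⟨v, rfl⟩
    rw [LinearMap.mem_ker]
    ext p i
    simp [Θ, Ψ, (v.1 i).2.2 p]
  let χ : LinearMap.ker Ψ →ₗ[k] vSub z s :=
    { toFun := fun v => ⟨v.1.2.1, v.1.2.2, fun p => by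
        have := congrArg (fun w => w.2 p) (LinearMap.mem_ker.1 v.2)
        exact this⟩
      map_add' := fun _ _ => rfl
      map_smul' := fun _ _ => rfl }
  have hχ : Function.Injective χ := by
    rw [injective_iff_map_eq_zero]
    rintro ⟨⟨n, g⟩, hv⟩ h0
    have hg0 : g = 0 := Subtype.ext (congrArg (fun w : vSub z s => (w : MvPolynomial (Fin 4) k)) h0)
    have hn : n = 0 := by
      ext1 i
      have := congrArg (fun w => (w.1 i).1) (LinearMap.mem_ker.1 hv)
      refine Subtype.ext ?_
      simpa [Ψ, hg0] using this
    simp [hg0, hn]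
  have r1 := LinearMap.finrank_range_add_finrank_ker Θ
  rw [LinearMap.range_eq_top.2 hΘ, finrank_top] at r1
  have r2 := LinearMap.finrank_range_add_finrank_ker Ψ
  have r3 := Submodule.finrank_mono hΨ
  have r4 := LinearMap.finrank_le_finrank_of_injective hχ
  simp only [Module.finrank_prod, Module.finrank_pi_fintype, finrank_homogeneousSubmodule,
    Finset.sum_const, Finset.card_univ, Fintype.card_fin, Module.finrank_self, smul_eq_mul,
    mul_one] at r1 r2
  have r5 := finrank_Mg hf hp.ne_zero hz s
  have r6 := finrank_Mg hf hp.ne_zero hz (s + 1)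
  have r7 := finrank_Mg_le_succ (z := z) hf hp s
  have c1 := two_mul_choose_add_three s
  have c2 := two_mul_choose_add_three (s + 1)
  have hM : Module.finrank k (Mg f z (s + 1)) = 0 := by
    nlinarith
  have := Submodule.finrank_eq_zero.1 hM
  rw [← qmk_eq_zero, ← Submodule.mem_bot k, ← this]
  exact qmk_mem_qmap ⟨hg, hgz⟩

end Count

section Resolution

variable {k : Type} [Field k] {f : MvPolynomial (Fin 4) k} {Z : Type} {z : Z → Fin 4 → k}

lemma kos1_map (y : Fin 4 → k) :
    (kos1 (X : Fin 4 → MvPolynomial (Fin 4) k)).map (eval y) = kos1 y := by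
  ext i j
  fin_cases i; fin_cases j <;> simp [kos1]

lemma kos2_map (y : Fin 4 → k) :
    (kos2 (X : Fin 4 → MvPolynomial (Fin 4) k)).map (eval y) = kos2 y := by
  ext i j
  fin_cases i <;> fin_cases j <;> simp [kos2]

lemma kos3_map (y : Fin 4 → k) :
    (kos3 (X : Fin 4 → MvPolynomial (Fin 4) k)).map (eval y) = kos3 y := by
  ext i j
  fin_cases i <;> fin_cases j <;> simp [kos3]

lemma kos4_map (y : Fin 4 → k) :
    (kos4 (X : Fin 4 → MvPolynomial (Fin 4) k)).map (eval y) = kos4 y := by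
  ext i j
  fin_cases i <;> fin_cases j <;> simp [kos4]

lemma Ag_exact₀ (hf : f.IsHomogeneous 3) (h0 : f ≠ 0) (t : ℕ) :
    KEx (kos0 (MvPolynomial (Fin 4) k)) (kos1 X) (Ag f t) (Ag f (t + 1)) :=
  KEx.quot (D := kosZ _) (Matrix.zero_mul _) isLin_zero hf h0 (koszul_exact₀ (by omega))
    fun m _ _ => ⟨0, fun _ => Submodule.zero_mem _, Subsingleton.elim _ _⟩

lemma Ag_exact₁ (hf : f.IsHomogeneous 3) (h0 : f ≠ 0) (t : ℕ) :
    KEx (kos1 (X : Fin 4 → MvPolynomial (Fin 4) k)) (kos2 X) (Ag f (t + 2)) (Ag f (t + 3)) :=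
  KEx.quot (D := kos0 _) (Matrix.zero_mul _) isLin_kos1 hf h0
    (koszul_exact₁.graded isLin_kos2 _ _) (koszul_exact₀ (by omega))

lemma Ag_exact₂ (hf : f.IsHomogeneous 3) (h0 : f ≠ 0) (t : ℕ) :
    KEx (kos2 (X : Fin 4 → MvPolynomial (Fin 4) k)) (kos3 X) (Ag f t) (Ag f (t + 1)) :=
  KEx.quot (kos1_mul_kos2 _) isLin_kos2 hf h0
    (koszul_exact₂.graded isLin_kos3 _ _) (koszul_exact₁.graded isLin_kos2 _ _)

lemma Ag_exact₃ (hf : f.IsHomogeneous 3) (h0 : f ≠ 0) (t : ℕ) :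
    KEx (kos3 (X : Fin 4 → MvPolynomial (Fin 4) k)) (kos4 X) (Ag f t) (Ag f (t + 1)) :=
  KEx.quot (kos2_mul_kos3 _) isLin_kos3 hf h0
    (koszul_exact₃.graded isLin_kos4 _ _) (koszul_exact₂.graded isLin_kos3 _ _)

/-- Interpolation of cycles by boundaries, given surjectivity of evaluation. -/
lemma SurjEv.interp {κ μ ν : Type*} [Fintype κ] [Fintype μ] [Fintype ν]
    {D₁ : (Fin 4 → k) → Matrix κ μ k} {D₂ : (Fin 4 → k) → Matrix μ ν k} {s : ℕ}
    (h : SurjEv s z) (hD : ∀ p, KEx (D₁ (z p)) (D₂ (z p)) (⊤ : Submodule k k) ⊤)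
    (b : Z → μ → k) (hb : ∀ p, act (D₁ (z p)) (b p) = 0) :
    ∃ c : ν → MvPolynomial (Fin 4) k, (∀ j, (c j).IsHomogeneous s) ∧
      ∀ p, act (D₂ (z p)) (fun j => eval (z p) (c j)) = b p := by
  choose n _ hn using fun p => hD p (b p) (fun _ => trivial) (hb p)
  choose c hc hcv using fun j => h fun p => n p j
  refine ⟨c, hc, fun p => ?_⟩
  simp only [hcv]
  exact hn p

lemma SurjO.interp {a : ℕ} (h : SurjO a z) (b : Z → Fin 4 → k)
    (hb : ∀ p, act (kos1 (z p)) (b p) = 0) :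
    ∃ c : Fin 6 → MvPolynomial (Fin 4) k, (∀ j, (c j).IsHomogeneous a) ∧
      ∀ p, act (kos2 (z p)) (fun j => eval (z p) (c j)) = b p := by
  obtain ⟨β, h0, hanti, hβ, hv⟩ := h b fun p => by
    have := congrFun (hb p) 0
    rw [act_kos1] at this
    simp only [smul_eq_mul, Pi.zero_apply] at this
    rw [Fin.sum_univ_four, ← this]; ring
  refine ⟨![β 0 1, β 0 2, β 0 3, β 1 2, β 1 3, β 2 3], fun j => by fin_cases j <;> exact hβ _ _,
    fun p => ?_⟩
  rw [act_kos2]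
  ext i
  rw [← hv p i, Fin.sum_univ_four]
  fin_cases i
  · simp [h0]
  · simp [h0, hanti 0 1]
  · simp [h0, hanti 0 2, hanti 1 2]; ring
  · simp [h0, hanti 0 3, hanti 1 3, hanti 2 3]; ring

lemma SurjQ.interp {a : ℕ} (h0 : ∀ p, z p ≠ 0) (h : SurjQ a z) (b : Z → Fin 6 → k)
    (hb : ∀ p, act (kos2 (z p)) (b p) = 0) :
    ∃ c : Fin 4 → MvPolynomial (Fin 4) k, (∀ j, (c j).IsHomogeneous a) ∧
      ∀ p, act (kos3 (z p)) (fun j => eval (z p) (c j)) = b p := by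
  choose n _ hn using fun p => koszul_field_exact₂ (h0 p) (b p) (fun _ => trivial) (hb p)
  obtain ⟨v, hv, c, hc⟩ := h n
  refine ⟨v, hv, fun p => ?_⟩
  simp only [hc]
  rw [← hn p, act_kos3, act_kos3]
  ext i
  fin_cases i <;> simp <;> ring

variable [Fintype Z] {a : ℕ}

lemma Mg_exact₀ (hf : f.IsHomogeneous 3) (h0 : f ≠ 0) (hz : ∀ p, eval (z p) f = 0) (ha : a ≠ 0)
    (hQ : SurjQ a z) (hO : SurjO a z) {t : ℕ} (ht : a < t) :
    KEx (kos0 (MvPolynomial (Fin 4) k)) (kos1 X) (Mg f z t) (Mg f z (t + 1)) := by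
  obtain ⟨s, rfl⟩ : ∃ s, t = s + 1 := ⟨t - 1, by omega⟩
  refine KEx.vanish (kos1_mul_kos2 _) isLin_kos2 hz (Ag_exact₀ hf h0 _) ?_
  simp only [kos1_map, kos2_map]
  rcases (Nat.lt_succ_iff.1 ht).lt_or_eq with h | rfl
  · exact (hQ.surjEv_of_lt ha h).interp fun p => koszul_field_exact₁ (hQ.ne_zero ha p)
  · exact hO.interp

lemma Mg_exact₁ (hf : f.IsHomogeneous 3) (h0 : f ≠ 0) (hz : ∀ p, eval (z p) f = 0) (ha : a ≠ 0)
    (hQ : SurjQ a z) {t : ℕ} (ht : a < t) :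
    KEx (kos1 (X : Fin 4 → MvPolynomial (Fin 4) k)) (kos2 X) (Mg f z t) (Mg f z (t + 1)) := by
  obtain ⟨s, rfl⟩ : ∃ s, t = s + 1 + 1 := ⟨t - 2, by omega⟩
  refine KEx.vanish (kos2_mul_kos3 _) isLin_kos3 hz (Ag_exact₁ hf h0 _) ?_
  simp only [kos2_map, kos3_map]
  rcases (Nat.lt_succ_iff.1 ht).lt_or_eq with h | h
  · exact (hQ.surjEv_of_lt ha h).interp fun p => koszul_field_exact₂ (hQ.ne_zero ha p)
  · rw [← h]; exact hQ.interp fun p => hQ.ne_zero ha p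

lemma Mg_exact₂ (hf : f.IsHomogeneous 3) (h0 : f ≠ 0) (hz : ∀ p, eval (z p) f = 0) (ha : a ≠ 0)
    (hQ : SurjQ a z) {t : ℕ} (ht : a + 1 < t) :
    KEx (kos2 (X : Fin 4 → MvPolynomial (Fin 4) k)) (kos3 X) (Mg f z t) (Mg f z (t + 1)) := by
  obtain ⟨s, rfl⟩ : ∃ s, t = s + 1 := ⟨t - 1, by omega⟩
  refine KEx.vanish (kos3_mul_kos4 _) isLin_kos4 hz (Ag_exact₂ hf h0 _) ?_
  simp only [kos3_map, kos4_map]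
  exact (hQ.surjEv_of_lt ha (by omega)).interp fun p => koszul_field_exact₃ (hQ.ne_zero ha p)

lemma Mg_exact₃ (hf : f.IsHomogeneous 3) (h0 : f ≠ 0) (hz : ∀ p, eval (z p) f = 0) (ha : a ≠ 0)
    (hQ : SurjQ a z) {t : ℕ} (ht : a < t) :
    KEx (kos3 (X : Fin 4 → MvPolynomial (Fin 4) k)) (kos4 X) (Mg f z t) (Mg f z (t + 1)) := by
  obtain ⟨s, rfl⟩ : ∃ s, t = s + 1 := ⟨t - 1, by omega⟩
  refine KEx.vanish (D₂ := kos5 _) (Matrix.mul_zero _) isLin_zero hz (Ag_exact₃ hf h0 _) ?_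
  simp only [kos4_map, kos5, Matrix.map_zero _ (map_zero _)]
  intro b hb
  refine ⟨0, fun _ => isHomogeneous_zero _ _ _, fun p => ?_⟩
  obtain ⟨n, -, hn⟩ := koszul_field_exact₄ (hQ.ne_zero ha p) (b p) (fun _ => trivial) (hb p)
  rw [← hn, kos5, act_zero_matrix, act_zero_matrix]

lemma Mg_smul (t : ℕ) (i : Fin 4) (y : MvPolynomial (Fin 4) k ⧸ Ideal.span {f})
    (hy : y ∈ Mg f z t) : (X i : MvPolynomial (Fin 4) k) • y ∈ Mg f z (t + 1) := by
  obtain ⟨g, hg, rfl⟩ := hy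
  have : X i * g ∈ vSub z (t + 1) := by
    refine ⟨?_, fun p => by rw [map_mul, hg.2, mul_zero]⟩
    rw [add_comm]
    exact (isHomogeneous_X _ _).mul hg.1
  exact qmk_mem_qmap this

lemma grIndep_Ag (hf : f.IsHomogeneous 3) : GrIndep (k := k) (Ag f) := by
  intro N y hy h0 t ht
  choose g hg hgy using hy
  have hd : f ∣ ∑ t ∈ Finset.range N, g t := by
    rw [← qmk_eq_zero, map_sum, ← h0]
    exact Finset.sum_congr rfl fun t _ => hgy t
  obtain ⟨q, hq⟩ := hd
  have := congrArg (homogeneousComponent t) hq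
  rw [homogeneousComponent_mul hf, map_sum, Finset.sum_eq_single t] at this
  · rw [homogeneousComponent_eq_self (hg t)] at this
    rw [← hgy t]
    exact qmk_eq_zero.2 ⟨_, this⟩
  · intro s _ hst
    rw [homogeneousComponent_of_mem (hg s), if_neg (Ne.symm hst)]
  · intro h
    exact absurd (Finset.mem_range.2 ht) h

lemma grIndep_Mg (hf : f.IsHomogeneous 3) : GrIndep (k := k) (Mg f z) :=
  (grIndep_Ag hf).mono fun t => Submodule.map_mono (vSub_le t)

end Resolution

section MinimalResolution

variable {k : Type} [Field k] {f : MvPolynomial (Fin 4) k} {Z : Type} {z : Z → Fin 4 → k}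
  {a : ℕ}

instance {V : Type*} [AddCommGroup V] [Module (MvPolynomial (Fin 4) k) V] [Module k V]
    [IsScalarTower k (MvPolynomial (Fin 4) k) V] {n : ℕ} (v : Fin n → V) (c t : ℕ) :
    FiniteDimensional k (syz k v c t) :=
  Submodule.finiteDimensional_of_le (inf_le_left : syz k v c t ≤ fgrad k n c t)

instance (t : ℕ) : FiniteDimensional k (Mg f z t) := by
  unfold Mg qmap
  infer_instance

lemma two_mul_finrank_Mg [Fintype Z] (hf : f.IsHomogeneous 3) (h0 : f ≠ 0)
    (hz : ∀ p, eval (z p) f = 0) {t : ℕ} (h : SurjEv t z) :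
    2 * Module.finrank k (Mg f z t) + 2 * Fintype.card Z = 3 * (t * (t + 1)) + 2 := by
  have h1 := finrank_Mg hf h0 hz t
  have h2 := finrank_vSub h
  have h3 := two_mul_choose_add_three t
  omega

lemma Mg_eq_bot [Fintype Z] (hf : f.IsHomogeneous 3) (hp : Prime f)
    (hz : ∀ p, eval (z p) f = 0) (ha : a ≠ 0) (hQ : SurjQ a z)
    (hcard : 2 * Fintype.card Z = 3 * (a * (a + 1)) + 2 + 2 * a) {t : ℕ} (ht : t < a + 1) :
    Mg f z t = ⊥ := by
  have h1 : Mg f z a = ⊥ := by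
    rw [eq_bot_iff]
    rintro _ ⟨g, hg, rfl⟩
    exact (qmk_eq_zero).2 (hQ.dvd ha hf hp hz hcard hg.1 hg.2)
  have h2 : Module.finrank k (Mg f z t) ≤ Module.finrank k (Mg f z a) := by
    obtain ⟨n, rfl⟩ := Nat.exists_eq_add_of_le (Nat.lt_succ_iff.1 ht)
    clear h1 ht hQ hcard ha
    induction n with
    | zero => exact le_rfl
    | succ n ih => exact ih.trans (finrank_Mg_le_succ hf hp _)
  rw [h1, finrank_bot, Nat.le_zero] at h2
  exact Submodule.finrank_eq_zero.1 h2

lemma entryOk_of_mem_fgrad {n c d : ℕ} {x : Fin n → MvPolynomial (Fin 4) k}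
    (hx : x ∈ fgrad k n c d) (hcd : c < d) (i : Fin n) : EntryOk k d c (x i) := by
  have h := mem_fgrad.1 hx i
  rw [grad_of_le hcd.le, mem_homogeneousSubmodule] at h
  refine ⟨Or.inr ⟨d - c, by omega, h⟩, h.coeff_eq_zero ?_⟩
  rw [map_zero]
  omega

set_option maxHeartbeats 1000000 in
/-- The generators of the successive syzygy modules. -/
lemma exists_pres [Fintype Z] (hf : f.IsHomogeneous 3) (hp : Prime f)
    (hz : ∀ p, eval (z p) f = 0) (ha : a ≠ 0) (hQ : SurjQ a z) (hO : SurjO a z)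
    (hcard : 2 * Fintype.card Z = 3 * (a * (a + 1)) + 2 + 2 * a) :
    ∃ v : Fin (2 * a + 3) → MvPolynomial (Fin 4) k ⧸ Ideal.span {f},
      Pres (a + 1) (2 * a + 3) (Mg f z) v ∧
    ∃ v₁ : Fin (3 * a + 3) → Fin (2 * a + 3) → MvPolynomial (Fin 4) k,
      Pres (a + 2) (3 * a + 3) (syz k v (a + 1)) v₁ ∧
    ∃ v₂ : Fin a → Fin (3 * a + 3) → MvPolynomial (Fin 4) k,
      Pres (a + 4) a (syz k v₁ (a + 2)) v₂ ∧ ∀ t, syz k v₂ (a + 4) t = ⊥ := by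
  have h0 := hp.ne_zero
  have dM : ∀ t, a < t → 2 * Module.finrank k (Mg f z t) + 2 * Fintype.card Z =
      3 * (t * (t + 1)) + 2 := fun t ht => two_mul_finrank_Mg hf h0 hz (hQ.surjEv_of_lt ha ht)
  have d1 := dM (a + 1) (by omega)
  have d2 := dM (a + 2) (by omega)
  have d3 := dM (a + 3) (by omega)
  have d4 := dM (a + 4) (by omega)
  have e1 : Module.finrank k (Mg f z (a + 1)) = 2 * a + 3 := by nlinarith
  have e2 : Module.finrank k (Mg f z (a + 2)) = 5 * a + 9 := by nlinarith
  have e3 : Module.finrank k (Mg f z (a + 3)) = 8 * a + 18 := by nlinarith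
  have e4 : Module.finrank k (Mg f z (a + 4)) = 11 * a + 30 := by nlinarith
  obtain ⟨v, hv⟩ := Pres.exists (c := a + 1) (Pg := Mg f z) e1
    (fun t ht => Mg_eq_bot hf hp hz ha hQ hcard ht) Mg_smul
    fun t ht => Mg_exact₀ hf h0 hz ha hQ hO ht
  have c4 : Nat.choose 4 3 = 4 := rfl
  have c10 : Nat.choose 5 3 = 10 := rfl
  have c20 : Nat.choose 6 3 = 20 := rfl
  have s2 : Module.finrank k (syz k v (a + 1) (a + 2)) = 3 * a + 3 := by
    have := finrank_syz_add (t := a + 2) hv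
    rw [finrank_fgrad, show a + 2 + 3 - (a + 1) = 4 by omega, c4, e2] at this
    exact Nat.add_right_cancel (this.trans (by ring))
  have s3 : Module.finrank k (syz k v (a + 1) (a + 3)) = 12 * a + 12 := by
    have := finrank_syz_add (t := a + 3) hv
    rw [finrank_fgrad, show a + 3 + 3 - (a + 1) = 5 by omega, c10, e3] at this
    exact Nat.add_right_cancel (this.trans (by ring))
  have s4 : Module.finrank k (syz k v (a + 1) (a + 4)) = 29 * a + 30 := by
    have := finrank_syz_add (t := a + 4) hv
    rw [finrank_fgrad, show a + 4 + 3 - (a + 1) = 6 by omega, c20, e4] at this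
    exact Nat.add_right_cancel (this.trans (by ring))
  have N1₀ : ∀ t, a + 2 ≤ t → KEx (kos0 (MvPolynomial (Fin 4) k)) (kos1 X)
      (syz k v (a + 1) t) (syz k v (a + 1) (t + 1)) := fun t ht => by
    obtain ⟨s, rfl⟩ : ∃ s, t = s + 1 := ⟨t - 1, by omega⟩
    exact hv.syz_exact (kos1_mul_kos2 _) isLin_kos2 (koszul_exact₀ (by omega))
      (Mg_exact₁ hf h0 hz ha hQ (by omega))
  have N1₁ : ∀ t, a + 3 ≤ t → KEx (kos1 (X : Fin 4 → MvPolynomial (Fin 4) k)) (kos2 X)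
      (syz k v (a + 1) t) (syz k v (a + 1) (t + 1)) := fun t ht => by
    obtain ⟨s, rfl⟩ : ∃ s, t = s + 1 := ⟨t - 1, by omega⟩
    exact hv.syz_exact (kos2_mul_kos3 _) isLin_kos3 (koszul_exact₁.graded isLin_kos2 _ _)
      (Mg_exact₂ hf h0 hz ha hQ (by omega))
  have N1₂ : ∀ t, a + 2 ≤ t → KEx (kos2 (X : Fin 4 → MvPolynomial (Fin 4) k)) (kos3 X)
      (syz k v (a + 1) t) (syz k v (a + 1) (t + 1)) := fun t ht => by
    obtain ⟨s, rfl⟩ : ∃ s, t = s + 1 := ⟨t - 1, by omega⟩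
    exact hv.syz_exact (kos3_mul_kos4 _) isLin_kos4 (koszul_exact₂.graded isLin_kos3 _ _)
      (Mg_exact₃ hf h0 hz ha hQ (by omega))
  obtain ⟨v₁, hv₁⟩ := Pres.exists (c := a + 2) (Pg := syz k v (a + 1)) s2
    (fun t ht => hv.syz_low t ht) (fun t i y hy => syz_smul t i y hy) N1₀
  have r3 : syz k v₁ (a + 2) (a + 3) = ⊥ := by
    have := finrank_syz_add (t := a + 3) hv₁
    rw [finrank_fgrad, show a + 3 + 3 - (a + 2) = 4 by omega, c4, s3] at this
    exact Submodule.finrank_eq_zero.1 (Nat.add_right_cancel (this.trans (by ring)))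
  have r4 : Module.finrank k (syz k v₁ (a + 2) (a + 4)) = a := by
    have := finrank_syz_add (t := a + 4) hv₁
    rw [finrank_fgrad, show a + 4 + 3 - (a + 2) = 5 by omega, c10, s4] at this
    exact Nat.add_right_cancel (this.trans (by ring))
  have N2₀ : ∀ t, a + 4 ≤ t → KEx (kos0 (MvPolynomial (Fin 4) k)) (kos1 X)
      (syz k v₁ (a + 2) t) (syz k v₁ (a + 2) (t + 1)) := fun t ht => by
    obtain ⟨s, rfl⟩ : ∃ s, t = s + 1 := ⟨t - 1, by omega⟩
    exact hv₁.syz_exact (kos1_mul_kos2 _) isLin_kos2 (koszul_exact₀ (by omega))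
      (N1₁ _ (by omega))
  have N2₁ : ∀ t, a + 3 ≤ t → KEx (kos1 (X : Fin 4 → MvPolynomial (Fin 4) k)) (kos2 X)
      (syz k v₁ (a + 2) t) (syz k v₁ (a + 2) (t + 1)) := fun t ht => by
    obtain ⟨s, rfl⟩ : ∃ s, t = s + 1 := ⟨t - 1, by omega⟩
    exact hv₁.syz_exact (kos2_mul_kos3 _) isLin_kos3 (koszul_exact₁.graded isLin_kos2 _ _)
      (N1₂ _ (by omega))
  have low₂ : ∀ t < a + 4, syz k v₁ (a + 2) t = ⊥ := fun t ht => by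
    rcases (Nat.lt_succ_iff.1 ht).lt_or_eq with h | rfl
    · exact hv₁.syz_low t h
    · exact r3
  obtain ⟨v₂, hv₂⟩ := Pres.exists (c := a + 4) (Pg := syz k v₁ (a + 2)) r4 low₂
    (fun t i y hy => syz_smul t i y hy) N2₀
  refine ⟨v, hv, v₁, hv₁, v₂, hv₂, fun t => ?_⟩
  rcases lt_or_ge t (a + 5) with h | h
  · exact hv₂.syz_low t h
  · induction t, h using Nat.le_induction with
    | base =>
      have := hv₂.syz_exact (t := a + 3) (kos1_mul_kos2 _) isLin_kos2
        (koszul_exact₀ (by omega)) (N2₁ (a + 3) le_rfl)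
      rw [hv₂.syz_low (a + 3 + 1) (by omega)] at this
      rw [eq_bot_iff]
      intro x hx
      obtain ⟨m, hm, hmx⟩ := this (fun _ => x) (fun _ => hx) (act_zero_matrix _)
      have hm0 : m = 0 := funext fun i => (Submodule.mem_bot k).1 (hm i)
      have := congrFun hmx 0
      rw [hm0, act_zero] at this
      exact this.symm
    | succ n hn ih =>
      obtain ⟨s, rfl⟩ : ∃ s, n = s + 1 := ⟨n - 1, by omega⟩
      have := hv₂.syz_exact (t := s) (kos1_mul_kos2 _) isLin_kos2
        (koszul_exact₀ (by omega)) (N2₁ s (by omega))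
      rw [ih] at this
      rw [eq_bot_iff]
      intro x hx
      obtain ⟨m, hm, hmx⟩ := this (fun _ => x) (fun _ => hx) (act_zero_matrix _)
      have hm0 : m = 0 := funext fun i => (Submodule.mem_bot k).1 (hm i)
      have := congrFun hmx 0
      rw [hm0, act_zero] at this
      exact this.symm

/-- The minimal resolution of the ideal of points for which both multiplication conditions
hold. -/
theorem hasMinFreeRes3 [Fintype Z] (hf : f.IsHomogeneous 3) (hp : Prime f)
    (hz : ∀ p, eval (z p) f = 0) (ha : a ≠ 0) (hQ : SurjQ a z) (hO : SurjO a z)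
    (hcard : 2 * Fintype.card Z = 3 * (a * (a + 1)) + 2 + 2 * a)
    {I : Ideal (MvPolynomial (Fin 4) k)}
    (hI : ∀ g, g ∈ I ↔ ∀ t p, eval (z p) (homogeneousComponent t g) = 0) :
    HasMinFreeRes3 k (Ideal.span {f}) I (fun _ : Fin (2 * a + 3) => a + 1)
      (fun _ : Fin (3 * a + 3) => a + 2) (fun _ : Fin a => a + 4) := by
  obtain ⟨v, hv, v₁, hv₁, v₂, hv₂, N3⟩ := exists_pres hf hp hz ha hQ hO hcard
  choose g hg hgv using hv.mem
  have hlc : ∀ w : Fin (2 * a + 3) → MvPolynomial (Fin 4) k,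
      lc k v w = qmk f (∑ j, w j * g j) := fun w => by
    rw [Fintype.linearCombination_apply, map_sum]
    refine Finset.sum_congr rfl fun j _ => ?_
    rw [← smul_eq_mul, map_smul]
    exact congrArg (w j • ·) (hgv j).symm
  have hlc₁ : ∀ (u : Fin (3 * a + 3) → MvPolynomial (Fin 4) k) j,
      lc k v₁ u j = ∑ i, u i * v₁ i j := fun u j => by
    simp [Fintype.linearCombination_apply]
  have hlc₂ : ∀ (u : Fin a → MvPolynomial (Fin 4) k) j,
      lc k v₂ u j = ∑ i, u i * v₂ i j := fun u j => by
    simp [Fintype.linearCombination_apply]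
  have hv₁' : ∀ i, v₁ i ∈ fgrad k _ (a + 1) (a + 2) ∧ lc k v (v₁ i) = 0 :=
    fun i => mem_syz.1 (hv₁.mem i)
  have hv₂' : ∀ i, v₂ i ∈ fgrad k _ (a + 2) (a + 4) ∧ lc k v₁ (v₂ i) = 0 :=
    fun i => mem_syz.1 (hv₂.mem i)
  have hi : GrIndep (k := k) (Mg f z) := grIndep_Mg hf
  refine ⟨g, v₁, v₂, fun j => ⟨(hI _).2 fun t p => ?_, (hg j).1⟩, fun x hx => ?_,
    fun i j => entryOk_of_mem_fgrad (hv₁' i).1 (by omega) j,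
    fun i j => entryOk_of_mem_fgrad (hv₂' i).1 (by omega) j, fun w => ?_, fun u => ?_,
    fun u hu => ?_⟩
  · rw [homogeneousComponent_of_mem (hg j).1]
    split_ifs
    · exact (hg j).2 p
    · exact map_zero _
  · rw [hI] at hx
    have hx' : ∀ t, qmk f (homogeneousComponent t x) ∈ Mg f z t := fun t =>
      (qmk_mem_Mg hz (homogeneousComponent_isHomogeneous _ _)).2 (hx t)
    choose w _ hwx using fun t => hv.lc_surj t _ (hx' t)
    refine ⟨∑ t ∈ Finset.range (x.totalDegree + 1), w t, ?_⟩
    rw [Ideal.mem_span_singleton, ← qmk_eq_zero, map_sub, ← hlc, map_sum,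
      Finset.sum_congr rfl fun t _ => hwx t, ← map_sum, sum_homogeneousComponent, sub_self]
  · rw [Ideal.mem_span_singleton, ← qmk_eq_zero, ← hlc]
    constructor
    · intro hw
      obtain ⟨u, hu⟩ := hv.ker_le hi (N := LinearMap.range (lc k v₁)) (fun t x hx => by
        obtain ⟨u, -, hu⟩ := hv₁.lc_surj t x hx
        exact ⟨u, hu⟩) w hw
      exact ⟨u, fun j => by rw [← hu, hlc₁]⟩
    · rintro ⟨u, hu⟩
      have : w = lc k v₁ u := funext fun j => by rw [hu, hlc₁]
      rw [this, show lc k v₁ u = ∑ i, u i • v₁ i from Fintype.linearCombination_apply _ _ _,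
        map_sum]
      exact Finset.sum_eq_zero fun i _ => by rw [map_smul, (hv₁' i).2, smul_zero]
  · simp only [← hlc₁]
    constructor
    · intro hu
      obtain ⟨y, hy⟩ := hv₁.ker_le ((grIndep_fgrad _ _).mono fun t => inf_le_left)
        (N := LinearMap.range (lc k v₂)) (fun t x hx => by
          obtain ⟨u, -, hu⟩ := hv₂.lc_surj t x hx
          exact ⟨u, hu⟩) u (funext hu)
      exact ⟨y, fun j => by rw [← hy, hlc₂]⟩
    · rintro ⟨y, hy⟩ j
      have : u = lc k v₂ y := funext fun j => by rw [hy, hlc₂]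
      rw [this, show lc k v₂ y = ∑ i, y i • v₂ i from Fintype.linearCombination_apply _ _ _,
        map_sum, Finset.sum_eq_zero fun i _ => ?_]
      · rfl
      · rw [map_smul, (hv₂' i).2, smul_zero]
  · simp only [← hlc₂] at hu
    have := hv₂.ker_le ((grIndep_fgrad _ _).mono fun t => inf_le_left) (N := ⊥)
      (fun t x hx => by rw [N3] at hx; simpa using hx) u (funext hu)
    simpa using this

end MinimalResolution

section Density

variable {k : Type*} [Field k] {f : MvPolynomial (Fin 4) k}

/-- The Nullstellensatz for a prime hypersurface. -/
lemma dvd_of_forall_eval {σ : Type*} [Finite σ] [IsAlgClosed k] {f : MvPolynomial σ k}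
    (hp : Prime f) {g : MvPolynomial σ k} (h : ∀ v, eval v f = 0 → eval v g = 0) : f ∣ g := by
  have hI : (Ideal.span {f}).IsPrime := (Ideal.span_singleton_prime hp.ne_zero).2 hp
  have h1 := IsPrime.vanishingIdeal_zeroLocus (k := k) (K := k) (Ideal.span {f})
  rw [← Ideal.mem_span_singleton, ← h1, mem_vanishingIdeal_iff]
  intro v hv
  rw [mem_zeroLocus_iff] at hv
  simpa using h v (by simpa using hv f (Ideal.mem_span_singleton_self f))

lemma exists_eval_ne_zero_of_not_dvd [IsAlgClosed k] (hp : Prime f)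
    {g : MvPolynomial (Fin 4) k} (h : ¬ f ∣ g) : ∃ v, eval v f = 0 ∧ eval v g ≠ 0 := by
  by_contra! H
  exact h (dvd_of_forall_eval hp H)

/-- Nonempty open subsets of an irreducible hypersurface meet. -/
lemma exists_common_ne_zero [IsAlgClosed k] (hp : Prime f) {g₁ g₂ : MvPolynomial (Fin 4) k}
    {u₁ u₂ : Fin 4 → k} (hu₁ : eval u₁ f = 0) (hu₂ : eval u₂ f = 0) (h₁ : eval u₁ g₁ ≠ 0)
    (h₂ : eval u₂ g₂ ≠ 0) : ∃ u, eval u f = 0 ∧ eval u g₁ ≠ 0 ∧ eval u g₂ ≠ 0 := by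
  have : ¬ f ∣ g₁ * g₂ := fun h => by
    rcases hp.dvd_or_dvd h with ⟨q, rfl⟩ | ⟨q, rfl⟩
    · exact h₁ (by rw [map_mul, hu₁, zero_mul])
    · exact h₂ (by rw [map_mul, hu₂, zero_mul])
  obtain ⟨u, hu, hg⟩ := exists_eval_ne_zero_of_not_dvd hp this
  rw [map_mul] at hg
  exact ⟨u, hu, left_ne_zero_of_mul hg, right_ne_zero_of_mul hg⟩

variable {ι : Type*}

/-- The coordinates of a configuration of vectors. -/
def coords (u : ι → Fin 4 → k) : ι × Fin 4 → k := fun q => u q.1 q.2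

/-- Fix all vectors of a configuration but one. -/
noncomputable def specialize [DecidableEq ι] (u : ι → Fin 4 → k) (p : ι) :
    MvPolynomial (ι × Fin 4) k →ₐ[k] MvPolynomial (Fin 4) k :=
  aeval fun q => if q.1 = p then X q.2 else C (u q.1 q.2)

lemma eval_specialize [DecidableEq ι] (u : ι → Fin 4 → k) (p : ι) (x : Fin 4 → k)
    (g : MvPolynomial (ι × Fin 4) k) :
    eval x (specialize u p g) = eval (coords (Function.update u p x)) g := by
  have : (aeval x).comp (specialize u p) = aeval (coords (Function.update u p x)) := by
    apply algHom_ext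
    rintro ⟨q, i⟩
    by_cases h : q = p
    · subst h; simp [specialize, coords]
    · simp [specialize, coords, h]
  simpa using congrArg (fun φ : _ →ₐ[k] k => φ g) this

/-- Nonempty open subsets of a power of an irreducible hypersurface meet. -/
theorem exists_config_ne_zero [Finite ι] [IsAlgClosed k] (hp : Prime f)
    {g₁ g₂ : MvPolynomial (ι × Fin 4) k} {u₁ u₂ : ι → Fin 4 → k} (hu₁ : ∀ p, eval (u₁ p) f = 0)
    (hu₂ : ∀ p, eval (u₂ p) f = 0) (h₁ : eval (coords u₁) g₁ ≠ 0)
    (h₂ : eval (coords u₂) g₂ ≠ 0) :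
    ∃ u : ι → Fin 4 → k, (∀ p, eval (u p) f = 0) ∧ eval (coords u) g₁ ≠ 0 ∧
      eval (coords u) g₂ ≠ 0 := by
  classical
  have := Fintype.ofFinite ι
  have key : ∀ s : Finset ι, ∃ u u' : ι → Fin 4 → k, (∀ p, eval (u p) f = 0) ∧
      (∀ p, eval (u' p) f = 0) ∧ eval (coords u) g₁ ≠ 0 ∧ eval (coords u') g₂ ≠ 0 ∧
      ∀ p ∈ s, u p = u' p := by
    intro s
    induction s using Finset.induction_on with
    | empty => exact ⟨u₁, u₂, hu₁, hu₂, h₁, h₂, by simp⟩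
    | insert p s _ ih =>
      obtain ⟨u, u', hu, hu', hg, hg', he⟩ := ih
      obtain ⟨x, hx, hx₁, hx₂⟩ := exists_common_ne_zero hp (hu p) (hu' p)
        (g₁ := specialize u p g₁) (g₂ := specialize u' p g₂)
        (by rwa [eval_specialize, Function.update_eq_self])
        (by rwa [eval_specialize, Function.update_eq_self])
      rw [eval_specialize] at hx₁ hx₂
      refine ⟨_, _, fun q => ?_, fun q => ?_, hx₁, hx₂, fun q hq => ?_⟩
      · by_cases h : q = p
        · subst h; simpa using hx
        · simpa [h] using hu q
      · by_cases h : q = p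
        · subst h; simpa using hx
        · simpa [h] using hu' q
      · by_cases h : q = p
        · subst h; simp
        · simpa [h] using he q ((Finset.mem_insert.1 hq).resolve_left h)
  obtain ⟨u, u', hu, _, h, h', he⟩ := key Finset.univ
  have : u = u' := funext fun p => he p (Finset.mem_univ p)
  subst this
  exact ⟨u, hu, h, h'⟩

variable {z : ι → Fin 4 → k} {a : ℕ}

lemma eval_coords_rename (u : ι → Fin 4 → k) (q : ι) (g : MvPolynomial (Fin 4) k) :
    eval (coords u) (rename (Prod.mk q) g) = eval (u q) g := by
  rw [eval_rename]; rfl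

lemma exists_vecMul_eq {σ n : Type*} [Fintype n] [DecidableEq n]
    {M : Matrix n n (MvPolynomial σ k)} {w : σ → k} (hw : eval w M.det ≠ 0) (t : n → k) :
    ∃ x : n → k, ∀ s, ∑ r, x r * eval w (M r s) = t s := by
  rw [RingHom.map_det] at hw
  refine ⟨Matrix.vecMul t ((eval w).mapMatrix M)⁻¹, fun s => ?_⟩
  have : Matrix.vecMul (Matrix.vecMul t ((eval w).mapMatrix M)⁻¹) ((eval w).mapMatrix M) = t := by
    rw [Matrix.vecMul_vecMul, Matrix.nonsing_inv_mul _ (Ne.isUnit hw), Matrix.vecMul_one]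
  exact congrFun this s

lemma eval_det_eq_one {σ n : Type*} [Fintype n] [DecidableEq n]
    {M : Matrix n n (MvPolynomial σ k)} {w : σ → k}
    (h : ∀ r s, eval w (M r s) = (1 : Matrix n n k) r s) : eval w M.det = 1 := by
  rw [RingHom.map_det, show (eval w).mapMatrix M = 1 from Matrix.ext h, Matrix.det_one]

lemma SurjQ.exists_open [Finite ι] (h : SurjQ a z) : ∃ G : MvPolynomial (ι × Fin 4) k,
    eval (coords z) G ≠ 0 ∧ ∀ u : ι → Fin 4 → k, eval (coords u) G ≠ 0 → SurjQ a u := by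
  classical
  have := Fintype.ofFinite ι
  choose v hv c hc using fun r : ι × Fin 4 =>
    h fun q j => (1 : Matrix (ι × Fin 4) (ι × Fin 4) k) r (q, j)
  let M : Matrix (ι × Fin 4) (ι × Fin 4) (MvPolynomial (ι × Fin 4) k) := fun r s =>
    rename (Prod.mk s.1) (v r s.2) - C (c r s.1) * X s
  have hM : ∀ (u : ι → Fin 4 → k) r q j, eval (coords u) (M r (q, j)) =
      eval (u q) (v r j) - c r q * u q j := fun u r q j => by
    change eval _ (rename (Prod.mk q) (v r j) - C (c r q) * X (q, j)) = _
    rw [map_sub, map_mul, eval_C, eval_X, eval_coords_rename]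
    rfl
  refine ⟨M.det, ?_, fun u hu t => ?_⟩
  · rw [eval_det_eq_one]
    · exact one_ne_zero
    · rintro r ⟨q, j⟩
      rw [hM, hc, add_sub_cancel_right]
  · obtain ⟨x, hx⟩ := exists_vecMul_eq hu fun s => t s.1 s.2
    refine ⟨fun j => ∑ r, C (x r) * v r j,
      fun j => IsHomogeneous.sum _ _ _ fun r _ => (hv r j).C_mul _,
      fun q => ∑ r, x r * c r q, fun q j => ?_⟩
    rw [← hx (q, j), map_sum, Finset.sum_mul, ← Finset.sum_add_distrib]
    exact Finset.sum_congr rfl fun r _ => by rw [map_mul, eval_C, hM]; ring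

/-- Antisymmetric matrices annihilate the square of a vector. -/
lemma sum_antisymm {β : Fin 4 → Fin 4 → k} (h0 : ∀ i, β i i = 0) (h : ∀ i j, β j i = -β i j)
    (y : Fin 4 → k) : ∑ i, (∑ j, y j * β i j) * y i = 0 := by
  simp only [Fin.sum_univ_four, h0, h 0 1, h 0 2, h 0 3, h 1 2, h 1 3, h 2 3]
  ring

lemma SurjO.exists_open [Finite ι] (hz : ∀ p, z p ≠ 0) (h : SurjO a z) :
    ∃ G : MvPolynomial (ι × Fin 4) k, eval (coords z) G ≠ 0 ∧
      ∀ u : ι → Fin 4 → k, eval (coords u) G ≠ 0 → SurjO a u := by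
  classical
  have := Fintype.ofFinite ι
  have hν : ∀ p, ∃ y : Fin 4 → k, ∑ i, z p i * y i = 1 := fun p => by
    simpa only [Fin.sum_univ_four] using exists_dot_eq_one (hz p)
  choose ν hν using hν
  choose b hb0 hba hbh hb using fun r : ι × Fin 4 =>
    h (fun q j => (1 : Matrix (ι × Fin 4) (ι × Fin 4) k) r (q, j) -
      if r.1 = q then z q r.2 * ν q j else 0) (by
      rintro q
      simp only [sub_mul, Finset.sum_sub_distrib]
      by_cases hq : r.1 = q
      · obtain ⟨p, i⟩ := r
        subst hq
        simp only [if_true, Matrix.one_apply, Prod.mk.injEq, true_and, ite_mul, one_mul, zero_mul,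
          Finset.sum_ite_eq, Finset.mem_univ]
        have h1 : ∑ j, z p i * ν p j * z p j = z p i * ∑ j, z p j * ν p j := by
          rw [Finset.mul_sum]
          exact Finset.sum_congr rfl fun j _ => by ring
        rw [h1, hν p, mul_one, sub_self]
      · simp only [hq, if_false, zero_mul, Finset.sum_const_zero, sub_zero]
        exact Finset.sum_eq_zero fun j _ => by
          rw [Matrix.one_apply_ne fun e => hq (by rw [e]), zero_mul])
  let M : Matrix (ι × Fin 4) (ι × Fin 4) (MvPolynomial (ι × Fin 4) k) := fun r s =>
    (∑ l, X (s.1, l) * rename (Prod.mk s.1) (b r s.2 l)) +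
      if r.1 = s.1 then C (z s.1 r.2 * ν s.1 s.2) else 0
  have hM : ∀ (u : ι → Fin 4 → k) r q j, eval (coords u) (M r (q, j)) =
      (∑ l, u q l * eval (u q) (b r j l)) + if r.1 = q then z q r.2 * ν q j else 0 :=
      fun u r q j => by
    change eval _ ((∑ l, X (q, l) * rename (Prod.mk q) (b r j l)) +
      if r.1 = q then C (z q r.2 * ν q j) else 0) = _
    rw [map_add, map_sum]
    congr 1
    · exact Finset.sum_congr rfl fun l _ => by
        rw [map_mul, eval_X, eval_coords_rename]; rfl
    · split_ifs
      · rw [eval_C]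
      · rw [map_zero]
  refine ⟨M.det * ∏ p, ∑ i, C (ν p i) * X (p, i), ?_, fun u hu t ht => ?_⟩
  · rw [map_mul, eval_det_eq_one, one_mul, map_prod]
    · refine Finset.prod_ne_zero_iff.2 fun p _ => ?_
      simp only [map_sum, map_mul, eval_C, eval_X, coords]
      simp only [mul_comm, hν p]
      exact one_ne_zero
    · rintro r ⟨q, j⟩
      rw [hM, hb, sub_add_cancel]
  · rw [map_mul, map_prod] at hu
    have hu' : ∀ p, ∑ i, ν p i * u p i ≠ 0 := fun p => by
      have := Finset.prod_ne_zero_iff.1 (right_ne_zero_of_mul hu) p (Finset.mem_univ p)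
      simpa only [map_sum, map_mul, eval_C, eval_X, coords] using this
    obtain ⟨x, hx⟩ := exists_vecMul_eq (left_ne_zero_of_mul hu) fun s => t s.1 s.2
    have hx' : ∀ q j, (∑ l, u q l * eval (u q) (∑ r, C (x r) * b r j l)) +
        (∑ r, x r * if r.1 = q then z q r.2 else 0) * ν q j = t q j := fun q j => by
      rw [← hx (q, j)]
      simp only [hM, mul_add, Finset.sum_add_distrib, map_sum, map_mul, eval_C, Finset.mul_sum,
        Finset.sum_mul]
      congr 1
      · rw [Finset.sum_comm]
        exact Finset.sum_congr rfl fun r _ => Finset.sum_congr rfl fun l _ => by ring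
      · exact Finset.sum_congr rfl fun r _ => by split_ifs <;> ring
    have hB0 : ∀ i, ∑ r, C (x r) * b r i i = 0 := fun i =>
      Finset.sum_eq_zero fun r _ => by rw [hb0, mul_zero]
    have hBa : ∀ i j, ∑ r, C (x r) * b r j i = -∑ r, C (x r) * b r i j := fun i j => by
      rw [← Finset.sum_neg_distrib]
      exact Finset.sum_congr rfl fun r _ => by rw [hba, mul_neg]
    have hs : ∀ q, (∑ r, x r * if r.1 = q then z q r.2 else 0) = 0 := fun q => by
      have h1 := sum_antisymm (β := fun i j => eval (u q) (∑ r, C (x r) * b r i j))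
        (fun i => by rw [hB0, map_zero]) (fun i j => by rw [hBa, map_neg]) (u q)
      have h2 := ht q
      simp only [← hx', add_mul, Finset.sum_add_distrib] at h2
      rw [h1, zero_add] at h2
      simp only [mul_assoc] at h2
      rw [← Finset.mul_sum] at h2
      exact (mul_eq_zero.1 h2).resolve_right (hu' q)
    refine ⟨fun i j => ∑ r, C (x r) * b r i j, hB0, hBa,
      fun i j => IsHomogeneous.sum _ _ _ fun r _ => (hbh r i j).C_mul _, fun q j => ?_⟩
    rw [← hx', hs, zero_mul, add_zero]

end Density

section Transfer

variable {k : Type*} [Field k] {ι : Type*} {z : ι → Fin 4 → k} {a : ℕ}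

/-- Linear substitution. -/
noncomputable def linSubst (N : Matrix (Fin 4) (Fin 4) k) :
    MvPolynomial (Fin 4) k →ₐ[k] MvPolynomial (Fin 4) k :=
  aeval fun i => ∑ j, C (N i j) * X j

lemma eval_linSubst (N : Matrix (Fin 4) (Fin 4) k) (y : Fin 4 → k) (g : MvPolynomial (Fin 4) k) :
    eval y (linSubst N g) = eval (N.mulVec y) g := by
  have : (aeval y).comp (linSubst N) = aeval (N.mulVec y) := by
    apply algHom_ext
    intro i
    simp [linSubst, Matrix.mulVec, dotProduct]
  simpa using congrArg (fun φ : _ →ₐ[k] k => φ g) this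

lemma linSubst_isHomogeneous (N : Matrix (Fin 4) (Fin 4) k) {d : ℕ} {g : MvPolynomial (Fin 4) k}
    (hg : g.IsHomogeneous d) : (linSubst N g).IsHomogeneous d := by
  have := hg.aeval (fun i => ∑ j, C (N i j) * (X j : MvPolynomial (Fin 4) k)) (n := 1)
    fun i => IsHomogeneous.sum _ _ _ fun j _ => (isHomogeneous_X _ _).C_mul _
  rwa [one_mul] at this

lemma linSubst_linSubst {N M : Matrix (Fin 4) (Fin 4) k} (h : N * M = 1) [Infinite k]
    (g : MvPolynomial (Fin 4) k) : linSubst M (linSubst N g) = g :=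
  MvPolynomial.funext fun y => by
    rw [eval_linSubst, eval_linSubst, Matrix.mulVec_mulVec, h, Matrix.one_mulVec]

lemma SurjQ.map {M N : Matrix (Fin 4) (Fin 4) k} (hMN : M * N = 1) (h : SurjQ a z) :
    SurjQ a fun p => M.mulVec (z p) := by
  have hNM : N * M = 1 := mul_eq_one_comm.1 hMN
  intro t
  obtain ⟨v, hv, c, hc⟩ := h fun p => N.mulVec (t p)
  refine ⟨fun i => ∑ j, C (M i j) * linSubst N (v j), fun i => IsHomogeneous.sum _ _ _ fun j _ =>
    (linSubst_isHomogeneous _ (hv j)).C_mul _, c, fun p i => ?_⟩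
  have h1 : (fun j => eval (z p) (v j)) = N.mulVec (t p) + c p • z p := funext fun j => hc p j
  have h2 := congrArg M.mulVec h1
  rw [Matrix.mulVec_add, Matrix.mulVec_mulVec, hMN, Matrix.one_mulVec, Matrix.mulVec_smul] at h2
  simp only [map_sum, map_mul, eval_C, eval_linSubst, Matrix.mulVec_mulVec, hNM,
    Matrix.one_mulVec]
  exact congrFun h2 i

lemma SurjO.map {M N : Matrix (Fin 4) (Fin 4) k} (hMN : M * N = 1) (h : SurjO a z) :
    SurjO a fun p => M.mulVec (z p) := by
  have hNM : N * M = 1 := mul_eq_one_comm.1 hMN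
  intro t ht
  obtain ⟨b, hb0, hba, hbh, hb⟩ := h (fun p => Matrix.vecMul (t p) M) fun p => by
    have := ht p
    change t p ⬝ᵥ M.mulVec (z p) = 0 at this
    rw [Matrix.dotProduct_mulVec] at this
    exact this
  refine ⟨fun i l => ∑ m, ∑ j, C (N m i * N j l) * linSubst N (b m j), fun i => ?_, fun i l => ?_,
    fun i l => IsHomogeneous.sum _ _ _ fun m _ => IsHomogeneous.sum _ _ _ fun j _ =>
      (linSubst_isHomogeneous _ (hbh m j)).C_mul _, fun p i => ?_⟩
  · simp only [Fin.sum_univ_four, hb0, hba 0 1, hba 0 2, hba 0 3, hba 1 2, hba 1 3, hba 2 3,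
      map_neg, map_zero, map_mul]
    ring
  · change ∑ m, ∑ j, C (N m l * N j i) * linSubst N (b m j) =
      -∑ m, ∑ j, C (N m i * N j l) * linSubst N (b m j)
    rw [Finset.sum_comm, ← Finset.sum_neg_distrib]
    refine Finset.sum_congr rfl fun m _ => ?_
    rw [← Finset.sum_neg_distrib]
    refine Finset.sum_congr rfl fun j _ => ?_
    rw [hba m j, map_neg, mul_neg, mul_comm (N j l)]
  · have h1 : Matrix.vecMul (Matrix.vecMul (t p) M) N = t p := by
      rw [Matrix.vecMul_vecMul, hMN, Matrix.vecMul_one]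
    have h2 : ∀ j, z p j = ∑ l, N j l * M.mulVec (z p) l := fun j => by
      have : N.mulVec (M.mulVec (z p)) = z p := by
        rw [Matrix.mulVec_mulVec, hNM, Matrix.one_mulVec]
      exact (congrFun this j).symm
    rw [← congrFun h1 i]
    simp only [map_sum, map_mul, eval_C, eval_linSubst, Matrix.mulVec_mulVec, hNM,
      Matrix.one_mulVec]
    change _ = ∑ m, Matrix.vecMul (t p) M m * N m i
    simp only [← hb]
    simp only [Finset.mul_sum, Finset.sum_mul]
    rw [Finset.sum_comm]
    refine Finset.sum_congr rfl fun m _ => ?_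
    rw [Finset.sum_comm]
    refine Finset.sum_congr rfl fun j _ => ?_
    conv_rhs => rw [h2 j]
    simp only [Finset.sum_mul]
    exact Finset.sum_congr rfl fun l _ => by ring

end Transfer

section Lines

variable {k : Type*} [Field k]

/-- The univariate polynomial `F` is nonzero and has three distinct roots. -/
def ThreeRoots (F : Polynomial k) : Prop :=
  F ≠ 0 ∧ ∃ t : Fin 3 → k, Function.Injective t ∧ ∀ j, F.eval (t j) = 0

/-- The discriminant of a cubic, times the leading coefficient. -/
def cubicDisc {A : Type*} [CommRing A] (F : Polynomial A) : A :=
  F.coeff 3 * Cubic.discr ⟨F.coeff 3, F.coeff 2, F.coeff 1, F.coeff 0⟩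

lemma toPoly_coeff {F : Polynomial k} (h : F.natDegree ≤ 3) :
    Cubic.toPoly ⟨F.coeff 3, F.coeff 2, F.coeff 1, F.coeff 0⟩ = F := by
  conv_rhs => rw [F.as_sum_range_C_mul_X_pow' (Nat.lt_succ_of_le h)]
  simp only [Cubic.toPoly, Finset.sum_range_succ, Finset.sum_range_zero, pow_zero, pow_one]
  ring

lemma cubicDisc_ne_zero_iff [IsAlgClosed k] {F : Polynomial k} (h : F.natDegree ≤ 3) :
    cubicDisc F ≠ 0 ↔ ThreeRoots F := by
  classical
  set P : Cubic k := ⟨F.coeff 3, F.coeff 2, F.coeff 1, F.coeff 0⟩ with hP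
  have hF : P.toPoly = F := toPoly_coeff h
  have hs : (P.toPoly.map (RingHom.id k)).Splits := IsAlgClosed.splits _
  have hr : (Cubic.map (RingHom.id k) P).roots = F.roots := by
    rw [Cubic.map_roots, hF, Polynomial.map_id]
  constructor
  · intro hd
    have ha : P.a ≠ 0 := left_ne_zero_of_mul hd
    obtain ⟨x, y, w, hxyz⟩ := (Cubic.splits_iff_roots_eq_three ha).1 hs
    obtain ⟨h1, h2, h3⟩ := (Cubic.discr_ne_zero_iff_roots_ne ha hxyz).1 (right_ne_zero_of_mul hd)
    have hF0 : F ≠ 0 := by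
      rintro rfl
      exact ha (Polynomial.coeff_zero 3)
    rw [hr] at hxyz
    have hroot : ∀ s ∈ ({x, y, w} : Multiset k), F.eval s = 0 := fun s hs => by
      rw [← hxyz] at hs
      exact (Polynomial.mem_roots hF0).1 hs
    refine ⟨hF0, ![x, y, w], ?_, fun j => ?_⟩
    · intro i j
      fin_cases i <;> fin_cases j <;> simp [h1, h2, h3, h1.symm, h2.symm, h3.symm]
    · fin_cases j <;> exact hroot _ (by simp)
  · rintro ⟨hF0, t, ht, h0⟩
    have hle : Finset.univ.val.map t ≤ F.roots := by
      rw [Multiset.le_iff_subset ((Multiset.nodup_map_iff_of_injective ht).2 Finset.univ.nodup)]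
      intro s hs
      obtain ⟨j, -, rfl⟩ := Multiset.mem_map.1 hs
      exact (Polynomial.mem_roots hF0).2 (h0 j)
    have hc : F.roots.card ≤ 3 := (Polynomial.card_roots' F).trans h
    have heq : Finset.univ.val.map t = F.roots :=
      Multiset.eq_of_le_of_card_le hle (by simpa using hc)
    have hdeg : F.natDegree = 3 := by
      refine le_antisymm h ?_
      calc 3 = F.roots.card := by rw [← heq]; simp
        _ ≤ _ := Polynomial.card_roots' F
    have ha : P.a ≠ 0 := by
      change F.coeff 3 ≠ 0
      rw [← hdeg]
      exact Polynomial.leadingCoeff_ne_zero.2 hF0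
    refine mul_ne_zero ha ?_
    rw [Cubic.discr_ne_zero_iff_roots_nodup ha hs, hr, ← heq]
    exact (Multiset.nodup_map_iff_of_injective ht).2 Finset.univ.nodup

variable {σ A : Type*} [CommRing A] [Algebra k A]

/-- The restriction of a polynomial to the line `u + t v`. -/
noncomputable def lineMap (u v : σ → A) : MvPolynomial σ k →ₐ[k] Polynomial A :=
  aeval fun i => Polynomial.C (u i) + Polynomial.X * Polynomial.C (v i)

lemma natDegree_lineMap_le (u v : σ → k) (g : MvPolynomial σ k) :
    (lineMap u v g).natDegree ≤ g.totalDegree := by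
  have := aeval_natDegree_le g le_rfl
    (fun i => Polynomial.C (u i) + Polynomial.X * Polynomial.C (v i)) (n := 1) (fun i => by
      compute_degree)
  rwa [mul_one] at this

lemma eval_lineMap (u v : σ → k) (g : MvPolynomial σ k) (t : k) :
    (lineMap u v g).eval t = eval (u + t • v) g := by
  have : (Polynomial.aeval t).comp (lineMap u v) = aeval (R := k) (u + t • v) := by
    apply algHom_ext
    intro i
    simp only [lineMap, AlgHom.comp_apply, aeval_X, map_add, map_mul, Polynomial.aeval_C,
      Polynomial.aeval_X, Pi.add_apply, Pi.smul_apply, smul_eq_mul]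
    rfl
  simpa using congrArg (fun φ : _ →ₐ[k] k => φ g) this

lemma map_lineMap {B : Type*} [CommRing B] [Algebra k B] (φ : A →ₐ[k] B) (u v : σ → A)
    (g : MvPolynomial σ k) :
    (lineMap u v g).map φ.toRingHom = lineMap (φ ∘ u) (φ ∘ v) g := by
  have : (Polynomial.mapAlgHom φ).comp (lineMap u v) = lineMap (φ ∘ u) (φ ∘ v) := by
    apply algHom_ext
    intro i
    simp [lineMap]
  exact congrArg (fun ψ : _ →ₐ[k] _ => ψ g) this

/-- Meeting a cubic in three distinct points is an open condition on a family of lines. -/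
lemma exists_disc [IsAlgClosed k] {τ : Type*} {f : MvPolynomial σ k} (hf : f.totalDegree ≤ 3)
    (U V : σ → MvPolynomial τ k) : ∃ Δ : MvPolynomial τ k, ∀ y, eval y Δ ≠ 0 ↔
      ThreeRoots (lineMap (fun i => eval y (U i)) (fun i => eval y (V i)) f) := by
  refine ⟨cubicDisc (lineMap U V f), fun y => ?_⟩
  rw [← cubicDisc_ne_zero_iff ((natDegree_lineMap_le _ _ _).trans hf)]
  have h := map_lineMap (aeval y : MvPolynomial τ k →ₐ[k] k) U V f
  have hU : ∀ W : σ → MvPolynomial τ k, (aeval y : MvPolynomial τ k →ₐ[k] k) ∘ W =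
      fun i => eval y (W i) := fun W => by
    funext i
    simp
  rw [hU, hU] at h
  rw [← h]
  have hφ : ∀ g, eval y g = (aeval y : MvPolynomial τ k →ₐ[k] k) g := fun g => by
    simp
  rw [hφ, Ne, Ne, not_iff_not]
  simp only [cubicDisc, Cubic.discr, Polynomial.coeff_map, map_mul, map_sub, map_add, map_pow,
    map_ofNat, AlgHom.toRingHom_eq_coe, RingHom.coe_coe]

lemma coeff_zero_lineMap (u v : σ → k) (g : MvPolynomial σ k) :
    (lineMap u v g).coeff 0 = eval u g := by
  rw [Polynomial.coeff_zero_eq_eval_zero, eval_lineMap, zero_smul, add_zero]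

lemma coeff_one_lineMap [Fintype σ] (u v : σ → k) (g : MvPolynomial σ k) :
    (lineMap u v g).coeff 1 = ∑ i, v i * eval u (pderiv i g) := by
  classical
  induction g using MvPolynomial.induction_on with
  | C c => simp [lineMap]
  | add p q hp hq => simp only [map_add, Polynomial.coeff_add, hp, hq, mul_add,
      Finset.sum_add_distrib]
  | mul_X p j hp =>
    have h1 : lineMap u v (p * X j) =
        lineMap u v p * Polynomial.C (u j) + lineMap u v p * Polynomial.C (v j) * Polynomial.X := by
      rw [map_mul]
      simp only [lineMap, aeval_X]
      ring
    rw [h1, Polynomial.coeff_add, Polynomial.coeff_mul_C, Polynomial.coeff_mul_X,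
      Polynomial.coeff_mul_C, coeff_zero_lineMap, hp]
    simp only [Derivation.leibniz, map_add, smul_eq_mul, map_mul, eval_X, mul_add,
      Finset.sum_add_distrib, pderiv_X, Pi.single_apply]
    rw [add_comm]
    congr 1
    · rw [Finset.sum_eq_single j]
      · simp [mul_comm]
      · intro b _ hb
        simp [hb.symm]
      · simp
    · rw [Finset.sum_mul]
      exact Finset.sum_congr rfl fun i _ => by ring

lemma eval_smul_of_isHomogeneous [Fintype σ] {d : ℕ} {g : MvPolynomial σ k} (hg : g.IsHomogeneous d)
    (c : k) (y : σ → k) : eval (c • y) g = c ^ d * eval y g := by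
  rw [eval_eq', eval_eq', Finset.mul_sum]
  refine Finset.sum_congr rfl fun m hm => ?_
  have hm' : ∑ i, m i = d := by
    rw [← Finsupp.degree_eq_sum]
    rw [Finsupp.degree_eq_weight_one]
    exact hg (mem_support_iff.1 hm)
  simp only [Pi.smul_apply, smul_eq_mul, mul_pow, Finset.prod_mul_distrib]
  rw [Finset.prod_pow_eq_pow_sum, hm']
  ring

/-- A cubic form with two roots on a line has the expected middle terms. -/
lemma eval_lineMap_of_eval_eq_zero [Infinite k] [Fintype σ] {f : MvPolynomial σ k}
    (hf : f.IsHomogeneous 3) {u v : σ → k} (hu : eval u f = 0) (hv : eval v f = 0) (t : k) :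
    eval (u + t • v) f =
      t * ((∑ i, v i * eval u (pderiv i f)) + t * ∑ i, u i * eval v (pderiv i f)) := by
  have hd : ∀ u v : σ → k, (lineMap u v f).natDegree ≤ 3 := fun u v =>
    (natDegree_lineMap_le u v f).trans hf.totalDegree_le
  have hs : ∀ (u v : σ → k) (t : k), eval (u + t • v) f = (lineMap u v f).coeff 0 +
      (lineMap u v f).coeff 1 * t + (lineMap u v f).coeff 2 * t ^ 2 +
      (lineMap u v f).coeff 3 * t ^ 3 := fun u v t => by
    rw [← eval_lineMap]
    conv_lhs => rw [Polynomial.eval_eq_sum_range' (Nat.lt_succ_of_le (hd u v))]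
    simp only [Finset.sum_range_succ, Finset.sum_range_zero, pow_zero, pow_one]
    ring
  have e : Polynomial.X * lineMap u v f = Polynomial.X *
      (Polynomial.C ((lineMap v u f).coeff 0) * Polynomial.X ^ 3 +
        Polynomial.C ((lineMap v u f).coeff 1) * Polynomial.X ^ 2 +
        Polynomial.C ((lineMap v u f).coeff 2) * Polynomial.X +
        Polynomial.C ((lineMap v u f).coeff 3)) := by
    refine Polynomial.funext fun t => ?_
    by_cases h : t = 0
    · simp [h]
    · have h1 : u + t • v = t • (v + t⁻¹ • u) := by
        rw [smul_add, smul_smul, mul_inv_cancel₀ h, one_smul, add_comm]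
      rw [Polynomial.eval_mul, eval_lineMap, h1, eval_smul_of_isHomogeneous hf, hs]
      simp only [Polynomial.eval_mul, Polynomial.eval_add, Polynomial.eval_C, Polynomial.eval_X,
        Polynomial.eval_pow]
      field_simp
  have e' := mul_left_cancel₀ Polynomial.X_ne_zero e
  have h3 : (lineMap u v f).coeff 3 = 0 := by
    rw [e', ← hv, ← coeff_zero_lineMap v u]
    simp
  have h2 : (lineMap u v f).coeff 2 = ∑ i, u i * eval v (pderiv i f) := by
    rw [e', ← coeff_one_lineMap]
    simp
  rw [hs, h3, h2, coeff_one_lineMap, coeff_zero_lineMap, hu]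
  ring

end Lines

section GoodCoordinates

variable {k : Type*} [Field k] {f : MvPolynomial (Fin 4) k}

lemma not_dvd_of_isHomogeneous_one (hf : f.IsHomogeneous 3) {g : MvPolynomial (Fin 4) k}
    (hg : g.IsHomogeneous 1) (h0 : g ≠ 0) : ¬ f ∣ g := by
  intro h
  obtain ⟨q, hq, e⟩ := exists_grad_of_dvd hf hg h
  rw [grad_of_lt (by omega), Submodule.mem_bot] at hq
  rw [hq, mul_zero] at e
  exact h0 e

/-- Two points of a smooth cubic surface whose connecting line meets it transversally at both. -/
lemma exists_transversal [IsAlgClosed k] (hf : f.IsHomogeneous 3) (hp : Prime f)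
    (hs : ∀ v ≠ 0, eval v f = 0 → ∃ i, eval v (pderiv i f) ≠ 0) :
    ∃ u v : Fin 4 → k, eval u f = 0 ∧ eval v f = 0 ∧ ∑ i, v i * eval u (pderiv i f) ≠ 0 ∧
      ∑ i, u i * eval v (pderiv i f) ≠ 0 := by
  obtain ⟨u, hu, hu0⟩ := exists_eval_ne_zero_of_not_dvd hp (not_dvd_X hf 0)
  obtain ⟨i, hi⟩ := hs u (fun h => hu0 (by simp [h])) hu
  have hl : ∀ y, eval y (∑ j, C (eval u (pderiv j f)) * X j) =
      ∑ j, y j * eval u (pderiv j f) := fun y => by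
    simp [mul_comm]
  obtain ⟨v, hv, hv0⟩ := exists_eval_ne_zero_of_not_dvd hp (not_dvd_of_isHomogeneous_one hf
    (g := ∑ j, C (eval u (pderiv j f)) * X j)
    (IsHomogeneous.sum _ _ _ fun j _ => (isHomogeneous_X _ _).C_mul _) (fun h => hi (by
      have := hl (Pi.single i 1)
      rw [h, map_zero] at this
      simpa [Pi.single_apply] using this.symm)))
  rw [hl] at hv0
  let g : Bool → MvPolynomial (Bool × Fin 4) k := fun b =>
    ∑ j, X (b, j) * rename (Prod.mk !b) (pderiv j f)
  have hg : ∀ b (w : Bool → Fin 4 → k), eval (coords w) (g b) =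
      ∑ j, w b j * eval (w !b) (pderiv j f) := fun b w => by
    simp only [g, map_sum, map_mul, eval_X, eval_coords_rename]
    rfl
  obtain ⟨w, hw, h1, h2⟩ := exists_config_ne_zero hp (g₁ := g true) (g₂ := g false)
    (u₁ := fun b => if b then v else u) (u₂ := fun b => if b then u else v)
    (by rintro (_ | _) <;> simp [hu, hv]) (by rintro (_ | _) <;> simp [hu, hv])
    (by rw [hg]; simpa using hv0) (by rw [hg]; simpa using hv0)
  rw [hg] at h1 h2
  exact ⟨w false, w true, hw _, hw _, h1, h2⟩

lemma lineMap_linSubst [Infinite k] (M : Matrix (Fin 4) (Fin 4) k) (u v : Fin 4 → k) :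
    lineMap u v (linSubst M f) = lineMap (M.mulVec u) (M.mulVec v) f := by
  refine Polynomial.funext fun t => ?_
  rw [eval_lineMap, eval_lineMap, eval_linSubst, Matrix.mulVec_add, Matrix.mulVec_smul]

lemma exists_invertible {u v : Fin 4 → k} (h : LinearIndependent k ![u, v]) :
    ∃ M N : Matrix (Fin 4) (Fin 4) k, M * N = 1 ∧ N * M = 1 ∧ M.mulVec (Pi.single 0 1) = u ∧
      M.mulVec (Pi.single 1 1) = v := by
  obtain ⟨w, hw⟩ := exists_linearIndependent_snoc_of_lt_finrank h (by simp)
  obtain ⟨x, hx⟩ := exists_linearIndependent_snoc_of_lt_finrank hw (by simp)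
  set E : Fin 4 → Fin 4 → k := Fin.snoc (Fin.snoc ![u, v] w) x with hE
  let M : Matrix (Fin 4) (Fin 4) k := Matrix.of fun i j => E j i
  have hu : IsUnit M := by
    rw [← Matrix.linearIndependent_cols_iff_isUnit]
    exact hx
  obtain ⟨⟨M', N, h1, h2⟩, rfl : M' = M⟩ := hu
  refine ⟨M, N, h1, h2, ?_, ?_⟩
  · rw [Matrix.mulVec_single_one]
    rfl
  · rw [Matrix.mulVec_single_one]
    rfl

/-- Coordinates in which the plane `x₃ = 0` cuts the surface in a reduced cubic. -/
theorem exists_good_coords [IsAlgClosed k] (hf : f.IsHomogeneous 3) (hp : Prime f)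
    (hs : ∀ v ≠ 0, eval v f = 0 → ∃ i, eval v (pderiv i f) ≠ 0) :
    ∃ M N : Matrix (Fin 4) (Fin 4) k, M * N = 1 ∧ N * M = 1 ∧
      ThreeRoots (lineMap (Pi.single 1 1 : Fin 4 → k) (Pi.single 0 1) (linSubst M f)) := by
  obtain ⟨u, v, hu, hv, hA, hB⟩ := exists_transversal hf hp hs
  have hφ := eval_lineMap_of_eval_eq_zero hf hu hv
  set A := ∑ i, v i * eval u (pderiv i f)
  set B := ∑ i, u i * eval v (pderiv i f)
  classical
  obtain ⟨κ, hκ⟩ : ∃ κ : k, κ ≠ 0 ∧ A + κ * B ≠ 0 := by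
    obtain ⟨κ, hκ⟩ := Infinite.exists_notMem_finset ({0, -A / B} : Finset k)
    simp only [Finset.mem_insert, Finset.mem_singleton, not_or] at hκ
    refine ⟨κ, hκ.1, fun h => hκ.2 ?_⟩
    field_simp
    linear_combination h
  have hli : LinearIndependent k ![u + κ • v, u] := by
    rw [LinearIndependent.pair_iff]
    intro s t hst
    have hs0 : s = 0 := by
      by_contra hs0
      have : u + κ • v = (-t / s) • u := by
        have : s • (u + κ • v) = -t • u := by
          rw [neg_smul]
          exact eq_neg_of_add_eq_zero_left hst
        rw [div_eq_inv_mul, mul_smul, ← this, smul_smul, inv_mul_cancel₀ hs0, one_smul]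
      have h2 := hφ κ
      rw [this, eval_smul_of_isHomogeneous hf, hu, mul_zero] at h2
      exact mul_ne_zero hκ.1 hκ.2 h2.symm
    have hu0 : u ≠ 0 := by
      rintro rfl
      exact hB (by simp [B])
    rw [hs0, zero_smul, zero_add] at hst
    exact ⟨hs0, (smul_eq_zero.1 hst).resolve_right hu0⟩
  obtain ⟨M, N, h1, h2, h3, h4⟩ := exists_invertible hli
  refine ⟨M, N, h1, h2, ?_⟩
  rw [lineMap_linSubst, h3, h4]
  have hC : A + κ * B ≠ 0 := hκ.2
  refine ⟨fun h => ?_, ![-1, 0, -A / (A + κ * B)], ?_, fun j => ?_⟩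
  · obtain ⟨t, ht⟩ := Infinite.exists_notMem_finset ({-1, 0, -A / (A + κ * B)} : Finset k)
    simp only [Finset.mem_insert, Finset.mem_singleton, not_or] at ht
    obtain ⟨ht1, ht0, ht2⟩ := ht
    have ht1' : 1 + t ≠ 0 := fun h => ht1 (by linear_combination h)
    have h5 := eval_lineMap u (u + κ • v) f t
    have : u + t • (u + κ • v) = (1 + t) • (u + (t * κ / (1 + t)) • v) := by
      ext i
      simp only [Pi.add_apply, Pi.smul_apply, smul_eq_mul]
      field_simp
      ring
    rw [h, Polynomial.eval_zero, this, eval_smul_of_isHomogeneous hf, hφ] at h5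
    have h6 : A + t * κ / (1 + t) * B ≠ 0 := fun h => ht2 (by
      field_simp at h ⊢
      linear_combination h)
    exact mul_ne_zero (pow_ne_zero 3 ht1') (mul_ne_zero (div_ne_zero (mul_ne_zero ht0 hκ.1) ht1')
      h6) h5.symm
  · have e1 : (-1 : k) ≠ -A / (A + κ * B) := fun h => by
      field_simp at h
      exact mul_ne_zero hκ.1 hB (by linear_combination -h)
    have e2 : (0 : k) ≠ -A / (A + κ * B) := (div_ne_zero (neg_ne_zero.2 hA) hC).symm
    intro i j
    fin_cases i <;> fin_cases j <;> simp [e1, e2, e1.symm, e2.symm]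
  · rw [eval_lineMap]
    fin_cases j
    · have : u + (-1 : k) • (u + κ • v) = (-κ) • v := by module
      change eval (u + (-1 : k) • (u + κ • v)) f = 0
      rw [this, eval_smul_of_isHomogeneous hf, hv, mul_zero]
    · change eval (u + (0 : k) • (u + κ • v)) f = 0
      rw [zero_smul, add_zero, hu]
    · change eval (u + (-A / (A + κ * B)) • (u + κ • v)) f = 0
      have : u + (-A / (A + κ * B)) • (u + κ • v) =
          (κ * B / (A + κ * B)) • (u + (-A / B) • v) := by
        ext i
        simp only [Pi.add_apply, Pi.smul_apply, smul_eq_mul]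
        field_simp
        ring
      rw [this, eval_smul_of_isHomogeneous hf, hφ]
      field_simp
      ring

end GoodCoordinates

section Plane

variable {k : Type*} [Field k]

lemma squarefree_of_threeRoots {σ : Type*} {f : MvPolynomial σ k} (hf : f.totalDegree ≤ 3)
    {u v : σ → k} (h : ThreeRoots (lineMap u v f)) : Squarefree f := by
  rintro x ⟨w, hw⟩
  obtain ⟨hF, t, ht, h0⟩ := h
  have hf0 : f ≠ 0 := by
    rintro rfl
    exact hF (map_zero _)
  have hx : x ≠ 0 := by
    rintro rfl
    exact hf0 (by rw [hw, zero_mul, zero_mul])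
  have hw0 : w ≠ 0 := by
    rintro rfl
    exact hf0 (by rw [hw, mul_zero])
  have hd : f.totalDegree = x.totalDegree + x.totalDegree + w.totalDegree := by
    rw [hw, totalDegree_mul_of_isDomain (mul_ne_zero hx hx) hw0, totalDegree_mul_of_isDomain hx hx]
  have hx0 : x.totalDegree = 0 := by
    by_contra hne
    refine hF ?_
    have : lineMap u v (x * w) = 0 := by
      refine Polynomial.eq_zero_of_natDegree_lt_card_of_eval_eq_zero _ ht (fun j => ?_) ?_
      · have := h0 j
        rw [hw, map_mul, map_mul, Polynomial.eval_mul, Polynomial.eval_mul] at this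
        rw [map_mul, Polynomial.eval_mul]
        rcases mul_eq_zero.1 this with h | h
        · rw [mul_self_eq_zero.1 h, zero_mul]
        · rw [h, mul_zero]
      · refine (natDegree_lineMap_le _ _ _).trans_lt ?_
        rw [totalDegree_mul_of_isDomain hx hw0, Fintype.card_fin]
        omega
    rw [hw, mul_assoc, map_mul, this, mul_zero]
  rw [totalDegree_eq_zero_iff_eq_C] at hx0
  rw [hx0]
  refine IsUnit.map C (Ne.isUnit fun h => hx ?_)
  rw [hx0, h, C_0]

/-- The Nullstellensatz for a reduced hypersurface. -/
lemma dvd_of_squarefree {σ : Type*} [Finite σ] [IsAlgClosed k] {f : MvPolynomial σ k}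
    (h0 : f ≠ 0) (hs : Squarefree f) {g : MvPolynomial σ k}
    (h : ∀ v, eval v f = 0 → eval v g = 0) : f ∣ g := by
  have h1 := vanishingIdeal_zeroLocus_eq_radical (k := k) (K := k) (Ideal.span {f})
  have h2 : g ∈ (Ideal.span {f}).radical := by
    rw [← h1, mem_vanishingIdeal_iff]
    intro v hv
    rw [mem_zeroLocus_iff] at hv
    simpa using h v (by simpa using hv f (Ideal.mem_span_singleton_self f))
  obtain ⟨n, hn⟩ := h2
  exact (isRadical_iff_squarefree_of_ne_zero h0).2 hs n g (Ideal.mem_span_singleton.1 hn)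

/-- The linear form with given coefficients. -/
noncomputable def linForm (l : Fin 3 → k) : MvPolynomial (Fin 3) k := ∑ i, C (l i) * X i

lemma linForm_isHomogeneous (l : Fin 3 → k) : (linForm l).IsHomogeneous 1 :=
  IsHomogeneous.sum _ _ _ fun _ _ => (isHomogeneous_X _ _).C_mul _

lemma eval_linForm (l y : Fin 3 → k) : eval y (linForm l) = l 0 * y 0 + l 1 * y 1 + l 2 * y 2 := by
  simp [linForm, Fin.sum_univ_three]

lemma coeff_linForm (l : Fin 3 → k) (i : Fin 3) :
    coeff (Finsupp.single i 1) (linForm l) = l i := by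
  classical
  simp only [linForm, coeff_sum, coeff_C_mul, coeff_X, Finsupp.single_left_inj one_ne_zero]
  simp

lemma linForm_prime {l : Fin 3 → k} (hl : l ≠ 0) : Prime (linForm l) := by
  have h0 : linForm l ≠ 0 := fun h => hl (funext fun i => by
    rw [← coeff_linForm l i, h, coeff_zero, Pi.zero_apply])
  refine (irreducible_of_totalDegree_eq_one ((linForm_isHomogeneous l).totalDegree h0)
    fun x hx => ?_).prime
  obtain ⟨i, hi⟩ := Function.ne_iff.1 hl
  refine isUnit_of_dvd_unit ?_ (Ne.isUnit hi)
  have := hx (Finsupp.single i 1)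
  rwa [coeff_linForm] at this

/-- A prime not dividing `f` is a nonzerodivisor modulo `f`. -/
lemma dvd_of_dvd_prime_mul {A : Type*} [CommRing A] [IsDomain A] {f l g : A} (hl : Prime l)
    (h : ¬ l ∣ f) (hg : f ∣ l * g) : f ∣ g := by
  obtain ⟨q, hq⟩ := hg
  obtain ⟨q', rfl⟩ := (hl.dvd_or_dvd ⟨g, hq.symm⟩).resolve_left h
  refine ⟨q', mul_left_cancel₀ hl.ne_zero ?_⟩
  rw [hq]
  ring

lemma dvd_of_dvd_prod_mul {A ι : Type*} [CommRing A] [IsDomain A] {f g : A} {l : ι → A}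
    (hl : ∀ i, Prime (l i)) (h : ∀ i, ¬ l i ∣ f) (s : Finset ι) (hg : f ∣ (∏ i ∈ s, l i) * g) :
    f ∣ g := by
  classical
  induction s using Finset.induction_on with
  | empty => simpa using hg
  | insert i s hi ih =>
    rw [Finset.prod_insert hi, mul_assoc] at hg
    exact ih (dvd_of_dvd_prime_mul (hl i) (h i) hg)

/-- The inclusion of the plane `x₃ = 0`. -/
def pl (y : Fin 3 → k) : Fin 4 → k := ![y 0, y 1, y 2, 0]

lemma pl_castSucc (y : Fin 3 → k) (i : Fin 3) : pl y i.castSucc = y i := by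
  fin_cases i <;> rfl

lemma pl_three (y : Fin 3 → k) : pl y 3 = 0 := rfl

/-- Ternary forms as quaternary forms. -/
noncomputable def lft : MvPolynomial (Fin 3) k →ₐ[k] MvPolynomial (Fin 4) k :=
  rename Fin.castSucc

lemma lft_isHomogeneous {d : ℕ} {g : MvPolynomial (Fin 3) k} (hg : g.IsHomogeneous d) :
    (lft g).IsHomogeneous d := hg.rename_isHomogeneous

lemma eval_pl_lft (y : Fin 3 → k) (g : MvPolynomial (Fin 3) k) :
    eval (pl y) (lft g) = eval y g := by
  rw [lft, eval_rename]
  congr 2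
  funext i
  exact pl_castSucc y i

/-- Restriction to the plane `x₃ = 0`. -/
noncomputable def res : MvPolynomial (Fin 4) k →ₐ[k] MvPolynomial (Fin 3) k :=
  aeval ![X 0, X 1, X 2, 0]

lemma eval_res (y : Fin 3 → k) (g : MvPolynomial (Fin 4) k) :
    eval y (res g) = eval (pl y) g := by
  have : (aeval y).comp res = aeval (R := k) (pl y) := by
    apply algHom_ext
    intro i
    fin_cases i <;> simp [res, pl]
  simpa using congrArg (fun φ : _ →ₐ[k] k => φ g) this

lemma res_isHomogeneous {d : ℕ} {g : MvPolynomial (Fin 4) k} (hg : g.IsHomogeneous d) :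
    (res g).IsHomogeneous d := by
  have := hg.aeval (![X 0, X 1, X 2, 0] : Fin 4 → MvPolynomial (Fin 3) k) (n := 1) fun i => by
    fin_cases i
    · exact isHomogeneous_X _ _
    · exact isHomogeneous_X _ _
    · exact isHomogeneous_X _ _
    · exact isHomogeneous_zero _ _ _
  rwa [one_mul] at this

lemma X_three_dvd_sub (g : MvPolynomial (Fin 4) k) : X 3 ∣ g - lft (res g) := by
  induction g using MvPolynomial.induction_on with
  | C c => simp [res, lft]
  | add p q hp hq =>
    rw [map_add, map_add, add_sub_add_comm]
    exact dvd_add hp hq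
  | mul_X p i hp =>
    have h : X 3 ∣ (X i : MvPolynomial (Fin 4) k) - lft (res (X i)) := by
      fin_cases i <;> simp [res, lft]
    rw [map_mul, map_mul, show p * X i - lft (res p) * lft (res (X i)) =
      (p - lft (res p)) * X i + lft (res p) * (X i - lft (res (X i))) by ring]
    exact dvd_add (hp.mul_right _) (h.mul_left _)

lemma exists_eq_lft_add {d : ℕ} {g : MvPolynomial (Fin 4) k} (hg : g.IsHomogeneous (d + 1)) :
    ∃ g' : MvPolynomial (Fin 4) k, g'.IsHomogeneous d ∧ g = lft (res g) + X 3 * g' := by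
  obtain ⟨q, hq, e⟩ := exists_grad_of_dvd (isHomogeneous_X k (3 : Fin 4))
    (hg.sub (lft_isHomogeneous (res_isHomogeneous hg))) (X_three_dvd_sub g)
  refine ⟨q, ?_, by rw [← e]; ring⟩
  rw [grad, if_pos (by omega)] at hq
  exact hq

end Plane

section LineArrangement

variable {k : Type*} [Field k]

/-- Lines in the plane, each meeting the cubic `f` in three distinct points off the others. -/
structure LineArrangement (f : MvPolynomial (Fin 3) k) (a : ℕ) where
  /-- the lines -/
  line : Fin a → Fin 3 → k
  /-- the points of intersection with the cubic -/
  pt : Fin a × Fin 3 → Fin 3 → k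
  root : ∀ q, eval (pt q) f = 0
  on_line : ∀ q, eval (pt q) (linForm (line q.1)) = 0
  off_line : ∀ q i, i ≠ q.1 → eval (pt q) (linForm (line i)) ≠ 0
  sep : ∀ i j j', j ≠ j' →
    ∃ m, eval (pt (i, j')) (linForm m) = 0 ∧ eval (pt (i, j)) (linForm m) ≠ 0
  line_ne_zero : ∀ i, line i ≠ 0
  not_dvd : ∀ i, ¬ linForm (line i) ∣ f

namespace LineArrangement

variable {f : MvPolynomial (Fin 3) k} {a : ℕ} (L : LineArrangement f a)

/-- The product of some of the lines. -/
noncomputable def prod (s : Finset (Fin a)) : MvPolynomial (Fin 3) k :=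
  ∏ i ∈ s, linForm (L.line i)

lemma prod_isHomogeneous (s : Finset (Fin a)) : (L.prod s).IsHomogeneous s.card := by
  have := IsHomogeneous.prod s (fun i => linForm (L.line i)) (fun _ => 1)
    fun i _ => linForm_isHomogeneous _
  rwa [Finset.sum_const, smul_eq_mul, mul_one] at this

lemma eval_prod_eq_zero {s : Finset (Fin a)} {q : Fin a × Fin 3} (h : q.1 ∈ s) :
    eval (L.pt q) (L.prod s) = 0 := by
  rw [prod, map_prod]
  exact Finset.prod_eq_zero h (L.on_line q)

lemma eval_prod_ne_zero {s : Finset (Fin a)} {q : Fin a × Fin 3} (h : q.1 ∉ s) :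
    eval (L.pt q) (L.prod s) ≠ 0 := by
  rw [prod, map_prod, Finset.prod_ne_zero_iff]
  exact fun i hi => L.off_line q i fun e => h (e ▸ hi)

lemma eval_prod_univ (q : Fin a × Fin 3) : eval (L.pt q) (L.prod Finset.univ) = 0 :=
  L.eval_prod_eq_zero (Finset.mem_univ _)

/-- If `f` divides the product of the lines with `g`, it divides `g`. -/
lemma dvd_of_dvd_prod_mul {g : MvPolynomial (Fin 3) k} (h : f ∣ L.prod Finset.univ * g) : f ∣ g :=
  CubicLink.dvd_of_dvd_prod_mul (fun i => linForm_prime (L.line_ne_zero i)) L.not_dvd _ h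

/-- A form of degree one more than the number of other lines singling out a point on a line. -/
lemma exists_linear (i : Fin a) {j j' : Fin 3} (h : j ≠ j') (s : Finset (Fin a)) (hi : i ∉ s) :
    ∃ g : MvPolynomial (Fin 3) k, g.IsHomogeneous (s.card + 1) ∧
      (∀ q : Fin a × Fin 3, q.1 ∈ s → eval (L.pt q) g = 0) ∧ eval (L.pt (i, j')) g = 0 ∧
      eval (L.pt (i, j)) g ≠ 0 := by
  obtain ⟨m, h1, h2⟩ := L.sep i j j' h
  refine ⟨L.prod s * linForm m, (L.prod_isHomogeneous s).mul (linForm_isHomogeneous m),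
    fun q hq => ?_, ?_, ?_⟩
  · rw [map_mul, L.eval_prod_eq_zero hq, zero_mul]
  · rw [map_mul, h1, mul_zero]
  · rw [map_mul]
    exact mul_ne_zero (L.eval_prod_ne_zero (q := (i, j)) hi) h2

lemma exists_quadratic (i : Fin a) (j : Fin 3) (s : Finset (Fin a)) (hi : i ∉ s) :
    ∃ g : MvPolynomial (Fin 3) k, g.IsHomogeneous (s.card + 2) ∧
      (∀ q : Fin a × Fin 3, q.1 ∈ s → eval (L.pt q) g = 0) ∧
      (∀ j', j' ≠ j → eval (L.pt (i, j')) g = 0) ∧ eval (L.pt (i, j)) g ≠ 0 := by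
  obtain ⟨j₁, j₂, h1, h2, h3⟩ : ∃ j₁ j₂ : Fin 3, j ≠ j₁ ∧ j ≠ j₂ ∧
      ∀ j', j' ≠ j → j' = j₁ ∨ j' = j₂ := by decide +revert
  obtain ⟨m, hm1, hm2⟩ := L.sep i j j₁ h1
  obtain ⟨g, hg, hs, hg1, hg2⟩ := L.exists_linear i h2 s hi
  refine ⟨g * linForm m, hg.mul (linForm_isHomogeneous m), fun q hq => ?_, fun j' hj' => ?_, ?_⟩
  · rw [map_mul, hs q hq, zero_mul]
  · rw [map_mul]
    rcases h3 j' hj' with rfl | rfl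
    · rw [hm1, mul_zero]
    · rw [hg1, zero_mul]
  · rw [map_mul]
    exact mul_ne_zero hg2 hm2

lemma eq_top_of_single_mem {ι M : Type*} [Fintype ι] [DecidableEq ι] [AddCommGroup M] [Module k M]
    {W : Submodule k (ι → M)} (h : ∀ q w, Pi.single q w ∈ W) (t : ι → M) : t ∈ W := by
  rw [← Finset.univ_sum_single t]
  exact W.sum_mem fun q _ => h q _

/-- Values, modulo the points, of vectors of forms of degree `d`. -/
def valQ (d : ℕ) : Submodule k (Fin a × Fin 3 → Fin 3 → k) where
  carrier := {t | ∃ v : Fin 3 → MvPolynomial (Fin 3) k, (∀ i, (v i).IsHomogeneous d) ∧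
    ∃ c : Fin a × Fin 3 → k, ∀ q i, eval (L.pt q) (v i) = t q i + c q * L.pt q i}
  add_mem' := by
    rintro t t' ⟨v, hv, c, hc⟩ ⟨v', hv', c', hc'⟩
    refine ⟨fun i => v i + v' i, fun i => (hv i).add (hv' i), fun q => c q + c' q, fun q i => ?_⟩
    rw [map_add, hc, hc', Pi.add_apply, Pi.add_apply]
    ring
  zero_mem' := ⟨fun _ => 0, fun _ => isHomogeneous_zero _ _ _, fun _ => 0, by simp⟩
  smul_mem' := by
    rintro x t ⟨v, hv, c, hc⟩
    refine ⟨fun i => C x * v i, fun i => (hv i).C_mul _, fun q => x * c q, fun q i => ?_⟩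
    rw [map_mul, eval_C, hc, Pi.smul_apply, Pi.smul_apply, smul_eq_mul]
    ring

lemma smul_mem_valQ {d : ℕ} {g : MvPolynomial (Fin 3) k} (hg : g.IsHomogeneous d)
    (w : Fin 3 → k) : (fun q => eval (L.pt q) g • w) ∈ L.valQ d :=
  ⟨fun i => C (w i) * g, fun i => hg.C_mul _, fun _ => 0, fun q i => by
    simp [mul_comm]⟩

lemma pt_mem_valQ (d : ℕ) (c : Fin a × Fin 3 → k) : (fun q => c q • L.pt q) ∈ L.valQ d :=
  ⟨fun _ => 0, fun i => isHomogeneous_zero _ _ _, fun q => -c q, fun q i => by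
    simp⟩

lemma single_mem_valQ_same (i : Fin a) (j j' : Fin 3) :
    Pi.single (i, j) (L.pt (i, j')) ∈ L.valQ a := by
  by_cases h : j = j'
  · subst h
    have := L.pt_mem_valQ a (Pi.single (i, j) 1)
    convert this using 1
    funext q
    by_cases hq : q = (i, j)
    · subst hq; simp
    · simp [hq]
  obtain ⟨j₂, h1, h2, h3⟩ : ∃ j₂ : Fin 3, j ≠ j₂ ∧ j' ≠ j₂ ∧ ∀ x, x = j ∨ x = j' ∨ x = j₂ := by
    revert h; revert j j'; decide
  obtain ⟨g, hg, hs, hg1, hg2⟩ := L.exists_linear i h1 (Finset.univ.erase i) (by simp)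
  rw [Finset.card_erase_of_mem (Finset.mem_univ i), Finset.card_univ, Fintype.card_fin,
    Nat.sub_add_cancel (Nat.one_le_of_lt i.2)] at hg
  have e : Pi.single (i, j) (L.pt (i, j')) = (eval (L.pt (i, j)) g)⁻¹ •
      ((fun q => eval (L.pt q) g • L.pt (i, j')) -
        fun q => Pi.single (M := fun _ => k) (i, j') (eval (L.pt (i, j')) g) q • L.pt q) := by
    funext ⟨i', x⟩
    by_cases hi : i' = i
    · subst hi
      rcases h3 x with rfl | rfl | rfl
      · simp [h, hg2]
      · simp [Ne.symm h]
      · simp [hg1, Ne.symm h1, Ne.symm h2]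
    · simp [hi, hs (i', x) (by simpa using hi)]
  rw [e]
  exact Submodule.smul_mem _ _ (sub_mem (L.smul_mem_valQ hg _) (L.pt_mem_valQ _ _))

lemma single_mem_valQ_other {i i' : Fin a} (hi : i ≠ i') (j : Fin 3) :
    Pi.single (i, j) (L.pt (i', 0)) ∈ L.valQ a := by
  obtain ⟨g, hg, hs, hg1, hg2⟩ := L.exists_quadratic i j ((Finset.univ.erase i).erase i') (by simp)
  have ha : 2 ≤ a := by
    have := i.2
    have := i'.2
    have : (i : ℕ) ≠ i' := fun h => hi (Fin.ext h)
    omega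
  rw [Finset.card_erase_of_mem (by simpa using hi.symm),
    Finset.card_erase_of_mem (Finset.mem_univ i), Finset.card_univ, Fintype.card_fin,
    show a - 1 - 1 + 2 = a by omega] at hg
  have e : Pi.single (i, j) (L.pt (i', 0)) = (eval (L.pt (i, j)) g)⁻¹ •
      ((fun q => eval (L.pt q) g • L.pt (i', 0)) -
        ∑ x, eval (L.pt (i', x)) g •
          (Pi.single (i', x) (L.pt (i', 0)) : Fin a × Fin 3 → Fin 3 → k)) := by
    funext ⟨i₀, x⟩
    rw [Pi.smul_apply, Pi.sub_apply, Finset.sum_apply]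
    by_cases h1 : i₀ = i
    · subst h1
      by_cases h2 : x = j
      · subst h2
        simp [hi, hg2]
      · simp [hi, h2, hg1 x h2]
    · by_cases h2 : i₀ = i'
      · subst h2
        simp only [Pi.smul_apply]
        rw [Finset.sum_eq_single x]
        · simp [h1]
        · intro y _ hy
          simp [Ne.symm hy]
        · simp
      · simp [h1, h2, hs (i₀, x) (by simp [h1, h2])]
  rw [e]
  exact Submodule.smul_mem _ _ (sub_mem (L.smul_mem_valQ hg _)
    (Submodule.sum_mem _ fun x _ => Submodule.smul_mem _ _ (L.single_mem_valQ_same i' x 0)))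

lemma linearIndependent_pt {i i' : Fin a} (hi : i ≠ i') :
    LinearIndependent k ![L.pt (i, 0), L.pt (i, 1), L.pt (i', 0)] := by
  rw [Fintype.linearIndependent_iff]
  intro c hc
  simp only [Fin.sum_univ_three] at hc
  have key : ∀ m, c 0 * eval (L.pt (i, 0)) (linForm m) + c 1 * eval (L.pt (i, 1)) (linForm m) +
      c 2 * eval (L.pt (i', 0)) (linForm m) = 0 := fun m => by
    have h0 := congrFun hc 0
    have h1 := congrFun hc 1
    have h2 := congrFun hc 2
    simp at h0 h1 h2
    simp only [eval_linForm]
    linear_combination m 0 * h0 + m 1 * h1 + m 2 * h2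
  have c2 : c 2 = 0 := by
    have := key (L.line i)
    rw [L.on_line (i, 0), L.on_line (i, 1), mul_zero, mul_zero, zero_add, zero_add] at this
    exact (mul_eq_zero.1 this).resolve_right (L.off_line (i', 0) i hi)
  obtain ⟨m, h1, h2⟩ := L.sep i 0 1 (by decide)
  obtain ⟨m', h1', h2'⟩ := L.sep i 1 0 (by decide)
  have c0 : c 0 = 0 := by
    have := key m
    rw [c2, h1, mul_zero, zero_mul, add_zero, add_zero] at this
    exact (mul_eq_zero.1 this).resolve_right h2
  have c1 : c 1 = 0 := by
    have := key m'
    rw [c2, h1', mul_zero, zero_mul, add_zero, zero_add] at this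
    exact (mul_eq_zero.1 this).resolve_right h2'
  intro x
  fin_cases x <;> assumption

/-- Vectors of forms of degree `a` take arbitrary values modulo the points. -/
theorem mem_valQ (ha : 2 ≤ a) (t : Fin a × Fin 3 → Fin 3 → k) : t ∈ L.valQ a := by
  refine eq_top_of_single_mem (fun q w => ?_) t
  obtain ⟨i, j⟩ := q
  have : Nontrivial (Fin a) := Fin.nontrivial_iff_two_le.2 ha
  obtain ⟨i', hi'⟩ := exists_ne i
  have hs := (L.linearIndependent_pt hi'.symm).span_eq_top_of_card_eq_finrank' (by simp)
  have hw : w ∈ Submodule.span k (Set.range ![L.pt (i, 0), L.pt (i, 1), L.pt (i', 0)]) := by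
    rw [hs]; trivial
  have : Submodule.span k (Set.range ![L.pt (i, 0), L.pt (i, 1), L.pt (i', 0)]) ≤
      (L.valQ a).comap (LinearMap.single k (fun _ => Fin 3 → k) (i, j)) := by
    rw [Submodule.span_le]
    rintro _ ⟨x, rfl⟩
    fin_cases x
    · exact L.single_mem_valQ_same i j 0
    · exact L.single_mem_valQ_same i j 1
    · exact L.single_mem_valQ_other hi'.symm j
  exact this hw

/-- Forms of degree `a + 1` take arbitrary values at the points and one point off the lines. -/
theorem exists_eval_eq (ha : a ≠ 0) {y : Fin 3 → k} (hy : eval y (L.prod Finset.univ) ≠ 0)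
    (t : Fin a × Fin 3 → k) (s : k) : ∃ g : MvPolynomial (Fin 3) k, g.IsHomogeneous (a + 1) ∧
      (∀ q, eval (L.pt q) g = t q) ∧ eval y g = s := by
  let W : Submodule k (Fin a × Fin 3 → k) :=
    (homogeneousSubmodule (Fin 3) k (a + 1)).map
      (LinearMap.pi fun q => (aeval (L.pt q) : MvPolynomial (Fin 3) k →ₐ[k] k).toLinearMap)
  have hW : ∀ t, t ∈ W := by
    refine eq_top_of_single_mem fun q w => ?_
    obtain ⟨i, j⟩ := q
    obtain ⟨g, hg, hs, hg1, hg2⟩ := L.exists_quadratic i j (Finset.univ.erase i) (by simp)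
    rw [Finset.card_erase_of_mem (Finset.mem_univ i), Finset.card_univ, Fintype.card_fin,
      show a - 1 + 2 = a + 1 by omega] at hg
    refine ⟨C (w * (eval (L.pt (i, j)) g)⁻¹) * g, hg.C_mul _, ?_⟩
    funext ⟨i', x⟩
    by_cases hi : i' = i
    · subst hi
      by_cases hx : x = j
      · subst hx
        simp [hg2]
      · simp [hg1 x hx, hx]
    · simp [hs (i', x) (by simpa using hi), hi]
  obtain ⟨g, hg, e⟩ := hW t
  have hg' : ∀ q, eval (L.pt q) g = t q := fun q => by
    have := congrFun e q
    simpa [coe_aeval_eq_eval] using this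
  obtain ⟨m, hm⟩ : ∃ m, eval y (linForm m) ≠ 0 := by
    have : Nonempty (Fin a) := Fin.pos_iff_nonempty.1 (Nat.pos_of_ne_zero ha)
    obtain ⟨i⟩ := this
    refine ⟨L.line i, fun h => hy ?_⟩
    rw [prod, map_prod]
    exact Finset.prod_eq_zero (Finset.mem_univ i) h
  have hp := (L.prod_isHomogeneous Finset.univ).mul (linForm_isHomogeneous m)
  rw [Finset.card_univ, Fintype.card_fin] at hp
  refine ⟨g + C ((s - eval y g) / (eval y (L.prod Finset.univ) * eval y (linForm m))) *
    (L.prod Finset.univ * linForm m), hg.add (hp.C_mul _), fun q => ?_, ?_⟩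
  · rw [map_add, map_mul, map_mul, L.eval_prod_univ, zero_mul, mul_zero, add_zero, hg']
  · rw [map_add, map_mul, map_mul, eval_C, div_mul_cancel₀ _ (mul_ne_zero hy hm)]
    ring

/-- Forms of degree `a` take arbitrary values at all but one of the points and one point off the
lines. -/
theorem exists_eval_eq_of_ne {b : ℕ} (L : LineArrangement f (b + 1)) {y : Fin 3 → k}
    (hy : eval y (L.prod Finset.univ) ≠ 0) (t : Fin (b + 1) × Fin 3 → k) (s : k) :
    ∃ g : MvPolynomial (Fin 3) k, g.IsHomogeneous (b + 1) ∧
      (∀ q, q ≠ (0, 0) → eval (L.pt q) g = t q) ∧ eval y g = s := by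
  let W : Submodule k (Fin (b + 1) × Fin 3 → k) :=
    { carrier := {t | ∃ g : MvPolynomial (Fin 3) k, g.IsHomogeneous (b + 1) ∧
        ∀ q, q ≠ (0, 0) → eval (L.pt q) g = t q}
      add_mem' := by
        rintro t t' ⟨g, hg, h⟩ ⟨g', hg', h'⟩
        exact ⟨g + g', hg.add hg', fun q hq => by rw [map_add, h q hq, h' q hq]; rfl⟩
      zero_mem' := ⟨0, isHomogeneous_zero _ _ _, fun q _ => map_zero _⟩
      smul_mem' := by
        rintro x t ⟨g, hg, h⟩
        exact ⟨C x * g, hg.C_mul _, fun q hq => by rw [map_mul, eval_C, h q hq]; rfl⟩ }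
  have h0 : ∀ j w, Pi.single (0, j) w ∈ W := fun j w => by
    by_cases hj : j = 0
    · subst hj
      exact ⟨0, isHomogeneous_zero _ _ _, fun q hq => by simp [hq]⟩
    obtain ⟨j₂, h1, h3⟩ : ∃ j₂ : Fin 3, j ≠ j₂ ∧ ∀ x, x = 0 ∨ x = j ∨ x = j₂ := by
      revert hj; revert j; decide
    obtain ⟨g, hg, hs, hg1, hg2⟩ := L.exists_linear 0 h1 (Finset.univ.erase 0) (by simp)
    rw [Finset.card_erase_of_mem (Finset.mem_univ 0), Finset.card_univ, Fintype.card_fin,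
      Nat.add_sub_cancel] at hg
    refine ⟨C (w * (eval (L.pt (0, j)) g)⁻¹) * g, hg.C_mul _, ?_⟩
    rintro ⟨i, x⟩ hq
    by_cases hi : i = 0
    · subst hi
      rcases h3 x with rfl | rfl | rfl
      · exact absurd rfl hq
      · simp [hg2]
      · simp [hg1, Ne.symm h1]
    · simp [hi, hs (i, x) (by simpa using hi)]
  have hW : ∀ t, t ∈ W := by
    refine eq_top_of_single_mem fun q w => ?_
    obtain ⟨i, j⟩ := q
    by_cases hi : i = 0
    · subst hi
      exact h0 j w
    obtain ⟨g, hg, hs, hg1, hg2⟩ :=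
      L.exists_quadratic i j ((Finset.univ.erase i).erase 0) (by simp)
    rw [Finset.card_erase_of_mem (by simpa using Ne.symm hi),
      Finset.card_erase_of_mem (Finset.mem_univ i), Finset.card_univ, Fintype.card_fin,
      show b + 1 - 1 - 1 + 2 = b + 1 by omega] at hg
    have e : Pi.single (i, j) w = (w * (eval (L.pt (i, j)) g)⁻¹) •
        ((fun q => eval (L.pt q) g) - ∑ x, Pi.single (0, x) (eval (L.pt (0, x)) g)) := by
      funext ⟨i₀, x⟩
      rw [Pi.smul_apply, Pi.sub_apply, Finset.sum_apply]
      by_cases h1 : i₀ = 0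
      · subst h1
        rw [Finset.sum_eq_single x]
        · simp [Ne.symm hi]
        · intro y _ hy
          simp [Ne.symm hy]
        · simp
      · by_cases h2 : i₀ = i
        · subst h2
          by_cases hx : x = j
          · subst hx
            simp [h1, hg2]
          · simp [h1, hg1 x hx, hx]
        · simp [h1, h2, hs (i₀, x) (by simp [h1, h2])]
    rw [e]
    exact W.smul_mem _ (W.sub_mem ⟨g, hg, fun _ _ => rfl⟩ (W.sum_mem fun x _ => h0 x _))
  obtain ⟨g, hg, hg'⟩ := hW t
  have hp := L.prod_isHomogeneous Finset.univ
  rw [Finset.card_univ, Fintype.card_fin] at hp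
  refine ⟨g + C ((s - eval y g) / eval y (L.prod Finset.univ)) * L.prod Finset.univ,
    hg.add (hp.C_mul _), fun q hq => ?_, ?_⟩
  · rw [map_add, map_mul, L.eval_prod_univ, mul_zero, add_zero, hg' q hq]
  · rw [map_add, map_mul, eval_C, div_mul_cancel₀ _ hy]
    ring

end LineArrangement

end LineArrangement

section Horace

variable {k : Type*} [Field k] {ι κ : Type*} {z : ι → Fin 4 → k} {w : κ → Fin 4 → k} {b : ℕ}

/-- Specialising part of the points to the plane `x₃ = 0`. -/
theorem SurjQ.sum_elim (h : SurjQ b z) (hz : ∀ p, z p 3 ≠ 0) (h' : SurjQ (b + 1) w)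
    (hw : ∀ p, w p 3 = 0) : SurjQ (b + 1) (Sum.elim z w) := by
  intro t
  obtain ⟨v, hv, c, hc⟩ := h' fun p => t (Sum.inr p)
  obtain ⟨v', hv', c', hc'⟩ := h fun p i => (t (Sum.inl p) i - eval (z p) (v i)) / z p 3
  refine ⟨fun i => v i + X 3 * v' i, fun i => (hv i).add ?_,
    Sum.elim (fun p => z p 3 * c' p) c, ?_⟩
  · rw [add_comm]
    exact (isHomogeneous_X _ _).mul (hv' i)
  · rintro (p | p) i
    · have := hc' p i
      have h3 := hz p
      simp only [Sum.elim_inl, map_add, map_mul, eval_X]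
      rw [this]
      field_simp
      ring
    · simp only [Sum.elim_inr, map_add, map_mul, eval_X, hw, zero_mul, add_zero, hc]

theorem SurjO.sum_elim (h : SurjO b z) (hz : ∀ p, z p 3 ≠ 0) (h' : SurjO (b + 1) w)
    (hw : ∀ p, w p 3 = 0) : SurjO (b + 1) (Sum.elim z w) := by
  intro t ht
  obtain ⟨β, h0, ha, hβ, hβ'⟩ := h' (fun p => t (Sum.inr p)) fun p => ht (Sum.inr p)
  obtain ⟨γ, g0, ga, hγ, hγ'⟩ := h
    (fun p i => (t (Sum.inl p) i - ∑ j, z p j * eval (z p) (β i j)) / z p 3) fun p => by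
    have h1 := ht (Sum.inl p)
    have h2 := sum_antisymm (β := fun i j => eval (z p) (β i j)) (fun i => by rw [h0, map_zero])
      (fun i j => by rw [ha i j, map_neg]) (z p)
    simp only [Sum.elim_inl] at h1
    simp_rw [div_mul_eq_mul_div]
    rw [← Finset.sum_div]
    simp only [sub_mul, Finset.sum_sub_distrib]
    rw [h1, h2, sub_zero, zero_div]
  refine ⟨fun i j => β i j + X 3 * γ i j, fun i => ?_, fun i j => ?_,
    fun i j => (hβ i j).add ?_, ?_⟩
  · change β i i + X 3 * γ i i = 0
    rw [h0, g0, mul_zero, add_zero]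
  · change β j i + X 3 * γ j i = -(β i j + X 3 * γ i j)
    rw [ha, ga]
    ring
  · rw [add_comm]
    exact (isHomogeneous_X _ _).mul (hγ i j)
  · rintro (p | p) i
    · have h1 := hγ' p i
      have h3 := hz p
      simp only [Sum.elim_inl, map_add, map_mul, eval_X, mul_add, Finset.sum_add_distrib]
      have : ∑ j, z p j * (z p 3 * eval (z p) (γ i j)) =
          z p 3 * ∑ j, z p j * eval (z p) (γ i j) := by
        rw [Finset.mul_sum]
        exact Finset.sum_congr rfl fun j _ => by ring
      rw [this, h1]
      field_simp
      ring
    · simp only [Sum.elim_inr, map_add, map_mul, eval_X, hw, zero_mul, add_zero, hβ']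

lemma exists_eq_sum_X_mul {σ : Type*} [Fintype σ] {n : ℕ} {g : MvPolynomial σ k}
    (hg : g.IsHomogeneous (n + 1)) : ∃ q : σ → MvPolynomial σ k,
      (∀ i, (q i).IsHomogeneous n) ∧ g = ∑ i, X i * q i := by
  classical
  rw [g.as_sum]
  refine Finset.sum_induction _ (fun g => ∃ q : σ → MvPolynomial σ k,
      (∀ i, (q i).IsHomogeneous n) ∧ g = ∑ i, X i * q i) ?_ ?_ fun m hm => ?_
  · rintro _ _ ⟨q, hq, rfl⟩ ⟨q', hq', rfl⟩
    exact ⟨fun i => q i + q' i, fun i => (hq i).add (hq' i), by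
      simp only [mul_add, Finset.sum_add_distrib]⟩
  · exact ⟨fun _ => 0, fun _ => isHomogeneous_zero _ _ _, by simp⟩
  · have hd : m.degree = n + 1 := by
      rw [Finsupp.degree_eq_weight_one]
      exact hg (mem_support_iff.1 hm)
    obtain ⟨i, hi⟩ : ∃ i, m i ≠ 0 := by
      by_contra! h
      have : m = 0 := Finsupp.ext h
      rw [this, map_zero] at hd
      omega
    have hm' : Finsupp.single i 1 + (m - Finsupp.single i 1) = m :=
      add_tsub_cancel_of_le (Finsupp.single_le_iff.2 (Nat.one_le_iff_ne_zero.2 hi))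
    refine ⟨fun j => if j = i then monomial (m - Finsupp.single i 1) (coeff m g) else 0,
      fun j => ?_, ?_⟩
    · beta_reduce
      split_ifs
      · refine isHomogeneous_monomial _ ?_
        rw [← hm', map_add, Finsupp.degree_single] at hd
        omega
      · exact isHomogeneous_zero _ _ _
    · simp only [mul_ite, mul_zero, Finset.sum_ite_eq', Finset.mem_univ, if_true]
      rw [X, monomial_mul, one_mul, hm']

namespace LineArrangement

variable {f : MvPolynomial (Fin 3) k} {a : ℕ} (L : LineArrangement f a)

lemma ne_zero_of_eval_prod_ne_zero (ha : a ≠ 0) {y : Fin 3 → k}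
    (hy : eval y (L.prod Finset.univ) ≠ 0) : y ≠ 0 := by
  rintro rfl
  have hp := L.prod_isHomogeneous Finset.univ
  rw [Finset.card_univ, Fintype.card_fin] at hp
  have := eval_smul_of_isHomogeneous hp 0 (0 : Fin 3 → k)
  rw [smul_zero, zero_pow ha, zero_mul] at this
  exact hy this

lemma pt_ne_zero (q : Fin a × Fin 3) : L.pt q ≠ 0 := by
  intro h
  obtain ⟨j', hj⟩ := exists_ne q.2
  obtain ⟨m, -, hm⟩ := L.sep q.1 q.2 j' hj.symm
  exact hm (by rw [Prod.mk.eta, h, eval_linForm]; simp)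

/-- Vectors of forms of degree `a` with given values modulo the points and at one point off the
lines. -/
lemma exists_vector (ha : 2 ≤ a) {y : Fin 3 → k} (hy : eval y (L.prod Finset.univ) ≠ 0)
    (t : Fin a × Fin 3 → Fin 3 → k) (s : Fin 3 → k) :
    ∃ v : Fin 3 → MvPolynomial (Fin 3) k, (∀ i, (v i).IsHomogeneous a) ∧
      (∃ c : Fin a × Fin 3 → k, ∀ q i, eval (L.pt q) (v i) = t q i + c q * L.pt q i) ∧
      ∀ i, eval y (v i) = s i := by
  obtain ⟨v, hv, c, hc⟩ := L.mem_valQ ha t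
  have hp := L.prod_isHomogeneous Finset.univ
  rw [Finset.card_univ, Fintype.card_fin] at hp
  refine ⟨fun i => v i + C ((s i - eval y (v i)) / eval y (L.prod Finset.univ)) *
    L.prod Finset.univ, fun i => (hv i).add (hp.C_mul _), ⟨c, fun q i => ?_⟩, fun i => ?_⟩
  · rw [map_add, map_mul, L.eval_prod_univ, mul_zero, add_zero, hc]
  · rw [map_add, map_mul, eval_C, div_mul_cancel₀ _ hy]
    ring

/-- A vector orthogonal to `x` is a cross product with `x`. -/
lemma exists_cross {x t : Fin 3 → k} (hx : x ≠ 0) (h : t 0 * x 0 + t 1 * x 1 + t 2 * x 2 = 0) :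
    ∃ s : Fin 3 → k, x 1 * s 2 - x 2 * s 1 = t 0 ∧ x 2 * s 0 - x 0 * s 2 = t 1 ∧
      x 0 * s 1 - x 1 * s 0 = t 2 := by
  obtain ⟨y, hy⟩ : ∃ y : Fin 3 → k, x 0 * y 0 + x 1 * y 1 + x 2 * y 2 = 1 := by
    obtain ⟨i, hi⟩ := Function.ne_iff.1 hx
    refine ⟨Pi.single i (x i)⁻¹, ?_⟩
    fin_cases i <;> simpa using mul_inv_cancel₀ hi
  refine ⟨![t 1 * y 2 - t 2 * y 1, t 2 * y 0 - t 0 * y 2, t 0 * y 1 - t 1 * y 0], ?_, ?_, ?_⟩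
  · simp
    linear_combination t 0 * hy - y 0 * h
  · simp
    linear_combination t 1 * hy - y 1 * h
  · simp
    linear_combination t 2 * hy - y 2 * h

theorem surjO (ha : 2 ≤ a) {y : Fin 3 → k} (hy : eval y (L.prod Finset.univ) ≠ 0) :
    SurjO a (Sum.elim (fun q => pl (L.pt q)) fun _ : Unit => pl y) := by
  intro t ht
  have ht' : ∀ (p : (Fin a × Fin 3) ⊕ Unit) (x : Fin 3 → k),
      Sum.elim (fun q => pl (L.pt q)) (fun _ : Unit => pl y) p = pl x →
      t p 0 * x 0 + t p 1 * x 1 + t p 2 * x 2 = 0 := fun p x e => by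
    have := ht p
    rw [e, Fin.sum_univ_four] at this
    simpa [pl] using this
  choose s hs using fun q => exists_cross (t := fun i => t (Sum.inl q) i.castSucc)
    (L.pt_ne_zero q) (ht' (Sum.inl q) _ rfl)
  obtain ⟨s', hs'⟩ := exists_cross (t := fun i => t (Sum.inr ()) i.castSucc)
    (L.ne_zero_of_eval_prod_ne_zero (by omega) hy) (ht' (Sum.inr ()) _ rfl)
  obtain ⟨v, hv, ⟨c, hc⟩, hvy⟩ := L.exists_vector ha hy s s'
  obtain ⟨G, hG, hG1, hG2⟩ := L.exists_eval_eq (by omega) hy (fun q => t (Sum.inl q) 3)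
    (t (Sum.inr ()) 3)
  obtain ⟨g, hg, rfl⟩ := exists_eq_sum_X_mul hG
  let β : Fin 4 → Fin 4 → MvPolynomial (Fin 3) k :=
    ![![0, v 2, -v 1, -g 0], ![-v 2, 0, v 0, -g 1], ![v 1, -v 0, 0, -g 2], ![g 0, g 1, g 2, 0]]
  have key : ∀ (x : Fin 3 → k) (i : Fin 4), ∑ j, pl x j * eval x (β i j) =
      ![x 1 * eval x (v 2) - x 2 * eval x (v 1), x 2 * eval x (v 0) - x 0 * eval x (v 2),
        x 0 * eval x (v 1) - x 1 * eval x (v 0), eval x (∑ j, X j * g j)] i := fun x i => by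
    rw [Fin.sum_univ_four]
    fin_cases i
    · simp [β, pl]; ring
    · simp [β, pl]; ring
    · simp [β, pl]; ring
    · simp [β, pl, Fin.sum_univ_three]
  refine ⟨fun i j => lft (β i j), fun i => ?_, fun i j => ?_, fun i j => lft_isHomogeneous ?_, ?_⟩
  · fin_cases i <;> simp [β]
  · fin_cases i <;> fin_cases j <;> simp [β]
  · fin_cases i <;> fin_cases j <;>
      first
      | exact isHomogeneous_zero _ _ _
      | exact hv _
      | exact hg _
      | exact (hv _).neg
      | exact (hg _).neg
  · rintro (q | ⟨⟩) i
    · simp only [Sum.elim_inl, eval_pl_lft]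
      obtain ⟨h0, h1, h2⟩ := hs q
      rw [key, hG1, hc, hc, hc]
      fin_cases i
      · change L.pt q 1 * (s q 2 + _) - L.pt q 2 * (s q 1 + _) = _
        refine Eq.trans ?_ h0
        ring
      · change L.pt q 2 * (s q 0 + _) - L.pt q 0 * (s q 2 + _) = _
        refine Eq.trans ?_ h1
        ring
      · change L.pt q 0 * (s q 1 + _) - L.pt q 1 * (s q 0 + _) = _
        refine Eq.trans ?_ h2
        ring
      · rfl
    · simp only [Sum.elim_inr, eval_pl_lft]
      rw [key, hG2, hvy, hvy, hvy]
      fin_cases i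
      · exact hs'.1
      · exact hs'.2.1
      · exact hs'.2.2
      · rfl

theorem surjQ {b : ℕ} (L : LineArrangement f (b + 1)) (hb : b ≠ 0) {y : Fin 3 → k}
    (hy : eval y (L.prod Finset.univ) ≠ 0) :
    SurjQ (b + 1) (Sum.elim (fun q : {q : Fin (b + 1) × Fin 3 // q ≠ (0, 0)} => pl (L.pt q))
      fun _ : Unit => pl y) := by
  classical
  intro t
  obtain ⟨v, hv, ⟨c, hc⟩, hvy⟩ := L.exists_vector (by omega) hy
    (fun q i => if h : q ≠ (0, 0) then t (Sum.inl ⟨q, h⟩) i.castSucc else 0)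
    (fun i => t (Sum.inr ()) i.castSucc)
  obtain ⟨g, hg, hg1, hg2⟩ := L.exists_eval_eq_of_ne hy
    (fun q => if h : q ≠ (0, 0) then t (Sum.inl ⟨q, h⟩) 3 else 0) (t (Sum.inr ()) 3)
  refine ⟨Fin.snoc (α := fun _ => MvPolynomial (Fin 4) k) (fun i => lft (v i)) (lft g), fun i => ?_,
    Sum.elim (fun q => c q) (fun _ => 0), ?_⟩
  · induction i using Fin.lastCases with
    | last => rw [Fin.snoc_last]; exact lft_isHomogeneous hg
    | cast i => rw [Fin.snoc_castSucc]; exact lft_isHomogeneous (hv i)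
  · rintro (⟨q, hq⟩ | ⟨⟩) i
    · induction i using Fin.lastCases with
      | last =>
        have := hg1 q hq
        rw [dif_pos hq] at this
        simp only [Sum.elim_inl, Fin.snoc_last, eval_pl_lft, this]
        change _ = _ + c q * pl (L.pt q) 3
        rw [pl_three, mul_zero, add_zero]
        rfl
      | cast i =>
        have := hc q i
        rw [dif_pos hq] at this
        simp only [Sum.elim_inl, Fin.snoc_castSucc, eval_pl_lft, this, pl_castSucc]
    · induction i using Fin.lastCases with
      | last =>
        simp only [Sum.elim_inr, Fin.snoc_last, eval_pl_lft, hg2, zero_mul, add_zero]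
        rfl
      | cast i => simp only [Sum.elim_inr, Fin.snoc_castSucc, eval_pl_lft, hvy, zero_mul, add_zero]

end LineArrangement

end Horace

section Existence

variable {k : Type*} [Field k]

lemma exists_eval_ne_zero {σ : Type*} [Infinite k] {g : MvPolynomial σ k} (hg : g ≠ 0) :
    ∃ u, eval u g ≠ 0 := by
  by_contra! h
  exact hg (MvPolynomial.funext fun u => by rw [h, map_zero])

/-- The cross product. -/
def cross {A : Type*} [CommRing A] (x y : Fin 3 → A) : Fin 3 → A :=
  ![x 1 * y 2 - x 2 * y 1, x 2 * y 0 - x 0 * y 2, x 0 * y 1 - x 1 * y 0]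

lemma exists_cross_eq (t : Fin 3 → k) : ∃ x y, cross x y = t := by
  obtain ⟨x, hx, h⟩ : ∃ x : Fin 3 → k, x ≠ 0 ∧ t 0 * x 0 + t 1 * x 1 + t 2 * x 2 = 0 := by
    by_cases h : t 0 = 0
    · exact ⟨![1, 0, 0], fun e => one_ne_zero (congrFun e 0), by simp [h]⟩
    · exact ⟨![t 1, -t 0, 0], fun e => h (neg_eq_zero.1 (congrFun e 1)), by simp; ring⟩
  obtain ⟨s, h0, h1, h2⟩ := LineArrangement.exists_cross hx h
  refine ⟨x, s, ?_⟩
  funext i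
  fin_cases i
  · exact h0
  · exact h1
  · exact h2

/-- Two points on a common line are proportional when they also lie on another line. -/
lemma mul_cross_eq {l m d : Fin 3 → k} (hl : l 0 * d 0 + l 1 * d 1 + l 2 * d 2 = 0)
    (hm : m 0 * d 0 + m 1 * d 1 + m 2 * d 2 = 0) : d 1 • cross l m = cross l m 1 • d := by
  funext i
  fin_cases i
  · simp [cross]
    linear_combination m 2 * hl - l 2 * hm
  · simp [cross]
    ring
  · simp [cross]
    linear_combination l 0 * hm - m 0 * hl

theorem exists_lineArrangement [IsAlgClosed k] {f : MvPolynomial (Fin 3) k}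
    (hf : f.IsHomogeneous 3)
    (h3 : ThreeRoots (lineMap (Pi.single 1 1 : Fin 3 → k) (Pi.single 0 1) f)) {a : ℕ}
    {Q : MvPolynomial (Fin a × Fin 3) k} (hQ : Q ≠ 0) :
    ∃ L : LineArrangement f a, eval (fun q => L.line q.1 q.2) Q ≠ 0 := by
  classical
  have : Infinite k := IsAlgClosed.instInfinite
  obtain ⟨Δ, hΔ⟩ := exists_disc hf.totalDegree_le
    (![0, X 2, -X 1] : Fin 3 → MvPolynomial (Fin 3) k) ![X 2, 0, -X 0]
  have hδ : X 2 * Δ ≠ 0 := by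
    intro h
    have h1 := congrArg (eval (Pi.single 2 1 : Fin 3 → k)) h
    rw [map_mul, eval_X, Pi.single_eq_same, one_mul, map_zero] at h1
    refine (hΔ _).2 ?_ h1
    have e1 : (fun i => eval (Pi.single 2 1 : Fin 3 → k)
        ((![0, X 2, -X 1] : Fin 3 → MvPolynomial (Fin 3) k) i)) = Pi.single 1 1 := by
      funext i
      fin_cases i <;> simp
    have e2 : (fun i => eval (Pi.single 2 1 : Fin 3 → k)
        ((![X 2, 0, -X 0] : Fin 3 → MvPolynomial (Fin 3) k) i)) = Pi.single 0 1 := by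
      funext i
      fin_cases i <;> simp
    rwa [e1, e2]
  obtain ⟨v₀, hv₀⟩ : ∃ v, eval v f ≠ 0 := exists_eval_ne_zero fun h => h3.1 (by rw [h, map_zero])
  let F : Fin a → Fin a → MvPolynomial (Fin a × Fin 3) k := fun i j =>
    if i = j then 1 else aeval (cross (fun m => X (i, m)) fun m => X (j, m)) f
  have hF : ∀ (u : Fin a × Fin 3 → k) i j, i ≠ j → eval u (F i j) =
      eval (cross (fun m => u (i, m)) fun m => u (j, m)) f := fun u i j h => by
    simp only [F, if_neg h]
    rw [← coe_aeval_eq_eval, ← coe_aeval_eq_eval, RingHom.coe_coe, RingHom.coe_coe,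
      comp_aeval_apply]
    congr 2
    funext m
    fin_cases m <;> simp [cross]
  have hF0 : ∀ i j, F i j ≠ 0 := fun i j => by
    by_cases h : i = j
    · simp [F, h]
    obtain ⟨x, y, hxy⟩ := exists_cross_eq v₀
    intro h0
    have := hF (fun q => if q.1 = i then x q.2 else y q.2) i j h
    rw [h0, map_zero] at this
    simp only [if_true, if_neg (Ne.symm h)] at this
    rw [hxy] at this
    exact hv₀ this.symm
  have hP : Q * ((∏ i : Fin a, rename (Prod.mk i) (X 2 * Δ)) * ∏ i, ∏ j, F i j) ≠ 0 :=
    mul_ne_zero hQ (mul_ne_zero (Finset.prod_ne_zero_iff.2 fun i _ => by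
      rw [← map_zero (rename (Prod.mk i))]
      exact (rename_injective _ (Prod.mk_right_injective i)).ne hδ)
      (Finset.prod_ne_zero_iff.2 fun i _ => Finset.prod_ne_zero_iff.2 fun j _ => hF0 i j))
  obtain ⟨u, hu⟩ := exists_eval_ne_zero hP
  rw [map_mul, map_mul, map_prod, map_prod] at hu
  have hu1 : ∀ i, u (i, 2) ≠ 0 ∧ eval (fun m => u (i, m)) Δ ≠ 0 := fun i => by
    have := Finset.prod_ne_zero_iff.1 (left_ne_zero_of_mul (right_ne_zero_of_mul hu)) i
      (Finset.mem_univ i)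
    rw [eval_rename, map_mul, eval_X] at this
    exact ⟨left_ne_zero_of_mul this, right_ne_zero_of_mul this⟩
  have hu2 : ∀ i j, i ≠ j → eval (cross (fun m => u (i, m)) fun m => u (j, m)) f ≠ 0 :=
    fun i j h => by
    have := Finset.prod_ne_zero_iff.1 (right_ne_zero_of_mul (right_ne_zero_of_mul hu)) i
      (Finset.mem_univ i)
    rw [map_prod] at this
    rw [← hF u i j h]
    exact Finset.prod_ne_zero_iff.1 this j (Finset.mem_univ j)
  choose hne t ht hroot using fun i => (hΔ _).1 (hu1 i).2
  have hpt : ∀ i s, (fun m => eval (fun m => u (i, m))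
        ((![0, X 2, -X 1] : Fin 3 → MvPolynomial (Fin 3) k) m)) +
      s • (fun m => eval (fun m => u (i, m))
        ((![X 2, 0, -X 0] : Fin 3 → MvPolynomial (Fin 3) k) m)) =
      ![s * u (i, 2), u (i, 2), -u (i, 1) - s * u (i, 0)] := fun i s => by
    funext m
    fin_cases m
    · simp
    · simp
    · simp [sub_eq_add_neg]
  have hon : ∀ i s, eval ![s * u (i, 2), u (i, 2), -u (i, 1) - s * u (i, 0)]
      (linForm fun m => u (i, m)) = 0 := fun i s => by
    rw [eval_linForm]
    simp
    ring
  have hroot' : ∀ i j, eval ![t i j * u (i, 2), u (i, 2), -u (i, 1) - t i j * u (i, 0)] f = 0 :=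
    fun i j => by
    rw [← hpt, ← eval_lineMap, hroot]
  refine ⟨{ line := fun i m => u (i, m)
            pt := fun q =>
              ![t q.1 q.2 * u (q.1, 2), u (q.1, 2), -u (q.1, 1) - t q.1 q.2 * u (q.1, 0)]
            root := fun q => hroot' _ _
            on_line := fun q => hon _ _
            off_line := fun q i hi h => ?_
            sep := fun i j j' h => ⟨![1, -t i j', 0], ?_, ?_⟩
            line_ne_zero := fun i h => (hu1 i).1 (congrFun h 2)
            not_dvd := fun i h => hne i ?_ }, left_ne_zero_of_mul hu⟩
  · have h1 := hon q.1 (t q.1 q.2)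
    rw [eval_linForm] at h h1
    have := congrArg (fun v => eval v f) (mul_cross_eq
      (l := fun m => u (q.1, m)) (m := fun m => u (i, m)) h1 h)
    simp only [eval_smul_of_isHomogeneous hf, hroot', mul_zero] at this
    exact hu2 _ _ hi.symm ((mul_eq_zero.1 this).resolve_left (pow_ne_zero _ (hu1 q.1).1))
  · rw [eval_linForm]
    simp
  · rw [eval_linForm]
    simp
    rw [← sub_eq_add_neg, ← sub_mul]
    exact mul_ne_zero (sub_ne_zero.2 ((ht i).ne h)) (hu1 i).1
  · obtain ⟨g, rfl⟩ := h
    refine Polynomial.funext fun s => ?_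
    rw [eval_lineMap, hpt, map_mul, hon, zero_mul, Polynomial.eval_zero]

end Existence

section Frame

variable {k : Type*} [Field k]

/-- The standard projective frame. -/
def frame : Fin 4 ⊕ Unit → Fin 4 → k := Sum.elim (fun i => Pi.single i 1) fun _ => 1

lemma surjQ_frame : SurjQ 1 (frame (k := k)) := by
  intro t
  let c : Fin 4 → k := fun i => t (Sum.inr ()) i - ∑ j, t (Sum.inl j) i
  refine ⟨fun i => ∑ j, C (t (Sum.inl j) i) * X j + C (c i) * X i, fun i =>
    (IsHomogeneous.sum _ _ _ fun j _ => (isHomogeneous_X _ _).C_mul _).add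
      ((isHomogeneous_X _ _).C_mul _), Sum.elim c 0, ?_⟩
  rintro (p | p) i
  · by_cases h : i = p
    · subst h
      simp [frame, Pi.single_apply]
    · simp [frame, Pi.single_apply, h]
  · simp [frame, c]

lemma surjO_frame : SurjO 1 (frame (k := k)) := by
  intro t ht
  have h0 : ∀ j, t (Sum.inl j) j = 0 := fun j => by
    have := ht (Sum.inl j)
    simpa [frame, Pi.single_apply] using this
  have h1 : ∑ i, t (Sum.inr ()) i = 0 := by
    have := ht (Sum.inr ())
    simpa [frame] using this
  let r : Fin 4 → k := fun i => t (Sum.inr ()) i - ∑ j, (t (Sum.inl j) i - t (Sum.inl i) j)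
  have hr : r 0 = -r 1 - r 2 - r 3 := by
    simp only [Fin.sum_univ_four] at h1
    simp only [r, Fin.sum_univ_four]
    linear_combination h1
  let γ : Fin 4 → Fin 4 → MvPolynomial (Fin 4) k :=
    ![![0, C (-r 1) * X 2, C (-r 2) * X 3, C (-r 3) * X 1], ![C (r 1) * X 2, 0, 0, 0],
      ![C (r 2) * X 3, 0, 0, 0], ![C (r 3) * X 1, 0, 0, 0]]
  refine ⟨fun i j => C (t (Sum.inl j) i) * X j - C (t (Sum.inl i) j) * X i + γ i j,
    fun i => ?_, fun i j => ?_, fun i j => (((isHomogeneous_X _ _).C_mul _).sub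
      ((isHomogeneous_X _ _).C_mul _)).add ?_, ?_⟩
  · change _ - _ + γ i i = 0
    rw [sub_self, zero_add]
    fin_cases i <;> rfl
  · change C (t (Sum.inl i) j) * X i - C (t (Sum.inl j) i) * X j + γ j i =
      -(C (t (Sum.inl j) i) * X j - C (t (Sum.inl i) j) * X i + γ i j)
    have : γ j i = -γ i j := by
      fin_cases i <;> fin_cases j <;> simp [γ]
    rw [this]
    ring
  · fin_cases i <;> fin_cases j <;>
      first
      | exact isHomogeneous_zero _ _ _
      | exact (isHomogeneous_X _ _).C_mul _
  · rintro (p | p) i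
    · have hγ : eval (Pi.single p 1) (γ i p) = 0 := by
        fin_cases i <;> fin_cases p <;> simp [γ]
      simp only [frame, Sum.elim_inl]
      rw [Finset.sum_eq_single p (fun j _ hj => by simp [hj]) (by simp)]
      simp only [map_add, map_sub, map_mul, eval_C, eval_X, hγ, Pi.single_eq_same]
      by_cases h : i = p
      · subst h
        simp [h0]
      · simp [h]
    · simp only [frame, Sum.elim_inr]
      simp only [map_add, map_sub, map_mul, eval_C, eval_X, Pi.one_apply, mul_one, one_mul,
        Finset.sum_add_distrib]
      have hγ : ∑ j, eval (1 : Fin 4 → k) (γ i j) = r i := by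
        rw [Fin.sum_univ_four]
        fin_cases i
        · simp [γ]
          rw [hr]
          ring
        · simp [γ]
        · simp [γ]
        · simp [γ]
      rw [hγ]
      simp only [r]
      ring

variable {f : MvPolynomial (Fin 4) k}

/-- Five points of the surface in general position in space. -/
theorem exists_frame [IsAlgClosed k] (hf : f.IsHomogeneous 3) (hp : Prime f) :
    ∃ M N : Matrix (Fin 4) (Fin 4) k, M * N = 1 ∧ ∀ p, eval (M.mulVec (frame p)) f = 0 := by
  have hl : ∀ l y : Fin 4 → k, eval y (∑ j, C (l j) * X j) = ∑ j, l j * y j := fun l y => by simp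
  have hl1 : ∀ l : Fin 4 → k, (∑ j, C (l j) * X j).IsHomogeneous 1 := fun l =>
    IsHomogeneous.sum _ _ _ fun j _ => (isHomogeneous_X _ _).C_mul _
  have hl2 : ∀ l : Fin 4 → k, l ≠ 0 → ¬ f ∣ ∑ j, C (l j) * X j := fun l h =>
    not_dvd_of_isHomogeneous_one hf (hl1 l) fun e => h (by
      funext i
      have := hl l (Pi.single i 1)
      rw [e, map_zero] at this
      simpa [Pi.single_apply] using this.symm)
  have hspan : Submodule.span k {v | eval v f = 0} = ⊤ := by
    by_contra h
    obtain ⟨φ, h0, hφ⟩ := Submodule.exists_le_ker_of_lt_top _ (lt_top_iff_ne_top.2 h)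
    obtain ⟨v, hv, hv'⟩ := exists_eval_ne_zero_of_not_dvd hp
      (hl2 (fun j => φ (Pi.single j 1)) fun e => h0 (LinearMap.pi_ext' fun i =>
        LinearMap.ext_ring (congrFun e i)))
    rw [hl] at hv'
    apply hv'
    have := hφ (Submodule.subset_span hv)
    rw [LinearMap.mem_ker, LinearMap.pi_apply_eq_sum_univ] at this
    rw [← this]
    refine Finset.sum_congr rfl fun i _ => ?_
    rw [smul_eq_mul, mul_comm]
    congr 2
    funext j
    simp [Pi.single_apply, eq_comm]
  obtain ⟨P, hP, hind⟩ : ∃ P : Fin 4 → Fin 4 → k, (∀ i, eval (P i) f = 0) ∧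
      LinearIndependent k P := by
    obtain ⟨g, h1, -, h3⟩ := Submodule.exists_fun_fin_finrank_span_eq k {v | eval v f = 0}
    have e : Module.finrank k (Submodule.span k {v | eval v f = 0}) = 4 := by
      rw [hspan, finrank_top, Module.finrank_fin_fun]
    exact ⟨fun i => g (Fin.cast e.symm i), fun i => h1 _,
      h3.comp _ (Fin.cast_injective _)⟩
  obtain ⟨⟨A, B, hAB, hBA⟩, rfl : A = _⟩ := Matrix.linearIndependent_cols_iff_isUnit.1
    (show LinearIndependent k (Matrix.of fun i j => P j i).col from hind)
  have hB : ∀ i, B i ≠ 0 := fun i h => by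
    have := congrFun (congrFun hBA i) i
    simp [Matrix.mul_apply, h] at this
  obtain ⟨v, hv, hv'⟩ := exists_eval_ne_zero_of_not_dvd hp
    (g := ∏ i, ∑ j, C (B i j) * X j) fun h => by
      obtain ⟨i, -, hi⟩ := hp.exists_mem_finset_dvd h
      exact hl2 _ (hB i) hi
  rw [map_prod, Finset.prod_ne_zero_iff] at hv'
  have hc : ∀ i, B.mulVec v i ≠ 0 := fun i => by
    have := hv' i (Finset.mem_univ i)
    rwa [hl] at this
  refine ⟨(Matrix.of fun i j => P j i) * Matrix.diagonal (B.mulVec v),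
    Matrix.diagonal (fun i => (B.mulVec v i)⁻¹) * B, ?_, ?_⟩
  · rw [Matrix.mul_assoc, ← Matrix.mul_assoc (Matrix.diagonal _), Matrix.diagonal_mul_diagonal]
    simp only [mul_inv_cancel₀ (hc _), Matrix.diagonal_one, Matrix.one_mul]
    exact hAB
  · rintro (p | p)
    · have : ((Matrix.of fun i j => P j i) * Matrix.diagonal (B.mulVec v)).mulVec
          (frame (Sum.inl p)) = B.mulVec v p • P p := by
        funext i
        simp [frame, mul_comm]
      rw [this, eval_smul_of_isHomogeneous hf, hP, mul_zero]
    · have : ((Matrix.of fun i j => P j i) * Matrix.diagonal (B.mulVec v)).mulVec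
          (frame (Sum.inr p)) = v := by
        have e : (Matrix.diagonal (B.mulVec v)).mulVec (1 : Fin 4 → k) = B.mulVec v := by
          funext i
          simp [Matrix.mulVec_diagonal]
        simp only [frame, Sum.elim_inr]
        rw [← Matrix.mulVec_mulVec, e, Matrix.mulVec_mulVec, hAB, Matrix.one_mulVec]
      rw [this, hv]

end Frame

section Existence

variable {k : Type*} [Field k] {f : MvPolynomial (Fin 4) k}

lemma SurjO.ne_zero {ι : Type*} {z : ι → Fin 4 → k} {a : ℕ} (h : SurjO a z) (p : ι) : z p ≠ 0 := by
  classical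
  intro h0
  obtain ⟨b, -, -, -, hb⟩ := h (fun q => if q = p then Pi.single 0 1 else 0) fun q => by
    by_cases hq : q = p
    · subst hq
      simp [h0]
    · simp [hq]
  have := hb p 0
  simp [h0] at this

/-- Points of an open set of configurations can be taken off the plane `x₃ = 0`. -/
lemma exists_config_off_plane [IsAlgClosed k] (hf : f.IsHomogeneous 3) (hp : Prime f)
    {ι : Type*} [Fintype ι] {z : ι → Fin 4 → k} (hz : ∀ p, eval (z p) f = 0)
    {G : MvPolynomial (ι × Fin 4) k} (hG : eval (coords z) G ≠ 0) :
    ∃ u : ι → Fin 4 → k, (∀ p, eval (u p) f = 0) ∧ eval (coords u) G ≠ 0 ∧ ∀ p, u p 3 ≠ 0 := by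
  obtain ⟨v, hv, hv'⟩ := exists_eval_ne_zero_of_not_dvd hp (not_dvd_X hf 3)
  have key : ∀ u : ι → Fin 4 → k, eval (coords u) (∏ p, rename (Prod.mk p) (X 3)) =
      ∏ p, u p 3 := fun u => by
    rw [map_prod]
    exact Finset.prod_congr rfl fun p _ => by rw [eval_coords_rename, eval_X]
  obtain ⟨u, h1, h2, h3⟩ := exists_config_ne_zero hp hz (u₂ := fun _ => v) (fun _ => hv) hG
    (g₂ := ∏ p, rename (Prod.mk p) (X 3)) (by
      rw [key, Finset.prod_ne_zero_iff]
      intro p _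
      rwa [eval_X] at hv')
  rw [key, Finset.prod_ne_zero_iff] at h3
  exact ⟨u, h1, h2, fun p => h3 p (Finset.mem_univ p)⟩

lemma LineArrangement.exists_eval_prod_mul_ne_zero [IsAlgClosed k] {f : MvPolynomial (Fin 3) k}
    (hf : f.IsHomogeneous 3)
    (h3 : ThreeRoots (lineMap (Pi.single 1 1 : Fin 3 → k) (Pi.single 0 1) f)) {a : ℕ}
    (L : LineArrangement f a) {g : MvPolynomial (Fin 3) k} (hg : ¬ f ∣ g) :
    ∃ y, eval y f = 0 ∧ eval y (L.prod Finset.univ) ≠ 0 ∧ eval y g ≠ 0 := by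
  by_contra! h
  refine hg (L.dvd_of_dvd_prod_mul (dvd_of_squarefree (fun h => h3.1 (by rw [h, map_zero]))
    (squarefree_of_threeRoots hf.totalDegree_le h3) fun v hv => ?_))
  rw [map_mul, mul_eq_zero, or_iff_not_imp_left]
  exact h v hv

theorem exists_surjO [IsAlgClosed k] (hf : f.IsHomogeneous 3) (hp : Prime f)
    (h3 : ThreeRoots (lineMap (Pi.single 1 1 : Fin 3 → k) (Pi.single 0 1) (res f))) {a : ℕ}
    (ha : a ≠ 0) : ∃ (Z : Type) (_ : Fintype Z) (z : Z → Fin 4 → k),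
      2 * Fintype.card Z = 3 * (a * (a + 1)) + 2 + 2 * a ∧ (∀ p, eval (z p) f = 0) ∧
      SurjO a z := by
  induction a, Nat.one_le_iff_ne_zero.2 ha using Nat.le_induction with
  | base =>
    obtain ⟨M, N, hMN, h⟩ := exists_frame hf hp
    exact ⟨_, inferInstance, _, by simp, h, surjO_frame.map hMN⟩
  | succ b hb ih =>
    obtain ⟨Z, _, z, hcard, hz, hO⟩ := ih (by omega)
    obtain ⟨G, hG, hG'⟩ := hO.exists_open hO.ne_zero
    obtain ⟨u, hu, hu1, hu2⟩ := exists_config_off_plane hf hp hz hG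
    obtain ⟨L, -⟩ := exists_lineArrangement (res_isHomogeneous hf) h3 (a := b + 1)
      (one_ne_zero (α := MvPolynomial (Fin (b + 1) × Fin 3) k))
    obtain ⟨y, hy, hy', -⟩ := L.exists_eval_prod_mul_ne_zero (res_isHomogeneous hf) h3 (g := 1)
      fun ⟨q, hq⟩ => by
        have := congrArg (eval (L.pt (0, 0))) hq
        rw [map_one, map_mul, L.root, zero_mul] at this
        exact one_ne_zero this
    refine ⟨_, inferInstance, _, ?_, ?_, (hG' u hu1).sum_elim hu2 (L.surjO (by omega) hy') ?_⟩
    · simp only [Fintype.card_sum, Fintype.card_prod, Fintype.card_fin, Fintype.card_unit]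
      nlinarith
    · rintro (p | q | p)
      · exact hu p
      · simp only [Sum.elim_inr, Sum.elim_inl]
        rw [← eval_res, L.root]
      · simp only [Sum.elim_inr]
        rw [← eval_res, hy]
    · rintro (q | p)
      · exact pl_three _
      · exact pl_three _

end Existence

section Plane

variable {k : Type*} [Field k]

lemma res_lft (g : MvPolynomial (Fin 3) k) : res (lft g) = g := by
  have : res.comp lft = AlgHom.id k (MvPolynomial (Fin 3) k) := by
    apply algHom_ext
    intro i
    fin_cases i <;> simp [res, lft]
  exact congrArg (fun φ => φ g) this

/-- A linear functional on forms, evaluated on products of linear forms, is a polynomial in their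
coefficients. -/
lemma exists_eval_eq_apply_prod {a : ℕ} (T : MvPolynomial (Fin 3) k →ₗ[k] k) :
    ∃ Q : MvPolynomial (Fin a × Fin 3) k, ∀ l : Fin a → Fin 3 → k,
      eval (fun q => l q.1 q.2) Q = T (∏ i, linForm (l i)) := by
  refine ⟨∑ s : Fin a → Fin 3, C (T (∏ i, X (s i))) * ∏ i, X (i, s i), fun l => ?_⟩
  have : ∏ i, linForm (l i) = ∑ s : Fin a → Fin 3, (∏ i, l i (s i)) • ∏ i, X (s i) := by
    simp only [linForm]
    rw [Finset.prod_univ_sum, Fintype.piFinset_univ]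
    refine Finset.sum_congr rfl fun s _ => ?_
    rw [Finset.prod_mul_distrib, ← map_prod, smul_eq_C_mul]
  rw [this, map_sum, map_sum]
  refine Finset.sum_congr rfl fun s _ => ?_
  rw [map_smul, map_mul (eval _), map_prod (eval _), eval_C, smul_eq_mul, mul_comm]
  simp only [eval_X]

lemma eq_zero_of_apply_prod_X {a : ℕ} {T : MvPolynomial (Fin 3) k →ₗ[k] k}
    (hT : ∀ s : Fin a → Fin 3, T (∏ i, X (s i)) = 0) {g : MvPolynomial (Fin 3) k}
    (hg : g.IsHomogeneous a) : T g = 0 := by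
  induction a generalizing T g with
  | zero =>
    rw [← totalDegree_zero_iff_isHomogeneous, totalDegree_eq_zero_iff_eq_C] at hg
    have := hT Fin.elim0
    rw [Fin.prod_univ_zero] at this
    rw [hg, ← mul_one (C _), ← smul_eq_C_mul, map_smul, this, smul_zero]
  | succ n ih =>
    obtain ⟨q, hq, rfl⟩ := exists_eq_sum_X_mul hg
    rw [map_sum]
    refine Finset.sum_eq_zero fun j _ => ?_
    refine ih (T := T ∘ₗ LinearMap.mulLeft k (X j)) (fun s => ?_) (hq j)
    have := hT (Fin.cons j s)
    rw [Fin.prod_univ_succ] at this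
    simpa using this

lemma linForm_single (j : Fin 3) : linForm (Pi.single j (1 : k)) = X j := by
  rw [linForm, Finset.sum_eq_single j (fun i _ hi => by simp [hi]) (by simp)]
  simp

/-- A functional not vanishing on forms of degree `a` does not vanish on general products of `a`
linear forms. -/
lemma exists_ne_zero_eval_eq_apply_prod {a : ℕ} {T : MvPolynomial (Fin 3) k →ₗ[k] k}
    {g : MvPolynomial (Fin 3) k} (hg : g.IsHomogeneous a) (hT : T g ≠ 0) :
    ∃ Q : MvPolynomial (Fin a × Fin 3) k, Q ≠ 0 ∧ ∀ l : Fin a → Fin 3 → k,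
      eval (fun q => l q.1 q.2) Q = T (∏ i, linForm (l i)) := by
  obtain ⟨Q, hQ⟩ := exists_eval_eq_apply_prod (a := a) T
  refine ⟨Q, ?_, hQ⟩
  rintro rfl
  refine hT (eq_zero_of_apply_prod_X (fun s => ?_) hg)
  have := hQ fun i => Pi.single (s i) 1
  simp only [linForm_single] at this
  rw [← this, map_zero]

variable {f : MvPolynomial (Fin 4) k} {ι : Type*} {z : ι → Fin 4 → k} {b : ℕ}

/-- Some form through the points has a restriction to the plane not divisible by that of `f`. -/
lemma exists_not_dvd_res [Fintype ι] (hf : f.IsHomogeneous 3) (hp : Prime f)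
    (hz : ∀ p, eval (z p) f = 0) (hz3 : ∀ p, z p 3 ≠ 0) (hb : b ≠ 0) (hQ : SurjQ b z)
    (hcard : 2 * Fintype.card ι = 3 * (b * (b + 1)) + 2 + 2 * b) :
    ∃ e ∈ vSub z (b + 1), ¬ res f ∣ res e := by
  by_contra! H
  have hM : Mg f z (b + 1) = ⊥ := by
    rw [eq_bot_iff]
    rintro _ ⟨g, hg, rfl⟩
    rw [Submodule.mem_bot]
    refine qmk_eq_zero.2 ?_
    obtain ⟨q, hq, e⟩ := exists_grad_of_dvd (lft_isHomogeneous (res_isHomogeneous hf))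
      (lft_isHomogeneous (res_isHomogeneous hg.1)) (map_dvd lft (H g hg))
    have e' : res g = res f * res q := by
      have := congrArg res e
      rwa [map_mul, res_lft, res_lft] at this
    have h1 := (vSub z (b + 1)).sub_mem hg (mul_mem_vSub hf hz hq)
    obtain ⟨g', hg', h2⟩ := exists_eq_lft_add h1.1
    rw [map_sub, map_mul, e', sub_self, map_zero, zero_add] at h2
    have h3 : f ∣ g' := hQ.dvd hb hf hp hz hcard hg' fun p => by
      have := h1.2 p
      rw [h2, map_mul, eval_X] at this
      exact (mul_eq_zero.1 this).resolve_left (hz3 p)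
    have h4 : g = f * q + X 3 * g' := by
      rw [← h2]
      ring
    rw [h4]
    exact dvd_add (dvd_mul_right _ _) (h3.mul_left _)
  have r1 := finrank_Mg hf hp.ne_zero hz (b + 1)
  rw [hM, finrank_bot] at r1
  have r2 := finrank_vSub (hQ.surjEv_of_lt hb (Nat.lt_succ_self b))
  have r3 := two_mul_choose_add_three (b + 1)
  rw [← r2, ← r1] at r3
  nlinarith

/-- Restrictions to the plane of forms through the points. -/
noncomputable def planeSub (z : ι → Fin 4 → k) (t : ℕ) : Submodule k (MvPolynomial (Fin 3) k) :=
  (vSub z t).map (res (k := k)).toLinearMap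

lemma exists_sub_mem_planeSub (hz3 : ∀ p, z p 3 ≠ 0) (hQ : SurjQ b z)
    {e : Fin 3 → MvPolynomial (Fin 3) k} (he : ∀ m, (e m).IsHomogeneous (b + 1)) :
    ∃ h : MvPolynomial (Fin 3) k, ∀ m, e m - h * X m ∈ planeSub z (b + 1) := by
  let E : Fin 4 → MvPolynomial (Fin 4) k := ![lft (e 0), lft (e 1), lft (e 2), 0]
  have hE : ∀ i, (E i).IsHomogeneous (b + 1) := fun i => by
    fin_cases i
    · exact lft_isHomogeneous (he 0)
    · exact lft_isHomogeneous (he 1)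
    · exact lft_isHomogeneous (he 2)
    · exact isHomogeneous_zero _ _ _
  obtain ⟨w, hw, c, hc⟩ := hQ fun p i => -(eval (z p) (E i) / z p 3)
  refine ⟨res (w 3), fun m => ⟨E m.castSucc + (w m.castSucc * X 3 - w 3 * X m.castSucc),
    ⟨(hE _).add (((hw _).mul (isHomogeneous_X _ _)).sub ((hw _).mul (isHomogeneous_X _ _))),
      fun p => ?_⟩, ?_⟩⟩
  · have h1 := hc p m.castSucc
    have h2 := hc p 3
    have h3 := hz3 p
    have hE3 : E 3 = 0 := rfl
    simp only [hE3, map_zero, zero_div, neg_zero, zero_add] at h2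
    rw [map_add, map_sub, map_mul, map_mul, eval_X, eval_X, h1, h2]
    field_simp
    ring
  · have : res (E m.castSucc) = e m := by
      fin_cases m <;> exact res_lft _
    change res (E m.castSucc + (w m.castSucc * X 3 - w 3 * X m.castSucc)) = _
    rw [map_add, map_sub, map_mul, map_mul, this]
    have h3 : res (X 3 : MvPolynomial (Fin 4) k) = 0 := by simp [res]
    have hm : res (X m.castSucc : MvPolynomial (Fin 4) k) = X m := by
      fin_cases m <;> simp [res]
    rw [h3, hm]
    ring

/-- A linear choice of corrections. -/
lemma exists_linear_correction (hz3 : ∀ p, z p 3 ≠ 0) (hQ : SurjQ b z) {y : Fin 3 → k}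
    {e₀ : MvPolynomial (Fin 3) k} (he₀ : e₀ ∈ planeSub z (b + 1)) (he : e₀.IsHomogeneous (b + 1))
    (hy : eval y e₀ ≠ 0) (i : Fin 3) :
    ∃ l : MvPolynomial (Fin 3) k →ₗ[k] MvPolynomial (Fin 3) k, l e₀ = 0 ∧
      ∀ e : MvPolynomial (Fin 3) k, e.IsHomogeneous (b + 1) →
        ∀ m, (if m = i then e else 0) - l e * X m ∈ planeSub z (b + 1) := by
  let S := homogeneousSubmodule (Fin 3) k (b + 1)
  let P : Submodule k (S × MvPolynomial (Fin 3) k) :=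
    { carrier := {x | ∀ m, (if m = i then (x.1 : MvPolynomial (Fin 3) k) else 0) - x.2 * X m ∈
        planeSub z (b + 1)}
      add_mem' := by
        intro x x' hx hx' m
        have := add_mem (hx m) (hx' m)
        convert this using 1
        simp only [Prod.fst_add, Prod.snd_add, Submodule.coe_add]
        split_ifs <;> ring
      zero_mem' := fun m => by simp
      smul_mem' := by
        intro c x hx m
        have := Submodule.smul_mem _ c (hx m)
        convert this using 1
        simp only [Prod.smul_fst, Prod.smul_snd, Submodule.coe_smul, smul_sub, smul_mul_assoc,
          smul_ite, smul_zero] }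
  obtain ⟨g, hg⟩ := LinearMap.exists_rightInverse_of_surjective
    (LinearMap.fst k S (MvPolynomial (Fin 3) k) ∘ₗ P.subtype) (by
      rw [LinearMap.range_eq_top]
      intro x
      obtain ⟨h, hh⟩ := exists_sub_mem_planeSub hz3 hQ
        (e := fun m => if m = i then (x : MvPolynomial (Fin 3) k) else 0) fun m => by
          split_ifs
          · exact x.2
          · exact isHomogeneous_zero _ _ _
      exact ⟨⟨(x, h), hh⟩, rfl⟩)
  obtain ⟨l, hl⟩ := LinearMap.exists_extend
    (LinearMap.snd k S (MvPolynomial (Fin 3) k) ∘ₗ P.subtype ∘ₗ g)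
  have hl' : ∀ e : MvPolynomial (Fin 3) k, e.IsHomogeneous (b + 1) →
      ∀ m, (if m = i then e else 0) - l e * X m ∈ planeSub z (b + 1) := fun e he m => by
    have h1 := LinearMap.congr_fun hg ⟨e, he⟩
    have h2 := LinearMap.congr_fun hl ⟨e, he⟩
    have h3 := (g ⟨e, he⟩).2 m
    change (g ⟨e, he⟩).1.1 = _ at h1
    change l e = (g ⟨e, he⟩).1.2 at h2
    rw [h1, ← h2] at h3
    exact h3
  have h0 : ∀ m, l e₀ * X m ∈ planeSub z (b + 1) := fun m => by
    have h1 := hl' e₀ he m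
    have h2 : (if m = i then e₀ else 0) ∈ planeSub z (b + 1) := by
      split_ifs
      · exact he₀
      · exact zero_mem _
    have := sub_mem h2 h1
    rwa [sub_sub_cancel] at this
  refine ⟨l - (eval y e₀)⁻¹ • ((aeval y : MvPolynomial (Fin 3) k →ₐ[k] k).toLinearMap.smulRight
    (l e₀)), ?_, fun e he m => ?_⟩
  · simp [smul_smul, inv_mul_cancel₀ hy]
  · have := add_mem (hl' e he m) (Submodule.smul_mem _ ((eval y e₀)⁻¹ * eval y e) (h0 m))
    convert this using 1
    simp [smul_smul, sub_mul]
    ring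

end Plane

section AddPoint

variable {k : Type*} [Field k]

/-- Adding a point where the sections vanishing at the others have maximal rank. -/
lemma SurjQ.sum_elim_point {ι : Type*} {z : ι → Fin 4 → k} {a : ℕ} (h : SurjQ a z)
    {v : Fin 3 → Fin 3 → MvPolynomial (Fin 4) k} (hv : ∀ j m, (v j m).IsHomogeneous a)
    (hvz : ∀ j p, ∃ c, (∀ m : Fin 3, eval (z p) (v j m) = c * z p m.castSucc) ∧ c * z p 3 = 0)
    {y : Fin 4 → k} (hy : y 3 ≠ 0) (hdet : (Matrix.of fun j m => eval y (v j m)).det ≠ 0) :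
    SurjQ a (Sum.elim z fun _ : Unit => y) := by
  intro t
  obtain ⟨V, hV, c, hc⟩ := h fun p => t (Sum.inl p)
  choose d hd hd3 using hvz
  let s := (eval y (V 3) - t (Sum.inr ()) 3) / y 3
  have hu := (Matrix.isUnit_iff_isUnit_det _).2 hdet.isUnit
  obtain ⟨x, hx⟩ := (Matrix.vecMul_surjective_iff_isUnit.2 hu) fun m : Fin 3 =>
    t (Sum.inr ()) m.castSucc + s * y m.castSucc - eval y (V m.castSucc)
  let W : Fin 4 → MvPolynomial (Fin 4) k :=
    Fin.snoc (α := fun _ => MvPolynomial (Fin 4) k) (fun m : Fin 3 => ∑ j, C (x j) * v j m) 0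
  have hWc : ∀ m : Fin 3, W m.castSucc = ∑ j, C (x j) * v j m := fun m => Fin.snoc_castSucc ..
  have hW3 : W 3 = 0 := Fin.snoc_last ..
  refine ⟨fun i => V i + W i, fun i => (hV i).add ?_,
    Sum.elim (fun p => c p + ∑ j, x j * d j p) fun _ => s, ?_⟩
  · induction i using Fin.lastCases with
    | last =>
      rw [show Fin.last 3 = 3 from rfl, hW3]
      exact isHomogeneous_zero _ _ _
    | cast m =>
      rw [hWc]
      exact IsHomogeneous.sum _ _ _ fun j _ => (hv j m).C_mul _
  · rintro (p | p) i
    · simp only [Sum.elim_inl, map_add, hc]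
      induction i using Fin.lastCases with
      | last =>
        rw [show Fin.last 3 = 3 from rfl, hW3, map_zero, add_zero, add_mul, Finset.sum_mul]
        simp only [mul_assoc, hd3, mul_zero, Finset.sum_const_zero, add_zero]
      | cast m =>
        rw [hWc, map_sum, add_mul, ← add_assoc, Finset.sum_mul]
        simp only [map_mul, eval_C, hd, mul_assoc]
    · simp only [Sum.elim_inr, map_add]
      induction i using Fin.lastCases with
      | last =>
        rw [show Fin.last 3 = 3 from rfl, hW3, map_zero, add_zero]
        simp only [s]
        rw [div_mul_cancel₀ _ hy]
        ring
      | cast m =>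
        have := congrFun hx m
        rw [hWc, map_sum]
        simp only [Matrix.vecMul, dotProduct, Matrix.of_apply] at this
        simp only [map_mul, eval_C]
        rw [this]
        ring

end AddPoint

section AddSections

variable {k : Type*} [Field k] {f : MvPolynomial (Fin 4) k} {ι : Type*} {z : ι → Fin 4 → k} {b : ℕ}

lemma LineArrangement.exists_section {f : MvPolynomial (Fin 3) k} (L : LineArrangement f (b + 1))
    (hb : b ≠ 0) {q₀ q₁ : Fin (b + 1) × Fin 3} :
    ∃ p : Fin 3 → MvPolynomial (Fin 3) k, (∀ i, (p i).IsHomogeneous (b + 1)) ∧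
      (∀ q, q ≠ q₀ → ∃ c, ∀ i, eval (L.pt q) (p i) = c * L.pt q i) ∧
      ∃ c, ∀ i, eval (L.pt q₀) (p i) = L.pt q₁ i + c * L.pt q₀ i := by
  classical
  obtain ⟨p, hp, c, hc⟩ := L.mem_valQ (by omega) fun q => if q = q₀ then L.pt q₁ else 0
  refine ⟨p, hp, fun q hq => ⟨c q, fun i => ?_⟩, c q₀, fun i => ?_⟩
  · simp [hc, hq]
  · simp [hc]

lemma combination_mem_planeSub {e : MvPolynomial (Fin 3) k} {g : Fin 3 → MvPolynomial (Fin 3) k}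
    (h : ∀ i m, (if m = i then e else 0) - g i * X m ∈ planeSub z b) (c : Fin 3 → k) (m : Fin 3) :
    C (c m) * e - (∑ i, C (c i) * g i) * X m ∈ planeSub z b := by
  have := sum_mem (S := planeSub z b) (t := Finset.univ)
    fun i (_ : i ∈ Finset.univ) => Submodule.smul_mem _ (c i) (h i m)
  convert this using 1
  simp only [smul_sub, Finset.sum_sub_distrib, smul_ite, smul_zero, Finset.sum_ite_eq,
    Finset.mem_univ, if_true, smul_eq_C_mul, Finset.sum_mul, mul_assoc]

/-- A matrix of forms encoding three corrected sections. -/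
noncomputable def secMatrix (e : MvPolynomial (Fin 3) k) (α : k) (u y : Fin 3 → k)
    (p q : Fin 3 → MvPolynomial (Fin 3) k) (P Q : Fin 3 → k) :
    Matrix (Fin 3) (Fin 3) (MvPolynomial (Fin 3) k) :=
  Matrix.of ![fun m => C α * X m - (∑ i, C (u i) * X i) * C (y m),
    fun m => e * C (P m) - (C α * p m - (∑ i, C (u i) * p i) * C (y m)),
    fun m => e * C (Q m) - (C α * q m - (∑ i, C (u i) * q i) * C (y m))]

lemma eval_det_secMatrix (e : MvPolynomial (Fin 3) k) (α : k) (u y : Fin 3 → k)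
    (p q : Fin 3 → MvPolynomial (Fin 3) k) (P Q : Fin 3 → k) (x : Fin 3 → k) :
    eval x (secMatrix e α u y p q P Q).det =
      (Matrix.of ![fun m => α * x m - (∑ i, u i * x i) * y m,
        fun m => eval x e * P m - (α * eval x (p m) - (∑ i, u i * eval x (p i)) * y m),
        fun m => eval x e * Q m - (α * eval x (q m) - (∑ i, u i * eval x (q i)) * y m)]).det := by
  rw [RingHom.map_det]
  congr 1
  ext j m
  fin_cases j <;> simp [secMatrix]

lemma eval_det_secMatrix_ne_zero {e : MvPolynomial (Fin 3) k} {α : k} {u y : Fin 3 → k}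
    {p q : Fin 3 → MvPolynomial (Fin 3) k} {P Q : Fin 3 → k} {x x₁ x₂ : Fin 3 → k}
    (hx : eval x e = 0) (hα : α ≠ 0) (hu : α - ∑ i, y i * u i ≠ 0) {c d : k}
    (hp : ∀ i, eval x (p i) = x₁ i + c * x i) (hq : ∀ i, eval x (q i) = x₂ i + d * x i)
    (hli : LinearIndependent k ![x, x₁, x₂]) :
    eval x (secMatrix e α u y p q P Q).det ≠ 0 := by
  have h := ((Matrix.isUnit_iff_isUnit_det _).1 ((Matrix.linearIndependent_rows_iff_isUnit
    (A := Matrix.of ![x, x₁, x₂])).1 hli)).ne_zero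
  have key : eval x (secMatrix e α u y p q P Q).det =
      α ^ 2 * (α - ∑ i, y i * u i) * (Matrix.of ![x, x₁, x₂]).det := by
    rw [eval_det_secMatrix]
    simp only [hx, hp, hq, Matrix.det_fin_three, Matrix.of_apply, Matrix.cons_val,
      Fin.sum_univ_three]
    ring
  rw [key]
  exact mul_ne_zero (mul_ne_zero (pow_ne_zero 2 hα) hu) h

set_option maxHeartbeats 1000000 in
lemma exists_plane_sections [IsAlgClosed k] [Fintype ι] (hf : f.IsHomogeneous 3) (hp : Prime f)
    (h3 : ThreeRoots (lineMap (Pi.single 1 1 : Fin 3 → k) (Pi.single 0 1) (res f)))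
    (hz : ∀ p, eval (z p) f = 0) (hz3 : ∀ p, z p 3 ≠ 0) (hb : b ≠ 0) (hQ : SurjQ b z)
    (hcard : 2 * Fintype.card ι = 3 * (b * (b + 1)) + 2 + 2 * b) :
    ∃ (L : LineArrangement (res f) (b + 1)) (y x : Fin 3 → k)
      (r : Fin 3 → Fin 3 → MvPolynomial (Fin 3) k),
      eval y (res f) = 0 ∧ eval x (res f) = 0 ∧ eval x (L.prod Finset.univ) ≠ 0 ∧
      (∀ j m, r j m ∈ planeSub z (b + 1)) ∧
      (∀ j q, q ≠ (0, 0) → ∃ c, ∀ m, eval (L.pt q) (r j m) = c * L.pt q m) ∧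
      (∀ j, ∃ c, ∀ m, eval x (r j m) = c * x m) ∧
      (Matrix.of fun j m => eval y (r j m)).det ≠ 0 := by
  obtain ⟨e, he, hdvd⟩ := exists_not_dvd_res hf hp hz hz3 hb hQ hcard
  obtain ⟨y, hy, hye⟩ : ∃ y, eval y (res f) = 0 ∧ eval y (res e) ≠ 0 := by
    by_contra! h
    exact hdvd (dvd_of_squarefree (fun h => h3.1 (by rw [h, map_zero]))
      (squarefree_of_threeRoots (res_isHomogeneous hf).totalDegree_le h3) h)
  have he₀ : res e ∈ planeSub z (b + 1) := ⟨e, he, rfl⟩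
  have hhom := res_isHomogeneous he.1
  choose l hl0 hl using exists_linear_correction hz3 hQ he₀ hhom hye
  let E : MvPolynomial (Fin 3) k →ₗ[k] k := (aeval y : MvPolynomial (Fin 3) k →ₐ[k] k).toLinearMap
  have hE : ∀ g, E g = eval y g := fun g => rfl
  let T : MvPolynomial (Fin 3) k →ₗ[k] k := E - ∑ i, y i • (E ∘ₗ l i)
  have hT : ∀ g, T g = eval y g - ∑ i, y i * eval y (l i g) := fun g => by
    simp [T, hE]
  obtain ⟨Q₁, hQ₁, hQ₁'⟩ := exists_ne_zero_eval_eq_apply_prod (T := T) hhom (by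
    simpa only [hT, hl0, map_zero, mul_zero, Finset.sum_const_zero, sub_zero] using hye)
  obtain ⟨Q₂, hQ₂, hQ₂'⟩ := exists_ne_zero_eval_eq_apply_prod (T := E) hhom hye
  obtain ⟨L, hL⟩ := exists_lineArrangement (res_isHomogeneous hf) h3 (mul_ne_zero hQ₁ hQ₂)
  rw [map_mul, hQ₁' L.line, hQ₂' L.line] at hL
  set e' := L.prod Finset.univ with he'
  have hTe : T e' ≠ 0 := left_ne_zero_of_mul hL
  have hEe : eval y e' ≠ 0 := right_ne_zero_of_mul hL
  have he'h : e'.IsHomogeneous (b + 1) := by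
    have := L.prod_isHomogeneous Finset.univ
    rwa [Finset.card_univ, Fintype.card_fin] at this
  have hS := combination_mem_planeSub fun i m => hl i e' he'h m
  obtain ⟨p, hph, hpv, cp, hcp⟩ := L.exists_section hb (q₀ := (0, 0)) (q₁ := (0, 1))
  obtain ⟨q, hqh, hqv, cq, hcq⟩ := L.exists_section hb (q₀ := (0, 0)) (q₁ := (1, 0))
  obtain ⟨hp', hhp⟩ := exists_sub_mem_planeSub hz3 hQ hph
  obtain ⟨hq', hhq⟩ := exists_sub_mem_planeSub hz3 hQ hqh
  have h01 : (0 : Fin (b + 1)) ≠ 1 := by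
    obtain ⟨n, rfl⟩ := Nat.exists_eq_succ_of_ne_zero hb
    exact Fin.zero_ne_one
  let M := secMatrix e' (eval y e') (fun i => eval y (l i e')) y p q
    (fun m => eval y (p m) - eval y hp' * y m) fun m => eval y (q m) - eval y hq' * y m
  have hM : ¬ res f ∣ M.det := by
    rintro ⟨g, hg⟩
    refine eval_det_secMatrix_ne_zero (L.eval_prod_univ _) hEe ?_ hcp hcq
      (L.linearIndependent_pt h01) ((congrArg (eval (L.pt (0, 0))) hg).trans ?_)
    · rwa [hT] at hTe
    · rw [map_mul, L.root, zero_mul]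
  obtain ⟨x, hx, hxe, hxM⟩ := L.exists_eval_prod_mul_ne_zero (res_isHomogeneous hf) h3 hM
  let sec : (Fin 3 → k) → Fin 3 → MvPolynomial (Fin 3) k := fun c m =>
    C (c m) * e' - (∑ i, C (c i) * l i e') * X m
  let sec' : (Fin 3 → MvPolynomial (Fin 3) k) → MvPolynomial (Fin 3) k →
      Fin 3 → MvPolynomial (Fin 3) k := fun p h m =>
    C (eval x e') * (p m - h * X m) - sec (fun i => eval x (p i)) m
  have hsec' : ∀ p h, (∀ m, p m - h * X m ∈ planeSub z (b + 1)) →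
      ∀ m, sec' p h m ∈ planeSub z (b + 1) := fun p h hph m => by
    have := Submodule.sub_mem _ (Submodule.smul_mem _ (eval x e') (hph m))
      (hS (fun i => eval x (p i)) m)
    rwa [smul_eq_C_mul] at this
  have hsecL : ∀ c q, ∃ d, ∀ m, eval (L.pt q) (sec c m) = d * L.pt q m := fun c q =>
    ⟨- ∑ i, c i * eval (L.pt q) (l i e'), fun m => by
      have h0 : eval (L.pt q) e' = 0 := L.eval_prod_univ _
      simp [sec, h0]⟩
  have hsecL' : ∀ p h q, (∃ c, ∀ i, eval (L.pt q) (p i) = c * L.pt q i) →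
      ∃ d, ∀ m, eval (L.pt q) (sec' p h m) = d * L.pt q m := fun p h q ⟨c, hc⟩ => by
    obtain ⟨d, hd⟩ := hsecL (fun i => eval x (p i)) q
    refine ⟨eval x e' * (c - eval (L.pt q) h) - d, fun m => ?_⟩
    simp only [sec', map_sub, map_mul, eval_C, eval_X, hd, hc]
    ring
  have hsecx : ∃ d, ∀ m, eval x (sec x m) = d * x m :=
    ⟨eval x e' - ∑ i, x i * eval x (l i e'), fun m => by
      simp [sec]
      ring⟩
  have hsecx' : ∀ p h, ∃ d, ∀ m, eval x (sec' p h m) = d * x m := fun p h =>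
    ⟨∑ i, eval x (p i) * eval x (l i e') - eval x e' * eval x h, fun m => by
      simp [sec', sec]
      ring⟩
  refine ⟨L, y, x, ![sec x, sec' p hp', sec' q hq'], hy, hx, hxe, fun j => ?_, fun j v hv => ?_,
    fun j => ?_, ?_⟩
  · fin_cases j
    · exact hS x
    · exact hsec' p hp' hhp
    · exact hsec' q hq' hhq
  · fin_cases j
    · exact hsecL x v
    · exact hsecL' p hp' v (hpv v hv)
    · exact hsecL' q hq' v (hqv v hv)
  · fin_cases j
    · exact hsecx
    · exact hsecx' p hp'
    · exact hsecx' q hq'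
  · rw [eval_det_secMatrix] at hxM
    convert hxM using 2
    ext j m
    fin_cases j
    · simp only [sec, Matrix.of_apply, Matrix.cons_val, Fin.zero_eta, Fin.isValue, map_sub,
        map_mul, eval_C, eval_X, map_sum, mul_comm]
    · simp [sec', sec, mul_comm]
    · simp [sec', sec, mul_comm]

end AddSections

section Induction

variable {k : Type*} [Field k] {f : MvPolynomial (Fin 4) k}

theorem SurjQ.exists_succ [IsAlgClosed k] {ι : Type} [Fintype ι] {z : ι → Fin 4 → k} {b : ℕ}
    (hf : f.IsHomogeneous 3) (hp : Prime f)
    (h3 : ThreeRoots (lineMap (Pi.single 1 1 : Fin 3 → k) (Pi.single 0 1) (res f)))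
    (hz : ∀ p, eval (z p) f = 0) (hz3 : ∀ p, z p 3 ≠ 0) (hb : b ≠ 0) (hQ : SurjQ b z)
    (hcard : 2 * Fintype.card ι = 3 * (b * (b + 1)) + 2 + 2 * b) :
    ∃ (Z : Type) (_ : Fintype Z) (w : Z → Fin 4 → k),
      Fintype.card Z = Fintype.card ι + (3 * (b + 1) + 1) ∧ (∀ p, eval (w p) f = 0) ∧
      SurjQ (b + 1) w := by
  classical
  obtain ⟨L, y, x, r, hy, hx, hxL, hr, hrL, hrx, hdet⟩ :=
    exists_plane_sections hf hp h3 hz hz3 hb hQ hcard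
  choose v hv hvr using hr
  have hvr' : ∀ (u : Fin 3 → k) j m, eval (pl u) (v j m) = eval u (r j m) := fun u j m => by
    rw [← eval_res, ← hvr]
    rfl
  have hS := hQ.sum_elim hz3 (L.surjQ hb hxL) (by
    rintro (p | p)
    · exact pl_three _
    · exact pl_three _)
  let D : MvPolynomial (Fin 4) k :=
    (Matrix.of v : Matrix (Fin 3) (Fin 3) (MvPolynomial (Fin 4) k)).det
  have hD : ∀ u, eval u D = (Matrix.of fun j m => eval u (v j m)).det := fun u => by
    rw [RingHom.map_det]
    rfl
  obtain ⟨x', hx', hx3⟩ := exists_eval_ne_zero_of_not_dvd hp (not_dvd_X hf 3)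
  obtain ⟨u, hu, huD, hu3⟩ := exists_common_ne_zero hp (u₁ := pl y) (u₂ := x') (g₁ := D)
    (by rw [← eval_res, hy]) hx' (by simpa only [hD, hvr'] using hdet) hx3
  rw [hD] at huD
  rw [eval_X] at hu3
  refine ⟨_, inferInstance, _, ?_, ?_, hS.sum_elim_point (fun j m => (hv j m).1) ?_ hu3 huD⟩
  · have : Fintype.card {q : Fin (b + 1) × Fin 3 // q ≠ (0, 0)} = 3 * b + 2 := by
      rw [Fintype.card_subtype_compl, Fintype.card_subtype_eq, Fintype.card_prod, Fintype.card_fin,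
        Fintype.card_fin]
      omega
    rw [Fintype.card_sum, Fintype.card_sum, Fintype.card_sum, this, Fintype.card_unit]
    ring
  · rintro ((p | q | p) | p)
    · exact hz p
    · simp only [Sum.elim_inr, Sum.elim_inl]
      rw [← eval_res, L.root]
    · simp only [Sum.elim_inr, Sum.elim_inl]
      rw [← eval_res, hx]
    · exact hu
  · rintro j (p | q | p)
    · exact ⟨0, fun m => by simpa using (hv j m).2 p, zero_mul _⟩
    · obtain ⟨c, hc⟩ := hrL j q q.2
      refine ⟨c, fun m => ?_, ?_⟩
      · simp only [Sum.elim_inr, Sum.elim_inl, hvr', pl_castSucc]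
        exact hc m
      · simp only [Sum.elim_inr, Sum.elim_inl, pl_three, mul_zero]
    · obtain ⟨c, hc⟩ := hrx j
      refine ⟨c, fun m => ?_, ?_⟩
      · simp only [Sum.elim_inr, hvr', pl_castSucc]
        exact hc m
      · simp only [Sum.elim_inr, pl_three, mul_zero]

theorem exists_surjQ [IsAlgClosed k] (hf : f.IsHomogeneous 3) (hp : Prime f)
    (h3 : ThreeRoots (lineMap (Pi.single 1 1 : Fin 3 → k) (Pi.single 0 1) (res f))) {a : ℕ}
    (ha : a ≠ 0) : ∃ (Z : Type) (_ : Fintype Z) (z : Z → Fin 4 → k),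
      2 * Fintype.card Z = 3 * (a * (a + 1)) + 2 + 2 * a ∧ (∀ p, eval (z p) f = 0) ∧
      SurjQ a z := by
  induction a, Nat.one_le_iff_ne_zero.2 ha using Nat.le_induction with
  | base =>
    obtain ⟨M, N, hMN, h⟩ := exists_frame hf hp
    exact ⟨_, inferInstance, _, by simp, h, surjQ_frame.map hMN⟩
  | succ b hb ih =>
    have hb0 : b ≠ 0 := by omega
    obtain ⟨Z, _, z, hcard, hz, hQ⟩ := ih hb0
    obtain ⟨G, hG, hG'⟩ := hQ.exists_open
    obtain ⟨u, hu, hu1, hu2⟩ := exists_config_off_plane hf hp hz hG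
    obtain ⟨W, i, w, hw, hwf, hwQ⟩ := (hG' u hu1).exists_succ hf hp h3 hu hu2 hb0 hcard
    refine ⟨W, i, w, ?_, hwf, hwQ⟩
    rw [hw]
    nlinarith

end Induction

section Assembly

lemma SurjQ.comp {k : Type*} [Field k] {ι κ : Type*} {z : ι → Fin 4 → k} {a : ℕ} (h : SurjQ a z)
    (e : κ ≃ ι) : SurjQ a fun p => z (e p) := fun t => by
  obtain ⟨v, hv, c, hc⟩ := h fun p => t (e.symm p)
  exact ⟨v, hv, fun p => c (e p), fun p i => by rw [hc, e.symm_apply_apply]⟩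

lemma SurjO.comp {k : Type*} [Field k] {ι κ : Type*} {z : ι → Fin 4 → k} {a : ℕ} (h : SurjO a z)
    (e : κ ≃ ι) : SurjO a fun p => z (e p) := fun t ht => by
  obtain ⟨b, h1, h2, h3, h4⟩ := h (fun p => t (e.symm p)) fun p => by
    simpa using ht (e.symm p)
  exact ⟨b, h1, h2, h3, fun p i => by rw [h4, e.symm_apply_apply]⟩

lemma SurjQ.ne_smul {k : Type*} [Field k] {ι : Type*} {z : ι → Fin 4 → k} {a : ℕ}
    (h : SurjQ a z) {p q : ι} (hpq : p ≠ q) (r : k) : z q ≠ r • z p := by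
  classical
  intro hr
  have key : ∀ i, ∃ d : k, (Pi.single i 1 : Fin 4 → k) = d • z p := fun i => by
    obtain ⟨v, hv, c, hc⟩ := h fun x => if x = q then Pi.single i 1 else 0
    refine ⟨r ^ a * c p - c q * r, funext fun j => ?_⟩
    have h1 := hc p j
    have h2 := hc q j
    rw [hr, eval_smul_of_isHomogeneous (hv j), h1] at h2
    simp only [hpq, if_false, Pi.zero_apply, zero_add, if_true, Pi.smul_apply, smul_eq_mul] at h2
    rw [Pi.smul_apply, smul_eq_mul, sub_mul, mul_assoc, h2]
    ring
  obtain ⟨d, hd⟩ := key 0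
  obtain ⟨d', hd'⟩ := key 1
  have h1 := congrFun hd 0
  have h2 := congrFun hd 1
  have h3 := congrFun hd' 1
  simp only [Pi.single_eq_same, Pi.smul_apply, smul_eq_mul] at h1 h2 h3
  rw [Pi.single_eq_of_ne (by decide)] at h2
  rcases mul_eq_zero.1 h2.symm with h | h
  · rw [h, zero_mul] at h1
    exact one_ne_zero h1
  · rw [h, mul_zero] at h3
    exact one_ne_zero h3

lemma prime_linSubst {k : Type*} [Field k] [Infinite k] {M N : Matrix (Fin 4) (Fin 4) k}
    (hMN : M * N = 1) (hNM : N * M = 1) {f : MvPolynomial (Fin 4) k} (hp : Prime f) :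
    Prime (linSubst M f) := by
  let e : MvPolynomial (Fin 4) k ≃ₐ[k] MvPolynomial (Fin 4) k :=
    AlgEquiv.ofAlgHom (linSubst M) (linSubst N) (AlgHom.ext fun g => linSubst_linSubst hNM g)
      (AlgHom.ext fun g => linSubst_linSubst hMN g)
  exact (MulEquiv.prime_iff (e : MvPolynomial (Fin 4) k ≃* MvPolynomial (Fin 4) k)).2 hp

lemma lineMap_res {k : Type*} [Field k] [Infinite k] (f : MvPolynomial (Fin 4) k) :
    lineMap (Pi.single 1 1 : Fin 3 → k) (Pi.single 0 1) (res f) =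
      lineMap (Pi.single 1 1 : Fin 4 → k) (Pi.single 0 1) f := by
  refine Polynomial.funext fun t => ?_
  rw [eval_lineMap, eval_lineMap, eval_res]
  congr 2
  ext i
  fin_cases i <;> simp [pl]

theorem exists_surj {k : Type*} [Field k] [IsAlgClosed k] {f : MvPolynomial (Fin 4) k}
    (hf : f.IsHomogeneous 3)
    (hp : Prime f) (hs : ∀ v ≠ 0, eval v f = 0 → ∃ i, eval v (pderiv i f) ≠ 0) {a n : ℕ}
    (ha : a ≠ 0) (hn : 2 * n = 3 * (a * (a + 1)) + 2 + 2 * a) :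
    (∃ z : Fin n → Fin 4 → k, (∀ p, eval (z p) f = 0) ∧ SurjQ a z) ∧
      ∃ z : Fin n → Fin 4 → k, (∀ p, eval (z p) f = 0) ∧ SurjO a z := by
  have : Infinite k := IsAlgClosed.instInfinite
  obtain ⟨M, N, hMN, hNM, h3⟩ := exists_good_coords hf hp hs
  rw [← lineMap_res] at h3
  have hf' := linSubst_isHomogeneous M hf
  have hp' := prime_linSubst hMN hNM hp
  constructor
  · obtain ⟨Z, _, z, hZ, hz, hQ⟩ := exists_surjQ hf' hp' h3 ha
    have e : Fin n ≃ Z := Fintype.equivOfCardEq (by rw [Fintype.card_fin]; omega)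
    exact ⟨_, fun p => by rw [← eval_linSubst]; exact hz (e p), (hQ.comp e).map hMN⟩
  · obtain ⟨Z, _, z, hZ, hz, hO⟩ := exists_surjO hf' hp' h3 ha
    have e : Fin n ≃ Z := Fintype.equivOfCardEq (by rw [Fintype.card_fin]; omega)
    exact ⟨_, fun p => by rw [← eval_linSubst]; exact hz (e p), (hO.comp e).map hMN⟩

lemma eval_homogeneousComponent_eq_zero {k σ : Type*} [Field k] [Infinite k] [Fintype σ]
    {g : MvPolynomial σ k} {v : σ → k} (h : ∀ s : k, s ≠ 0 → eval (s • v) g = 0) (t : ℕ) :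
    eval v (homogeneousComponent t g) = 0 := by
  let F : Polynomial k := ∑ i ∈ Finset.range (g.totalDegree + 1),
    Polynomial.monomial i (eval v (homogeneousComponent i g))
  have hF : ∀ s, F.eval s = eval (s • v) g := fun s => by
    conv_rhs => rw [← sum_homogeneousComponent g]
    simp only [F, Polynomial.eval_finsetSum, Polynomial.eval_monomial, map_sum]
    exact Finset.sum_congr rfl fun i _ => by
      rw [eval_smul_of_isHomogeneous (homogeneousComponent_isHomogeneous i g), mul_comm]
  have h0 : Polynomial.X * F = 0 := Polynomial.funext fun s => by
    rw [Polynomial.eval_mul, Polynomial.eval_X, hF, Polynomial.eval_zero, mul_eq_zero,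
      or_iff_not_imp_left]
    exact h s
  have h1 : F = 0 := (mul_eq_zero.1 h0).resolve_left Polynomial.X_ne_zero
  by_cases ht : t ∈ Finset.range (g.totalDegree + 1)
  · have := congrArg (fun P => Polynomial.coeff P t) h1
    simpa [F, Polynomial.finsetSum_coeff, Polynomial.coeff_monomial, Finset.mem_range.1 ht]
      using this
  · rw [homogeneousComponent_eq_zero _ _ (by simpa using ht), map_zero]

lemma mem_pointsIdeal_iff {k : Type} [Field k] [Infinite k] {n : ℕ} {Z : Fin n → P3 k}
    {v : Fin n → Fin 4 → k} (hv : ∀ i, ∃ h : v i ≠ 0, Projectivization.mk k (v i) h = Z i)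
    (g : R4 k) : g ∈ pointsIdeal k (Set.range Z) ↔
      ∀ t p, eval (v p) (homogeneousComponent t g) = 0 := by
  constructor
  · intro h t p
    obtain ⟨h0, hp⟩ := hv p
    refine eval_homogeneousComponent_eq_zero (fun s hs => ?_) t
    refine h (Z p) ⟨p, rfl⟩ (s • v p) (smul_ne_zero hs h0) ?_
    rw [← hp, Projectivization.mk_eq_mk_iff']
    exact ⟨s, rfl⟩
  · rintro h _ ⟨p, rfl⟩ w hw e
    obtain ⟨h0, hp⟩ := hv p
    rw [← hp, Projectivization.mk_eq_mk_iff'] at e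
    obtain ⟨s, rfl⟩ := e
    rw [← sum_homogeneousComponent g, map_sum]
    refine Finset.sum_eq_zero fun i _ => ?_
    rw [eval_smul_of_isHomogeneous (homogeneousComponent_isHomogeneous i g), h, mul_zero]

/-- The resolution of general points, without any assumption on other sets of points. -/
theorem generalPointsSatisfy_hasMinFreeRes3 {k : Type} [Field k] [IsAlgClosed k]
    (S : SmoothCubicSurface k) {a n : ℕ} (ha : a ≠ 0)
    (hn : 2 * n = 3 * (a * (a + 1)) + 2 + 2 * a) :
    GeneralPointsSatisfy k S n (fun Z =>
      HasMinFreeRes3 k (Ideal.span {S.f}) (pointsIdeal k (Set.range Z))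
        (fun _ : Fin (2 * a + 3) => a + 1)
        (fun _ : Fin (3 * a + 3) => a + 2)
        (fun _ : Fin a => a + 4)) := by
  have : Infinite k := IsAlgClosed.instInfinite
  have hp : Prime S.f := S.irred.prime
  obtain ⟨⟨z₁, hz₁, hQ⟩, z₂, hz₂, hO⟩ := exists_surj S.homog hp S.smooth ha hn
  obtain ⟨G₁, h₁, hG₁⟩ := hQ.exists_open
  obtain ⟨G₂, h₂, hG₂⟩ := hO.exists_open hO.ne_zero
  refine ⟨G₁ * G₂, ?_, fun Z hZ ⟨v, hv, hG⟩ => ?_⟩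
  · obtain ⟨u, hu, hu₁, hu₂⟩ := exists_config_ne_zero hp hz₁ hz₂ h₁ h₂
    have hQu := hG₁ u hu₁
    have hu0 := hQu.ne_zero ha
    refine ⟨fun p => Projectivization.mk k (u p) (hu0 p), ⟨fun p q e => ?_, fun p w hw e => ?_⟩,
      u, fun p => ⟨hu0 p, rfl⟩, ?_⟩
    · by_contra hpq
      obtain ⟨r, hr⟩ := (Projectivization.mk_eq_mk_iff' ..).1 e
      exact hQu.ne_smul (Ne.symm hpq) r hr.symm
    · obtain ⟨r, rfl⟩ := (Projectivization.mk_eq_mk_iff' ..).1 e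
      rw [eval_smul_of_isHomogeneous S.homog, hu, mul_zero]
    · rw [map_mul]
      exact mul_ne_zero hu₁ hu₂
  · rw [map_mul] at hG
    exact hasMinFreeRes3 S.homog hp (fun p => (hv p).elim fun h e => hZ.2 p (v p) h e) ha
      (hG₁ v (left_ne_zero_of_mul hG)) (hG₂ v (right_ne_zero_of_mul hG))
      (by rw [Fintype.card_fin, hn]) (mem_pointsIdeal_iff hv)

end Assembly

end CubicLink

/-- Fourth link.  If a general set of `p(a)` points on `X` has
`0 → R(-a-3)^(2a) → R(-a-2)^(3a+3) → R(-a)^a ⊕ R(-a-1)^3 → I_(Z,X) → 0` as graded minimal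
free resolution over `R`, then a general set of `m(a+1)` points on `X` has graded minimal free
resolution `0 → R(-a-4)^a → R(-a-2)^(3a+3) → R(-a-1)^(2a+3) → I_(Z,X) → 0`. -/
theorem fourth_link (k : Type) [Field k] [IsAlgClosed k]
    (S : SmoothCubicSurface k) (a : ℕ) (ha : 1 ≤ a)
    (hyp : GeneralPointsSatisfy k S (3 * (a * (a - 1) / 2) + 2 * a + 1) (fun Z =>
      HasMinFreeRes3 k (Ideal.span {S.f}) (pointsIdeal k (Set.range Z))
        (Fin.append (fun _ : Fin (a) => a) (fun _ : Fin (3) => a + 1))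
        (fun _ : Fin (3 * a + 3) => a + 2)
        (fun _ : Fin (2 * a) => a + 3))) :
    GeneralPointsSatisfy k S (3 * ((a + 1) * a / 2) + (a + 1)) (fun Z =>
      HasMinFreeRes3 k (Ideal.span {S.f}) (pointsIdeal k (Set.range Z))
        (fun _ : Fin (2 * a + 3) => a + 1)
        (fun _ : Fin (3 * a + 3) => a + 2)
        (fun _ : Fin (a) => a + 4)) := by
  refine CubicLink.generalPointsSatisfy_hasMinFreeRes3 S (Nat.one_le_iff_ne_zero.1 ha) ?_
  rw [mul_comm (a + 1) a]
  have := Nat.div_mul_cancel (Nat.even_mul_succ_self a).two_dvd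
  lia
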